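/- arXiv:1607.04529 — 2 statements merged into one kernel-verified Lean document; each statement's English description precedes it below -/
import Mathlib

section
/- Let R be a Noetherian ring, 𝔞 ⊊ R a proper ideal, and M a finite RCMF R-module with respect to 𝔞. Then for every prime ideal 𝔭 ∈ Supp_R(M) ∩ V(𝔞), the localization M_𝔭 is an RCMF R_𝔭-module with respect to 𝔞R_𝔭. -/
open CategoryTheory

noncomputable section

/-- The cohomological dimension `cd(𝔞, M)`: the supremum (in `ℕ`) of the set of
indices `i` with `H^i_𝔞(M) ≠ 0`, local cohomology being taken w.r.t. `𝔞`. -/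
def cohDim {R : Type} [CommRing R] (I : Ideal R) (M : Type) [AddCommGroup M] [Module R M] : ℕ :=
  sSup {i : ℕ | Nontrivial ((localCohomology I i).obj (ModuleCat.of R M))}

/-- `M` is relative Cohen-Macaulay w.r.t. `𝔞` if there is precisely one non-vanishing
local cohomology module of `M` w.r.t. `𝔞`. -/
def IsRelCM {R : Type} [CommRing R] (I : Ideal R) (M : Type) [AddCommGroup M] [Module R M] :
    Prop :=
  ∃ c : ℕ, ∀ i : ℕ, Nontrivial ((localCohomology I i).obj (ModuleCat.of R M)) ↔ i = c

/-- `f : K →ₗ[R] E` exhibits `E` as an injective hull of `K`: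
`E` is an injective module and `f` is an essential monomorphism. -/
structure IsInjectiveHull (R : Type) [CommRing R] {K E : Type} [AddCommGroup K] [Module R K]
    [AddCommGroup E] [Module R E] (f : K →ₗ[R] E) : Prop where
  injective : Module.Injective R E
  inj : Function.Injective f
  essential : ∀ N : Submodule R E, N ≠ ⊥ → N ⊓ LinearMap.range f ≠ ⊥

/-- `F` is the cohomological dimension filtration (cd-filtration) of `M` in the range
`0 ≤ i ≤ c`: `F i` is the largest submodule of `M` of cohomological dimension `≤ i`. -/
def IsCdFiltration {R : Type} [CommRing R] (I : Ideal R) {M : Type} [AddCommGroup M]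
    [Module R M] (c : ℕ) (F : ℕ → Submodule R M) : Prop :=
  ∀ i ≤ c, cohDim I (F i) ≤ i ∧ ∀ N : Submodule R M, cohDim I N ≤ i → N ≤ F i

/-- The `i`-th factor `M_i / M_{i-1}` of a filtration `F` of `M`. -/
def filtFactor {R : Type} [CommRing R] {M : Type} [AddCommGroup M] [Module R M]
    (F : ℕ → Submodule R M) (i : ℕ) : Type :=
  ↥(F i) ⧸ Submodule.comap (F i).subtype (F (i - 1))

instance {R : Type} [CommRing R] {M : Type} [AddCommGroup M] [Module R M]
    (F : ℕ → Submodule R M) (i : ℕ) : AddCommGroup (filtFactor F i) :=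
  inferInstanceAs (AddCommGroup (↥(F i) ⧸ Submodule.comap (F i).subtype (F (i - 1))))

instance {R : Type} [CommRing R] {M : Type} [AddCommGroup M] [Module R M]
    (F : ℕ → Submodule R M) (i : ℕ) : Module R (filtFactor F i) :=
  inferInstanceAs (Module R (↥(F i) ⧸ Submodule.comap (F i).subtype (F (i - 1))))

/-- `M` is a relative Cohen-Macaulay filtered (RCMF) module w.r.t. `𝔞`: every factor
`M_i/M_{i-1}` (`1 ≤ i ≤ c = cd(𝔞,M)`) of its cd-filtration is either zero or an
`i`-cohomological dimensional relative Cohen-Macaulay module w.r.t. `𝔞`. -/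
def IsRCMF {R : Type} [CommRing R] (I : Ideal R) (M : Type) [AddCommGroup M] [Module R M] :
    Prop :=
  ∀ F : ℕ → Submodule R M, IsCdFiltration I (cohDim I M) F →
    ∀ i : ℕ, 1 ≤ i → i ≤ cohDim I M →
      Subsingleton (filtFactor F i) ∨
        (IsRelCM I (filtFactor F i) ∧ cohDim I (filtFactor F i) = i)

end

section
open CategoryTheory Opposite Limits

lemma rcmf_lc_iff {R : Type} [CommRing R] (I : Ideal R) (i : ℕ) (M : ModuleCat.{0} R) :
    Subsingleton ((localCohomology I i).obj M) ↔
      ∀ (n : ℕ) (e : ((Ext R (ModuleCat.{0} R) i).obj (op (ModuleCat.of R (R ⧸ I ^ n)))).obj M),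
        ∃ (m : ℕ) (h : n ≤ m),
          (((Ext R (ModuleCat.{0} R) i).map
            (ModuleCat.ofHom (Submodule.mapQ (I ^ m) (I ^ n) LinearMap.id
              (Ideal.pow_le_pow_right h))).op).app M) e = 0 := by
  let D := localCohomology.diagram (localCohomology.idealPowersDiagram I) i
  let D' := D ⋙ (evaluation _ _).obj M
  have e1 : (localCohomology I i).obj M ≅ colimit D' := colimitObjIsoColimitCompEvaluation D M
  have e2 : Subsingleton ((localCohomology I i).obj M) ↔ Subsingleton (colimit D' : ModuleCat R) :=
    e1.toLinearEquiv.toEquiv.subsingleton_congr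
  rw [e2]
  constructor
  · intro hs n e
    have : colimit.ι D' (op (op n)) e = 0 := Subsingleton.elim _ _
    obtain ⟨j, f, h⟩ := Concrete.colimit_rep_eq_zero (hx := this)
    exact ⟨j.unop.unop, f.unop.unop.down.down, h⟩
  · intro H
    refine subsingleton_of_forall_eq 0 fun x => ?_
    obtain ⟨j, y, rfl⟩ := Concrete.colimit_exists_rep (C := ModuleCat R) D' x
    obtain ⟨m, h, hm⟩ := H j.unop.unop y
    let f : j ⟶ op (op m) := (homOfLE h).op.op
    have h2 : D'.map f y = 0 := hm
    have h3 := congrArg (fun g => g y) (congrArg (fun g => g.hom) (colimit.w D' f))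
    refine h3.symm.trans ?_
    exact (congrArg (colimit.ι D' (op (op m))) h2).trans (map_zero _)

end

section
open CategoryTheory Opposite Limits

noncomputable section
section
variable {R : Type} [CommRing R] {L Y : ModuleCat.{0} R} (P : ProjectiveResolution L)

/-- The opposite Hom complex. -/
abbrev rcmfK (Y : ModuleCat.{0} R) : ChainComplex (ModuleCat.{0} R)ᵒᵖ ℕ :=
  (((linearYoneda R (ModuleCat.{0} R)).obj Y).rightOp.mapHomologicalComplex _).obj P.complex

/-- The cocycle `f` represents the class `e`. -/
def rcmfRep (i : ℕ) (e : ((Ext R (ModuleCat.{0} R) i).obj (op L)).obj Y)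
    (f : P.complex.X i ⟶ Y) : Prop :=
  ∃ z : ((rcmfK P Y).opcycles i).unop,
    (((rcmfK P Y).pOpcycles i).unop).hom z = f ∧
    e = ((P.isoLeftDerivedObj ((linearYoneda R (ModuleCat.{0} R)).obj Y).rightOp i).hom.unop).hom
      ((((rcmfK P Y).homologyι i).unop).hom z)

lemma rcmfRep_exists (i : ℕ) (e : ((Ext R (ModuleCat.{0} R) i).obj (op L)).obj Y) :
    ∃ f, rcmfRep P i e f := by
  have h1 : Function.Surjective ((P.isoLeftDerivedObj ((linearYoneda R (ModuleCat.{0} R)).obj Y).rightOp i).hom.unop).hom :=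
    (ModuleCat.epi_iff_surjective _).1 inferInstance
  have h2 : Function.Surjective (((rcmfK P Y).homologyι i).unop).hom :=
    (ModuleCat.epi_iff_surjective _).1 inferInstance
  obtain ⟨y, hy⟩ := h1 e
  obtain ⟨z, hz⟩ := h2 y
  exact ⟨_, z, rfl, by rw [hz, hy]⟩

lemma rcmfRep_cocycle (i : ℕ) (e : ((Ext R (ModuleCat.{0} R) i).obj (op L)).obj Y)
    (f : P.complex.X i ⟶ Y) (h : rcmfRep P i e f) : P.complex.d (i+1) i ≫ f = 0 := by
  obtain ⟨z, hz, -⟩ := h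
  have := congrArg (fun g => g.unop.hom z) ((rcmfK P Y).d_pOpcycles (i+1) i)
  rw [← hz]
  exact this

lemma rcmfRep_of_cocycle (i : ℕ) (f : P.complex.X i ⟶ Y) (h : P.complex.d (i+1) i ≫ f = 0) :
    ∃ e, rcmfRep P i e f := by
  have hc := ShortComplex.exact_of_g_is_cokernel (ShortComplex.mk _ _ ((rcmfK P Y).d_pOpcycles (i+1) i))
    ((rcmfK P Y).opcyclesIsCokernel (i+1) i (by simp))
  have hu := (ShortComplex.moduleCat_exact_iff _).1 hc.unop
  obtain ⟨z, hz⟩ := hu f h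
  exact ⟨_, z, hz, rfl⟩

lemma rcmfRep_eq_zero_iff (i j : ℕ) (hj : (ComplexShape.down ℕ).next i = j)
    (e : ((Ext R (ModuleCat.{0} R) i).obj (op L)).obj Y)
    (f : P.complex.X i ⟶ Y) (h : rcmfRep P i e f) :
    e = 0 ↔ ∃ g : P.complex.X j ⟶ Y, P.complex.d i j ≫ g = f := by
  obtain ⟨z, hz, rfl⟩ := h
  have h1 : Function.Injective ((P.isoLeftDerivedObj ((linearYoneda R (ModuleCat.{0} R)).obj Y).rightOp i).hom.unop).hom :=
    (ModuleCat.mono_iff_injective _).1 inferInstance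
  have h2 : Function.Injective (((rcmfK P Y).pOpcycles i).unop).hom :=
    (ModuleCat.mono_iff_injective _).1 inferInstance
  have hc := ShortComplex.exact_of_f_is_kernel
    (ShortComplex.mk _ _ ((rcmfK P Y).homologyι_comp_fromOpcycles i j))
    ((rcmfK P Y).homologyIsKernel i j hj)
  have hu := (ShortComplex.moduleCat_exact_iff _).1 hc.unop
  have h0 := congrArg (fun g => g.unop.hom) ((rcmfK P Y).homologyι_comp_fromOpcycles i j)
  have hp := congrArg (fun g => g.unop.hom) ((rcmfK P Y).p_fromOpcycles i j)
  refine Iff.trans (map_eq_zero_iff _ h1) ?_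
  constructor
  · intro hz0
    obtain ⟨g, hg⟩ := hu z hz0
    refine ⟨g, ?_⟩
    rw [← hz, ← hg]
    exact (congrArg (fun q => q g) hp).symm
  · rintro ⟨g, hg⟩
    have : z = ((rcmfK P Y).fromOpcycles i j).unop.hom g := by
      apply h2
      rw [hz, ← hg]
      exact (congrArg (fun q => q g) hp).symm
    rw [this]
    exact congrArg (fun q => q g) h0

lemma rcmfRep_map {L' : ModuleCat.{0} R} (P' : ProjectiveResolution L') (u : L' ⟶ L)
    (φ : P'.complex ⟶ P.complex) (comm : φ.f 0 ≫ P.π.f 0 = P'.π.f 0 ≫ u) (i : ℕ)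
    (e : ((Ext R (ModuleCat.{0} R) i).obj (op L)).obj Y)
    (f : P.complex.X i ⟶ Y) (h : rcmfRep P i e f) :
    rcmfRep P' i ((((Ext R (ModuleCat.{0} R) i).map u.op).app Y).hom e) (φ.f i ≫ f) := by
  obtain ⟨z, hz, rfl⟩ := h
  let F := ((linearYoneda R (ModuleCat.{0} R)).obj Y).rightOp
  let ψ : rcmfK P' Y ⟶ rcmfK P Y := (F.mapHomologicalComplex _).map φ
  refine ⟨(HomologicalComplex.opcyclesMap ψ i).unop.hom z, ?_, ?_⟩
  · have := congrArg (fun g => g.unop.hom z) (HomologicalComplex.p_opcyclesMap ψ i)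
    rw [← hz]
    exact this
  · have h1 := congrArg (fun g => g.unop.hom)
      (ProjectiveResolution.isoLeftDerivedObj_hom_naturality u P' P φ comm F i)
    have h2 := congrArg (fun g => g.unop.hom z) (HomologicalComplex.homologyι_naturality ψ i)
    refine (congrArg (fun q => q (((rcmfK P Y).homologyι i).unop.hom z)) h1).trans ?_
    exact congrArg ((P'.isoLeftDerivedObj F i).hom.unop.hom) h2

end
end

end

section
open CategoryTheory Opposite Limits

noncomputable section
section
variable {R : Type} [CommRing R]

lemma rcmf_extMk_zero {L Y : ModuleCat.{0} R} (P : ProjectiveResolution L) (n : ℕ) (f : P.complex.X n ⟶ Y)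
    (hf : P.complex.d (n+1) n ≫ f = 0) (j : ℕ) (hj : (ComplexShape.down ℕ).next n = j) :
    P.extMk f (n+1) rfl hf = 0 ↔ ∃ g : P.complex.X j ⟶ Y, P.complex.d n j ≫ g = f := by
  rcases n with _ | n
  · simp only [ChainComplex.next_nat_zero] at hj
    subst hj
    have h0 : P.complex.d 0 0 = 0 := P.complex.shape _ _ (by simp)
    rw [h0]
    constructor
    · intro h
      refine ⟨0, ?_⟩
      rw [← P.extEquivCohomologyClass.apply_eq_iff_eq, ProjectiveResolution.extEquivCohomologyClass_extMk,
        ProjectiveResolution.extEquivCohomologyClass_zero, CochainComplex.HomComplex.CohomologyClass.mk_eq_zero_iff,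
        CochainComplex.HomComplex.Cocycle.toSingleMk_mem_coboundaries_iff _ _ _ _ _ 1 (by simp)] at h
      obtain ⟨g, hg⟩ := h
      have hz : P.cochainComplex.d (-((0:ℕ):ℤ)) 1 = 0 := by
        apply IsZero.eq_of_tgt
        exact P.complex.isZero_extend_X _ _ (by simp; intro i; omega)
      rw [hz] at hg
      rw [← cancel_epi (P.cochainComplexXIso (-((0:ℕ):ℤ)) 0 rfl).hom]
      simp at hg ⊢
      exact hg
    · rintro ⟨g, hg⟩
      have : f = 0 := by rw [← hg]; simp
      subst this
      simp
  · rw [ChainComplex.next_nat_succ] at hj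
    subst hj
    exact P.extMk_eq_zero_iff f _ rfl hf _ rfl

abbrev rcmfπ (I : Ideal R) {m n : ℕ} (h : n ≤ m) : ModuleCat.of R (R ⧸ I ^ m) ⟶ ModuleCat.of R (R ⧸ I ^ n) :=
  ModuleCat.ofHom (Submodule.mapQ (I ^ m) (I ^ n) LinearMap.id (Ideal.pow_le_pow_right h))

/-- Vanishing of the `i`-th local cohomology, through `Abelian.Ext`. -/
def rcmfV (I : Ideal R) (i : ℕ) (X : Type) [AddCommGroup X] [Module R X] : Prop :=
  ∀ (n : ℕ) (e : Abelian.Ext (ModuleCat.of R (R ⧸ I ^ n)) (ModuleCat.of R X) i),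
    ∃ (m : ℕ) (h : n ≤ m), (Abelian.Ext.mk₀ (rcmfπ I h)).comp e (zero_add i) = 0

lemma rcmfV_iff (I : Ideal R) (i : ℕ) (X : Type) [AddCommGroup X] [Module R X] :
    rcmfV I i X ↔ Subsingleton ((localCohomology I i).obj (ModuleCat.of R X)) := by
  rw [rcmf_lc_iff]
  let P (n : ℕ) : ProjectiveResolution (ModuleCat.of R (R ⧸ I ^ n)) := ProjectiveResolution.of _
  let φ {m n : ℕ} (h : n ≤ m) : ProjectiveResolution.Hom (P m) (P n) (rcmfπ I h) :=
    ⟨ProjectiveResolution.lift _ _ _, by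
      have := ProjectiveResolution.lift_commutes (rcmfπ I h) (P m) (P n)
      exact congrArg (fun q => q.f 0) this⟩
  have hφ {m n : ℕ} (h : n ≤ m) : (φ h).hom.f 0 ≫ (P n).π.f 0 = (P m).π.f 0 ≫ rcmfπ I h := by
    rw [(φ h).hom_f_zero_comp_π_f_zero]; simp
  refine forall_congr' fun n => ⟨fun H e => ?_, fun H e => ?_⟩
  · obtain ⟨f, hf⟩ := rcmfRep_exists (P n) i e
    obtain ⟨m, h, hm⟩ := H ((P n).extMk f (i+1) rfl (rcmfRep_cocycle _ _ _ _ hf))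
    refine ⟨m, h, ?_⟩
    rw [ProjectiveResolution.mk₀_comp_extMk _ _ _ _ (φ h), rcmf_extMk_zero _ _ _ _ _ rfl] at hm
    exact (rcmfRep_eq_zero_iff (P m) i _ rfl _ _ (rcmfRep_map _ (P m) _ _ (hφ h) i e f hf)).2 hm
  · obtain ⟨f, hf, rfl⟩ := (P n).extMk_surjective e (i+1) rfl
    obtain ⟨e', he'⟩ := rcmfRep_of_cocycle (P n) i f hf
    obtain ⟨m, h, hm⟩ := H e'
    refine ⟨m, h, ?_⟩
    rw [ProjectiveResolution.mk₀_comp_extMk _ _ _ _ (φ h), rcmf_extMk_zero _ _ _ _ _ rfl]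
    exact (rcmfRep_eq_zero_iff (P m) i _ rfl _ _ (rcmfRep_map _ (P m) _ _ (hφ h) i e' f he')).1 hm
end
end

end

section
open CategoryTheory Opposite Limits

section
variable {R : Type} [CommRing R] {a : Ideal R}

lemma rcmfπ_comp (I : Ideal R) {l m n : ℕ} (h : n ≤ m) (h' : m ≤ l) :
    rcmfπ I h' ≫ rcmfπ I h = rcmfπ I (h.trans h') := by
  ext; rfl

section ses
variable {X Y Z : Type} [AddCommGroup X] [Module R X] [AddCommGroup Y] [Module R Y]
  [AddCommGroup Z] [Module R Z] {f : X →ₗ[R] Y} {g : Y →ₗ[R] Z}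

lemma rcmf_ses (hf : Function.Injective f) (hfg : Function.Exact f g) (hg : Function.Surjective g) :
    ∃ w : ModuleCat.ofHom f ≫ ModuleCat.ofHom g = 0,
      (ShortComplex.mk (ModuleCat.ofHom f) (ModuleCat.ofHom g) w).ShortExact := by
  refine ⟨by ext x; exact hfg.apply_apply_eq_zero x, ?_⟩
  exact { exact := (ShortComplex.moduleCat_exact_iff _).2 fun y hy => (hfg y).1 hy
          mono_f := (ModuleCat.mono_iff_injective _).2 hf
          epi_g := (ModuleCat.epi_iff_surjective _).2 hg }

open Abelian in
lemma rcmfV_mid (hf : Function.Injective f) (hfg : Function.Exact f g) (hg : Function.Surjective g)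
    {i : ℕ} (hX : rcmfV a i X) (hZ : rcmfV a i Z) : rcmfV a i Y := by
  obtain ⟨w, S⟩ := rcmf_ses hf hfg hg
  intro n e
  obtain ⟨m, h, hm⟩ := hZ n (e.comp (Ext.mk₀ (ModuleCat.ofHom g)) (add_zero i))
  rw [← Ext.comp_assoc_of_third_deg_zero] at hm
  obtain ⟨x, hx⟩ := Ext.covariant_sequence_exact₂ _ S _ hm
  obtain ⟨l, h', hl⟩ := hX m x
  refine ⟨l, h.trans h', ?_⟩
  rw [← rcmfπ_comp a h h', ← Ext.mk₀_comp_mk₀_assoc, ← hx, ← Ext.comp_assoc_of_third_deg_zero, hl, Ext.zero_comp]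

open Abelian in
lemma rcmfV_right (hf : Function.Injective f) (hfg : Function.Exact f g) (hg : Function.Surjective g)
    {i : ℕ} (hY : rcmfV a i Y) (hX : rcmfV a (i+1) X) : rcmfV a i Z := by
  obtain ⟨w, S⟩ := rcmf_ses hf hfg hg
  intro n e
  obtain ⟨m, h, hm⟩ := hX n (e.comp S.extClass rfl)
  rw [← Ext.comp_assoc _ _ _ (zero_add i) rfl (by omega)] at hm
  obtain ⟨x, hx⟩ := Ext.covariant_sequence_exact₃ _ S _ rfl hm
  obtain ⟨l, h', hl⟩ := hY m x
  refine ⟨l, h.trans h', ?_⟩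
  rw [← rcmfπ_comp a h h', ← Ext.mk₀_comp_mk₀_assoc, ← hx, ← Ext.comp_assoc_of_third_deg_zero, hl, Ext.zero_comp]

open Abelian in
lemma rcmfV_left (hf : Function.Injective f) (hfg : Function.Exact f g) (hg : Function.Surjective g)
    {i : ℕ} (hZ : rcmfV a i Z) (hY : rcmfV a (i+1) Y) : rcmfV a (i+1) X := by
  obtain ⟨w, S⟩ := rcmf_ses hf hfg hg
  intro n e
  obtain ⟨m, h, hm⟩ := hY n (e.comp (Ext.mk₀ (ModuleCat.ofHom f)) (add_zero _))
  rw [← Ext.comp_assoc_of_third_deg_zero] at hm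
  obtain ⟨x, hx⟩ := Ext.covariant_sequence_exact₁ _ S _ hm rfl
  obtain ⟨l, h', hl⟩ := hZ m x
  refine ⟨l, h.trans h', ?_⟩
  rw [← rcmfπ_comp a h h', ← Ext.mk₀_comp_mk₀_assoc, ← hx, ← Ext.comp_assoc _ _ _ (zero_add i) rfl (by omega), hl, Ext.zero_comp]

/-- elements of `X` killed by `a ^ n` correspond to maps -/
lemma rcmf_hom_of_killed (n : ℕ) (x : X) (hx : ∀ r ∈ a ^ n, r • x = 0) :
    ∃ φ : (R ⧸ a ^ n) →ₗ[R] X, φ 1 = x := by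
  refine ⟨Submodule.liftQ (a ^ n) (LinearMap.toSpanSingleton R X x) ?_, ?_⟩
  · intro r hr; simpa using hx r hr
  · exact (Submodule.liftQ_apply _ _ (1 : R)).trans (by simp)

lemma rcmf_killed_of_hom (n : ℕ) (φ : (R ⧸ a ^ n) →ₗ[R] X) (r) (hr : r ∈ a ^ n) : r • φ 1 = 0 := by
  rw [← map_smul]
  have : r • (1 : R ⧸ a ^ n) = 0 := by
    rw [Algebra.smul_def, mul_one]; exact Ideal.Quotient.eq_zero_iff_mem.2 hr
  rw [this, map_zero]

lemma rcmf_hom_ext (n : ℕ) (φ ψ : ModuleCat.of R (R ⧸ a ^ n) ⟶ ModuleCat.of R X)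
    (h : φ.hom (1 : R ⧸ a ^ n) = ψ.hom (1 : R ⧸ a ^ n)) : φ = ψ := by
  ext
  exact h

open Abelian in
lemma rcmfV_zero_iff : rcmfV a 0 X ↔ ∀ n (x : X), (∀ r ∈ a ^ n, r • x = 0) → x = 0 := by
  constructor
  · intro H n x hx
    obtain ⟨φ, rfl⟩ := rcmf_hom_of_killed n x hx
    obtain ⟨m, h, hm⟩ := H n (Ext.mk₀ (ModuleCat.ofHom φ))
    rw [Ext.mk₀_comp_mk₀, Ext.mk₀_eq_zero_iff] at hm
    exact congrArg (fun q => q.hom (1 : R ⧸ a ^ m)) hm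
  · intro H n e
    obtain ⟨φ, rfl⟩ := (Ext.mk₀_bijective _ _).2 e
    refine ⟨n, le_rfl, ?_⟩
    rw [Ext.mk₀_comp_mk₀, Ext.mk₀_eq_zero_iff]
    apply rcmf_hom_ext
    exact H n _ (rcmf_killed_of_hom n φ.hom)

lemma rcmfV_injective [Module.Injective R X] (i : ℕ) : rcmfV a (i+1) X := by
  have : Injective (ModuleCat.of R X) := Module.injective_object_of_injective_module R X
  intro n e
  refine ⟨n, le_rfl, ?_⟩
  rw [Abelian.Ext.eq_zero_of_injective e, Abelian.Ext.comp_zero]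

open Abelian in
lemma rcmfV_one_iff [Module.Injective R Y] (hf : Function.Injective f) (hfg : Function.Exact f g) (hg : Function.Surjective g) :
    rcmfV a 1 X ↔ ∀ n (z : Z), (∀ r ∈ a ^ n, r • z = 0) →
      ∃ m y, g y = z ∧ ∀ r ∈ a ^ m, r • y = 0 := by
  obtain ⟨w, S⟩ := rcmf_ses hf hfg hg
  constructor
  · intro H n z hz
    obtain ⟨φ, rfl⟩ := rcmf_hom_of_killed n z hz
    obtain ⟨m, h, hm⟩ := H n ((Ext.mk₀ (ModuleCat.ofHom φ)).comp S.extClass rfl)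
    rw [Ext.mk₀_comp_mk₀_assoc] at hm
    obtain ⟨x, hx⟩ := Ext.covariant_sequence_exact₃ _ S _ rfl hm
    obtain ⟨ψ, rfl⟩ := (Ext.mk₀_bijective _ _).2 x
    rw [Ext.mk₀_comp_mk₀] at hx
    have := (Ext.mk₀_bijective _ _).1 hx
    exact ⟨m, ψ.hom (1 : R ⧸ a ^ m), congrArg (fun q => q.hom (1 : R ⧸ a ^ m)) this, rcmf_killed_of_hom m ψ.hom⟩
  · intro H n e
    have : Injective (ModuleCat.of R Y) := Module.injective_object_of_injective_module R Y
    obtain ⟨x, hx⟩ := Ext.covariant_sequence_exact₁ _ S e (Ext.eq_zero_of_injective _) rfl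
    obtain ⟨φ, rfl⟩ := (Ext.mk₀_bijective _ _).2 x
    obtain ⟨m, y, hy, hm⟩ := H n _ (rcmf_killed_of_hom n φ.hom)
    have hm' : ∀ r ∈ a ^ (max m n), r • y = 0 := fun r hr => hm r (Ideal.pow_le_pow_right (le_max_left _ _) hr)
    obtain ⟨ψ, hψ⟩ := rcmf_hom_of_killed _ y hm'
    refine ⟨max m n, le_max_right _ _, ?_⟩
    rw [← hx, Ext.mk₀_comp_mk₀_assoc]
    have : rcmfπ a (le_max_right m n) ≫ φ = ModuleCat.ofHom ψ ≫ ModuleCat.ofHom g := by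
      apply rcmf_hom_ext
      have e1 : (ModuleCat.ofHom ψ ≫ ModuleCat.ofHom g).hom (1 : R ⧸ a ^ (max m n)) = φ.hom (1 : R ⧸ a ^ n) := by
        rw [← hy, ← hψ]; rfl
      rw [e1]; rfl
    rw [this, ← Ext.mk₀_comp_mk₀, Ext.comp_assoc_of_second_deg_zero]
    have := S.comp_extClass
    exact (congrArg (fun q => (Ext.mk₀ (ModuleCat.ofHom ψ)).comp q (zero_add _)) this).trans (Ext.comp_zero _ _ _ _ _)

lemma rcmfV_subsingleton [Subsingleton X] (i : ℕ) : rcmfV a i X := by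
  intro n e
  refine ⟨n, le_rfl, ?_⟩
  have : 𝟙 (ModuleCat.of R X) = 0 := by ext; exact Subsingleton.elim _ _
  rw [← Abelian.Ext.comp_mk₀_id e, this, Abelian.Ext.mk₀_zero, Abelian.Ext.comp_zero, Abelian.Ext.comp_zero]

lemma rcmfV_equiv (u : X ≃ₗ[R] Y) {i : ℕ} (h : rcmfV a i X) : rcmfV a i Y :=
  rcmfV_mid (f := u.toLinearMap) (g := (0 : Y →ₗ[R] PUnit)) u.injective
    (fun y => ⟨fun _ => u.surjective y, fun _ => rfl⟩) (fun z => ⟨0, Subsingleton.elim _ _⟩) h (rcmfV_subsingleton i)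

lemma rcmfV_shift [Module.Injective R Y] (hf : Function.Injective f) (hfg : Function.Exact f g) (hg : Function.Surjective g) (i : ℕ) :
    rcmfV a (i+2) X ↔ rcmfV a (i+1) Z :=
  ⟨fun h => rcmfV_right hf hfg hg (rcmfV_injective i) h, fun h => rcmfV_left hf hfg hg h (rcmfV_injective _)⟩

open Abelian in
lemma rcmfV_of_bijective (x : R) (hx : x ∈ a) (h : Function.Bijective (fun y : X => x • y)) (i : ℕ) :
    rcmfV a i X := by
  intro n e
  refine ⟨n, le_rfl, ?_⟩
  suffices e = 0 by rw [this, Ext.comp_zero]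
  have hb : Function.Bijective ((x ^ n) • (LinearMap.id : X →ₗ[R] X)) := by
    have : (⇑((x ^ n) • (LinearMap.id : X →ₗ[R] X))) = (fun y : X => x • y)^[n] := by
      funext y
      rw [smul_iterate_apply]; rfl
    rw [this]; exact h.iterate n
  let u := LinearEquiv.ofBijective _ hb
  have h1 : ModuleCat.ofHom ((x ^ n) • (LinearMap.id : X →ₗ[R] X)) ≫ ModuleCat.ofHom u.symm.toLinearMap = 𝟙 _ := by
    ext y; exact u.symm_apply_apply y
  have h2 : e.comp (Ext.mk₀ (ModuleCat.ofHom ((x ^ n) • (LinearMap.id : X →ₗ[R] X)))) (add_zero i) = 0 := by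
    have e1 : ModuleCat.ofHom ((x ^ n) • (LinearMap.id : X →ₗ[R] X)) = (x^n) • 𝟙 (ModuleCat.of R X) := rfl
    have e2 : (x^n) • 𝟙 (ModuleCat.of R (R ⧸ a ^ n)) = 0 := by
      apply rcmf_hom_ext
      have : x ^ n • (1 : R ⧸ a ^ n) = 0 := by
        rw [Algebra.smul_def, mul_one]; exact Ideal.Quotient.eq_zero_iff_mem.2 (Ideal.pow_mem_pow hx n)
      exact this
    rw [e1, Ext.mk₀_smul, Ext.comp_smul, Ext.comp_mk₀_id, ← Ext.mk₀_id_comp e, ← Ext.smul_comp, ← Ext.mk₀_smul, e2,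
      Ext.mk₀_zero, Ext.zero_comp]
  rw [← Ext.comp_mk₀_id e, ← h1, ← Ext.mk₀_comp_mk₀, ← Ext.comp_assoc_of_third_deg_zero, h2, Ext.zero_comp]
end ses
end

end

section
open CategoryTheory Opposite Limits

section
variable {R : Type} [CommRing R]

/-- The `a`-torsion submodule. -/
def rcmfΓ (a : Ideal R) (X : Type) [AddCommGroup X] [Module R X] : Submodule R X where
  carrier := {x | ∃ n : ℕ, ∀ r ∈ a ^ n, r • x = 0}
  zero_mem' := ⟨0, fun r _ => smul_zero r⟩
  add_mem' := by
    rintro x y ⟨n, hn⟩ ⟨m, hm⟩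
    refine ⟨max n m, fun r hr => ?_⟩
    rw [smul_add, hn r (Ideal.pow_le_pow_right (le_max_left _ _) hr),
      hm r (Ideal.pow_le_pow_right (le_max_right _ _) hr), add_zero]
  smul_mem' := by
    rintro c x ⟨n, hn⟩
    exact ⟨n, fun r hr => by rw [smul_comm, hn r hr, smul_zero]⟩

variable {a : Ideal R} {X Y Z : Type} [AddCommGroup X] [Module R X] [AddCommGroup Y] [Module R Y]
  [AddCommGroup Z] [Module R Z]

lemma mem_rcmfΓ {x : X} : x ∈ rcmfΓ a X ↔ ∃ n : ℕ, ∀ r ∈ a ^ n, r • x = 0 := Iff.rfl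

lemma rcmfV_zero_iff' : rcmfV a 0 X ↔ rcmfΓ a X = ⊥ := by
  rw [rcmfV_zero_iff, eq_bot_iff]
  exact ⟨fun h x ⟨n, hn⟩ => h n x hn, fun h n x hx => h ⟨n, hx⟩⟩

lemma rcmfΓ_map (f : X →ₗ[R] Y) {x : X} (hx : x ∈ rcmfΓ a X) : f x ∈ rcmfΓ a Y := by
  obtain ⟨n, hn⟩ := hx
  exact ⟨n, fun r hr => by rw [← map_smul, hn r hr, map_zero]⟩

lemma rcmfΓ_of_injective (f : X →ₗ[R] Y) (hf : Function.Injective f) {x : X} (hx : f x ∈ rcmfΓ a Y) :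
    x ∈ rcmfΓ a X := by
  obtain ⟨n, hn⟩ := hx
  exact ⟨n, fun r hr => hf (by rw [map_smul, hn r hr, map_zero])⟩

lemma rcmfΓ_Γ : rcmfΓ a (rcmfΓ a X) = ⊤ :=
  eq_top_iff.2 fun x _ => rcmfΓ_of_injective (rcmfΓ a X).subtype Subtype.val_injective x.2

lemma rcmf_kill [Module.Finite R X] (f : X →ₗ[R] Y) (hf : ∀ x, f x ∈ rcmfΓ a Y) :
    ∃ k : ℕ, ∀ r ∈ a ^ k, ∀ x, r • f x = 0 := by
  obtain ⟨s, hs⟩ := Module.Finite.fg_top (R := R) (M := X)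
  choose k hk using hf
  refine ⟨s.sup k, fun r hr x => ?_⟩
  have hx : x ∈ Submodule.span R (s : Set X) := hs ▸ Submodule.mem_top
  induction hx using Submodule.span_induction with
  | mem x hx => exact hk x r (Ideal.pow_le_pow_right (Finset.le_sup hx) hr)
  | zero => simp
  | add x y _ _ h1 h2 => rw [map_add, smul_add, h1, h2, add_zero]
  | smul c x _ h => rw [map_smul, smul_comm, h, smul_zero]

lemma rcmf_kill_ideal [IsNoetherianRing R] (n : ℕ) (x : X) (h : ∀ r ∈ a ^ n, r • x ∈ rcmfΓ a X) :
    x ∈ rcmfΓ a X := by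
  obtain ⟨k, hk⟩ := rcmf_kill (X := (a ^ n : Ideal R)) ((LinearMap.toSpanSingleton R X x).comp (Submodule.subtype _))
    (fun r => h r r.2)
  refine ⟨k + n, fun r hr => ?_⟩
  rw [pow_add] at hr
  induction hr using Submodule.mul_induction_on' with
  | mem_mul_mem u hu v hv =>
    rw [mul_smul]; exact hk u hu ⟨v, hv⟩
  | add u _ v _ h1 h2 => rw [add_smul, h1, h2, add_zero]

lemma rcmfV_zero_quot [IsNoetherianRing R] : rcmfV a 0 (X ⧸ rcmfΓ a X) := by
  rw [rcmfV_zero_iff]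
  intro n x hx
  obtain ⟨x, rfl⟩ := Submodule.mkQ_surjective _ x
  simp only [Submodule.mkQ_apply, Submodule.Quotient.mk_eq_zero]
  refine rcmf_kill_ideal n x fun r hr => ?_
  have := hx r hr
  rwa [← map_smul, Submodule.mkQ_apply, Submodule.Quotient.mk_eq_zero] at this

lemma rcmfΓ_injective [IsNoetherianRing R] [Module.Injective R X] : Module.Injective R (rcmfΓ a X) := by
  apply Module.Baer.injective
  intro J φ
  obtain ⟨k, hk⟩ := rcmf_kill (a := a) ((rcmfΓ a X).subtype.comp φ) (fun x => (φ x).2)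
  obtain ⟨c, hc⟩ := Ideal.exists_pow_inf_eq_pow_smul a (M := R) J
  have hAR : ∀ j (hj : j ∈ J), j ∈ a ^ (k + c) → φ ⟨j, hj⟩ = 0 := by
    intro j hj hja
    have h1 : j ∈ (a ^ (k+c) • ⊤ ⊓ J : Submodule R R) := ⟨by simpa using hja, hj⟩
    rw [hc _ (by omega), Nat.add_sub_cancel] at h1
    have h2 : j ∈ a ^ k • (J : Submodule R R) := Submodule.smul_mono le_rfl inf_le_right h1
    have h3 : ∀ j ∈ a ^ k • (J : Submodule R R), ∃ hj : j ∈ J, φ ⟨j, hj⟩ = 0 := by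
      intro j hj
      induction hj using Submodule.smul_induction_on' with
      | smul r hr n hn =>
        refine ⟨J.smul_mem _ hn, ?_⟩
        have := hk r hr ⟨n, hn⟩
        have e : (⟨r • n, J.smul_mem _ hn⟩ : J) = r • ⟨n, hn⟩ := rfl
        rw [e, map_smul]
        exact Subtype.ext this
      | add x _ y _ h1 h2 =>
        obtain ⟨hx, h1⟩ := h1
        obtain ⟨hy, h2⟩ := h2
        refine ⟨J.add_mem hx hy, ?_⟩
        have e : (⟨x + y, J.add_mem hx hy⟩ : J) = ⟨x, hx⟩ + ⟨y, hy⟩ := rfl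
        rw [e, map_add, h1, h2, add_zero]
    exact (h3 j h2).2
  let q : J →ₗ[R] (R ⧸ a ^ (k + c)) := (Submodule.mkQ (a ^ (k+c))).comp J.subtype
  have hq : LinearMap.ker q ≤ LinearMap.ker ((rcmfΓ a X).subtype.comp φ) := by
    intro j hj
    have : (j : R) ∈ a ^ (k+c) := (Submodule.Quotient.mk_eq_zero _).1 hj
    simp [hAR j j.2 this]
  obtain ⟨h, hh⟩ := Module.Injective.out (Submodule.liftQ (LinearMap.ker q) q le_rfl)
    (LinearMap.ker_eq_bot.1 (Submodule.ker_liftQ_eq_bot _ _ _ le_rfl))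
    (Submodule.liftQ (LinearMap.ker q) _ hq)
  have h1 : h (1 : R ⧸ a ^ (k+c)) ∈ rcmfΓ a X := ⟨k + c, fun r hr => rcmf_killed_of_hom _ h r hr⟩
  refine ⟨LinearMap.toSpanSingleton R _ ⟨_, h1⟩, fun x hx => ?_⟩
  have h2 := hh (Submodule.Quotient.mk ⟨x, hx⟩)
  apply Subtype.ext
  refine Eq.trans ?_ h2
  have : (Submodule.liftQ (LinearMap.ker q) q le_rfl) (Submodule.Quotient.mk ⟨x, hx⟩) = x • (1 : R ⧸ a ^ (k+c)) := by
    rw [Algebra.smul_def, mul_one]; rfl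
  rw [this, map_smul]
  rfl

variable (R X) in
lemma rcmf_exists_inj : ∃ (E : Type) (_ : AddCommGroup E) (_ : Module R E) (_ : Module.Injective R E)
    (f : X →ₗ[R] E), Function.Injective f := by
  let E : ModuleCat.{0} R := Injective.under (ModuleCat.of R X)
  refine ⟨E, inferInstance, inferInstance, ?_, (Injective.ι (ModuleCat.of R X)).hom, ?_⟩
  · exact (Module.injective_iff_injective_object R _).2 (inferInstanceAs (Injective E))
  · exact (ModuleCat.mono_iff_injective _).1 inferInstance

lemma rcmf_exists_inj_torsion [IsNoetherianRing R] (hX : rcmfΓ a X = ⊤) : ∃ (E : Type) (_ : AddCommGroup E) (_ : Module R E) (_ : Module.Injective R E)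
    (f : X →ₗ[R] E), Function.Injective f ∧ rcmfΓ a E = ⊤ := by
  obtain ⟨E, _, _, _, f, hf⟩ := rcmf_exists_inj R X
  exact ⟨rcmfΓ a E, inferInstance, inferInstance, rcmfΓ_injective,
    f.codRestrict _ (fun x => rcmfΓ_map f (hX ▸ Submodule.mem_top)), fun x y h => hf (congrArg Subtype.val h), rcmfΓ_Γ⟩

lemma rcmf_retract_injective [Module.Injective R Y] (s : X →ₗ[R] Y) (r : Y →ₗ[R] X) (h : ∀ x, r (s x) = x) :
    Module.Injective R X := by
  constructor
  intro A B _ _ _ _ f hf g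
  obtain ⟨k, hk⟩ := Module.Injective.out f hf (s.comp g)
  exact ⟨r.comp k, fun x => by simp [hk, h]⟩

lemma rcmf_exists_inj_free [IsNoetherianRing R] (hX : rcmfV a 0 X) : ∃ (E : Type) (_ : AddCommGroup E) (_ : Module R E) (_ : Module.Injective R E)
    (f : X →ₗ[R] E), Function.Injective f ∧ ∀ i, rcmfV a i E := by
  obtain ⟨E, _, _, _, f, hf⟩ := rcmf_exists_inj R X
  have := rcmfΓ_injective (a := a) (X := E)
  obtain ⟨r, hr⟩ := Module.Injective.out (rcmfΓ a E).subtype Subtype.val_injective LinearMap.id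
  let s : (E ⧸ rcmfΓ a E) →ₗ[R] E := Submodule.liftQ _ (LinearMap.id - (rcmfΓ a E).subtype.comp r) (by
    intro x hx
    have := hr ⟨x, hx⟩
    simp only [Submodule.subtype_apply] at this
    simp [this])
  have hs : ∀ x, (rcmfΓ a E).mkQ (s x) = x := by
    intro x
    obtain ⟨x, rfl⟩ := Submodule.mkQ_surjective _ x
    have : s ((rcmfΓ a E).mkQ x) = x - r x := rfl
    rw [this, map_sub, sub_eq_self]
    simp
  have hi := rcmf_retract_injective s _ hs
  refine ⟨E ⧸ rcmfΓ a E, inferInstance, inferInstance, hi, (rcmfΓ a E).mkQ.comp f, ?_, ?_⟩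
  · rw [← LinearMap.ker_eq_bot, eq_bot_iff]
    intro x hx
    rw [rcmfV_zero_iff'] at hX
    rw [← hX]
    exact rcmfΓ_of_injective f hf ((Submodule.Quotient.mk_eq_zero _).1 hx)
  · rintro (_ | i)
    · exact rcmfV_zero_quot
    · exact rcmfV_injective i

lemma rcmf_exact (f : X →ₗ[R] Y) : Function.Exact f (LinearMap.range f).mkQ :=
  LinearMap.exact_iff.2 (Submodule.ker_mkQ _)

lemma rcmfV_torsion [IsNoetherianRing R] (hX : rcmfΓ a X = ⊤) (i : ℕ) : rcmfV a (i+1) X := by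
  induction i generalizing X with
  | zero =>
    obtain ⟨E, _, _, _, f, hf, hE⟩ := rcmf_exists_inj_torsion hX
    refine (rcmfV_one_iff hf (rcmf_exact f) (Submodule.mkQ_surjective _)).2 fun n z hz => ?_
    obtain ⟨y, rfl⟩ := Submodule.mkQ_surjective _ z
    obtain ⟨m, hm⟩ : y ∈ rcmfΓ a E := hE ▸ Submodule.mem_top
    exact ⟨m, y, rfl, hm⟩
  | succ i ih =>
    obtain ⟨E, _, _, _, f, hf, hE⟩ := rcmf_exists_inj_torsion hX
    refine (rcmfV_shift hf (rcmf_exact f) (Submodule.mkQ_surjective _) i).2 (ih ?_)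
    rw [eq_top_iff]
    intro z _
    obtain ⟨y, rfl⟩ := Submodule.mkQ_surjective _ z
    exact rcmfΓ_map _ (hE ▸ Submodule.mem_top)
end

end

section
open CategoryTheory Opposite Limits

section
variable {R : Type} [CommRing R]
variable {a b : Ideal R} {X Y Z : Type} [AddCommGroup X] [Module R X] [AddCommGroup Y] [Module R Y]
  [AddCommGroup Z] [Module R Z]

lemma mem_rcmfΓ_span {x : R} {y : X} : y ∈ rcmfΓ (Ideal.span {x}) X ↔ ∃ n : ℕ, x ^ n • y = 0 := by
  rw [mem_rcmfΓ]
  refine exists_congr fun n => ?_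
  rw [Ideal.span_singleton_pow]
  constructor
  · intro h; exact h _ (Ideal.mem_span_singleton_self _)
  · intro h r hr
    obtain ⟨c, rfl⟩ := Ideal.mem_span_singleton'.1 hr
    rw [mul_smul, h, smul_zero]

lemma rcmfΓ_sup {y : X} (h1 : y ∈ rcmfΓ a X) (h2 : y ∈ rcmfΓ b X) : y ∈ rcmfΓ (a ⊔ b) X := by
  obtain ⟨n, hn⟩ := h1
  obtain ⟨m, hm⟩ := h2
  refine ⟨n + m, fun r hr => ?_⟩
  obtain ⟨u, hu, v, hv, rfl⟩ := Submodule.mem_sup.1 (Ideal.sup_pow_add_le_pow_sup_pow hr)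
  rw [add_smul, hn u hu, hm v hv, add_zero]

lemma rcmfΓ_mono (h : a ≤ b) : rcmfΓ b X ≤ rcmfΓ a X := by
  rintro y ⟨n, hn⟩
  exact ⟨n, fun r hr => hn r (Ideal.pow_right_mono h n hr)⟩

lemma rcmfV_sup [IsNoetherianRing R] (hX : rcmfΓ b X = ⊤) (i : ℕ) (h : rcmfV a i X) : rcmfV (a ⊔ b) i X := by
  induction i using Nat.strong_induction_on generalizing X with
  | _ i ih =>
  obtain ⟨E, _, _, _, f, hf, hE⟩ := rcmf_exists_inj_torsion hX
  have hex := rcmf_exact f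
  have hsu := Submodule.mkQ_surjective (LinearMap.range f)
  rcases i with _ | _ | i
  · rw [rcmfV_zero_iff'] at h ⊢
    rw [eq_bot_iff, ← h]
    exact rcmfΓ_mono le_sup_left
  · rw [zero_add, rcmfV_one_iff hf hex hsu] at h ⊢
    intro n z hz
    obtain ⟨m, y, hy, hm⟩ := h n z (fun r hr => hz r (Ideal.pow_right_mono le_sup_left n hr))
    obtain ⟨k, hk⟩ := rcmfΓ_sup (a := a) (b := b) (y := y) ⟨m, hm⟩ (hE ▸ Submodule.mem_top)
    exact ⟨k, y, hy, hk⟩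
  · rw [rcmfV_shift hf hex hsu] at h ⊢
    refine ih (i+1) (by omega) ?_ h
    rw [eq_top_iff]
    intro z _
    obtain ⟨y, rfl⟩ := Submodule.mkQ_surjective _ z
    exact rcmfΓ_map _ (hE ▸ Submodule.mem_top)

lemma rcmf_bound_step [IsNoetherianRing R] (x : R) (r : ℕ)
    (h : ∀ (X : Type) [AddCommGroup X] [Module R X] (i : ℕ), r < i → rcmfV a i X)
    (X : Type) [AddCommGroup X] [Module R X] (i : ℕ) (hi : r + 1 < i) :
    rcmfV (a ⊔ Ideal.span {x}) i X := by
  let S := Submonoid.powers x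
  let f := LocalizedModule.mkLinearMap S X
  have hx : x ∈ a ⊔ Ideal.span {x} := (le_sup_right : _ ≤ a ⊔ Ideal.span {x}) (Ideal.mem_span_singleton_self x)
  have hL : ∀ i, rcmfV (a ⊔ Ideal.span {x}) i (LocalizedModule S X) := fun i =>
    rcmfV_of_bijective x hx ((Module.End.isUnit_iff _).1
      (IsLocalizedModule.map_units f (⟨x, Submonoid.mem_powers x⟩ : S))) i
  have hT : ∀ i, r < i → rcmfV (a ⊔ Ideal.span {x}) i (LinearMap.ker f) := fun i hi => by
    refine rcmfV_sup ?_ i (h _ i hi)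
    rw [eq_top_iff]
    intro y _
    rw [mem_rcmfΓ_span]
    obtain ⟨⟨c, n, rfl⟩, hc⟩ := (IsLocalizedModule.eq_zero_iff S f).1 (LinearMap.mem_ker.1 y.2)
    exact ⟨n, Subtype.ext hc⟩
  have hC : ∀ i, r < i → rcmfV (a ⊔ Ideal.span {x}) i (LocalizedModule S X ⧸ LinearMap.range f) := fun i hi => by
    refine rcmfV_sup ?_ i (h _ i hi)
    rw [eq_top_iff]
    intro y _
    obtain ⟨y, rfl⟩ := Submodule.mkQ_surjective _ y
    rw [mem_rcmfΓ_span]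
    obtain ⟨⟨z, ⟨c, n, rfl⟩⟩, hc⟩ := IsLocalizedModule.surj S f y
    refine ⟨n, ?_⟩
    rw [← map_smul, Submodule.mkQ_apply, Submodule.Quotient.mk_eq_zero]
    exact ⟨z, hc.symm⟩
  obtain ⟨i, rfl⟩ : ∃ j, i = j + 1 := ⟨i - 1, by omega⟩
  have hR : rcmfV (a ⊔ Ideal.span {x}) (i+1) (LinearMap.range f) :=
    rcmfV_left (f := (LinearMap.range f).subtype) (g := (LinearMap.range f).mkQ) Subtype.val_injective
      (LinearMap.exact_iff.2 (by simp)) (Submodule.mkQ_surjective _) (hC i (by omega)) (hL _)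
  exact rcmfV_mid (f := (LinearMap.ker f).subtype) (g := f.rangeRestrict) Subtype.val_injective
      (LinearMap.exact_iff.2 (by simp)) (LinearMap.surjective_rangeRestrict f) (hT _ (by omega)) hR

variable (a) in
lemma rcmf_bound [IsNoetherianRing R] :
    ∃ r : ℕ, ∀ (X : Type) [AddCommGroup X] [Module R X] (i : ℕ), r < i → rcmfV a i X := by
  classical
  obtain ⟨s, rfl⟩ := IsNoetherian.noetherian a
  induction s using Finset.induction_on with
  | empty =>
    refine ⟨0, fun X _ _ i hi => ?_⟩
    obtain ⟨i, rfl⟩ : ∃ j, i = j + 1 := ⟨i - 1, by omega⟩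
    refine rcmfV_torsion ?_ i
    rw [eq_top_iff]
    intro y _
    refine ⟨1, fun r hr => ?_⟩
    simp at hr
    simp [hr]
  | insert x s _ ih =>
    obtain ⟨r, hr⟩ := ih
    refine ⟨r + 1, fun X _ _ i hi => ?_⟩
    have := rcmf_bound_step x r hr X i hi
    rw [Finset.coe_insert, Submodule.span_insert, sup_comm]
    exact this

lemma rcmf_not_V {i : ℕ} : ¬ rcmfV a i X ↔ Nontrivial ((localCohomology a i).obj (ModuleCat.of R X)) := by
  rw [rcmfV_iff, not_subsingleton_iff_nontrivial]

lemma rcmf_cohDim_le [IsNoetherianRing R] {i : ℕ} : cohDim a X ≤ i ↔ ∀ j, i < j → rcmfV a j X := by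
  obtain ⟨r, hr⟩ := rcmf_bound a
  have hb : BddAbove {i : ℕ | Nontrivial ((localCohomology a i).obj (ModuleCat.of R X))} := by
    refine ⟨r, fun i hi => ?_⟩
    by_contra hlt
    exact rcmf_not_V.2 hi (hr X i (by omega))
  constructor
  · intro h j hj
    by_contra hV
    have := le_csSup hb (rcmf_not_V.1 hV)
    have : j ≤ cohDim a X := this
    omega
  · intro h
    refine csSup_le' fun j hj => ?_
    by_contra hlt
    exact rcmf_not_V.2 hj (h j (by omega))
end

end

section
open CategoryTheory Opposite Limits

section
variable {R : Type} [CommRing R]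
variable {a b : Ideal R} {X X' : Type} [AddCommGroup X] [Module R X] {S : Submonoid R}
  [AddCommGroup X'] [Module R X'] [Module (Localization S) X'] [IsScalarTower R (Localization S) X']

lemma rcmf_loc_kill (n : ℕ) (y : X') :
    (∀ r ∈ (a.map (algebraMap R (Localization S))) ^ n, r • y = 0) ↔ ∀ r ∈ a ^ n, r • y = 0 := by
  rw [← Ideal.map_pow]
  constructor
  · intro h r hr
    have := h _ (Ideal.mem_map_of_mem _ hr)
    rwa [algebraMap_smul] at this
  · intro h r hr
    induction hr using Submodule.span_induction with
    | mem x hx => obtain ⟨r, hr, rfl⟩ := hx; rw [algebraMap_smul]; exact h r hr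
    | zero => simp
    | add x y _ _ h1 h2 => rw [add_smul, h1, h2, add_zero]
    | smul c x _ h => rw [smul_assoc, h, smul_zero]

lemma rcmf_loc_Γ [IsNoetherianRing R] (f : X →ₗ[R] X') [IsLocalizedModule S f] (n : ℕ) (y : X')
    (h : ∀ r ∈ a ^ n, r • y = 0) : ∃ t : S, ∃ x ∈ rcmfΓ a X, t • y = f x := by
  classical
  obtain ⟨⟨x, s⟩, hs⟩ := IsLocalizedModule.surj S f y
  have hr : ∀ r ∈ a ^ n, ∃ t : S, t • r • x = 0 := by
    intro r hr
    apply (IsLocalizedModule.eq_zero_iff S f).1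
    rw [map_smul]
    simp only at hs
    rw [← hs, smul_comm, h r hr, smul_zero]
  have hfg : (a ^ n).FG := IsNoetherian.noetherian _
  obtain ⟨σ, hσ⟩ := hfg
  have hr' : ∀ r : σ, ∃ t : S, t • (r : R) • x = 0 := fun r => hr r (hσ ▸ Submodule.subset_span r.2)
  choose t ht using hr'
  refine ⟨(∏ r, t r) * s, (∏ r, t r) • x, ⟨n, fun r hr => ?_⟩, ?_⟩
  · rw [← hσ] at hr
    induction hr using Submodule.span_induction with
    | mem r hr =>
      rw [← Finset.prod_erase_mul _ t (Finset.mem_univ (⟨r, hr⟩ : σ)), mul_smul, smul_comm r, smul_comm r]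
      have := ht ⟨r, hr⟩
      simp only at this
      rw [this, smul_zero]
    | zero => simp
    | add x y _ _ h1 h2 => rw [add_smul, h1, h2, add_zero]
    | smul c x _ h => rw [smul_assoc, h, smul_zero]
  · simp only at hs
    rw [mul_smul, hs]
    exact (map_smul f ((∏ r, t r : S) : R) x).symm

lemma rcmf_unit_smul (t : S) (y : X') : ∃ z : X', t • z = y ∧ ∃ c : Localization S, z = c • y := by
  refine ⟨(IsLocalization.mk' (Localization S) 1 t) • y, ?_, _, rfl⟩
  have : t • (IsLocalization.mk' (Localization S) 1 t) • y = (algebraMap R (Localization S) t * IsLocalization.mk' (Localization S) 1 t) • y := by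
    rw [mul_smul, algebraMap_smul]; rfl
  rw [this, IsLocalization.mk'_spec', map_one, one_smul]

lemma rcmf_unit_cancel (t : S) {y : X'} (h : t • y = 0) : y = 0 := by
  have h' : (algebraMap R (Localization S) t) • y = 0 := by rw [algebraMap_smul]; exact h
  exact (IsUnit.smul_eq_zero (IsLocalization.map_units _ t)).1 h'

lemma rcmfV_loc [IsNoetherianRing R] (f : X →ₗ[R] X') [IsLocalizedModule S f] (i : ℕ) (h : rcmfV a i X) :
    rcmfV (a.map (algebraMap R (Localization S))) i X' := by
  induction i using Nat.strong_induction_on generalizing X X' with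
  | _ i ih =>
  rcases i with _ | i
  · rw [rcmfV_zero_iff'] at h
    rw [rcmfV_zero_iff]
    intro n y hy
    obtain ⟨t, x, hx, hxy⟩ := rcmf_loc_Γ (S := S) f n y ((rcmf_loc_kill n y).1 hy)
    rw [h, Submodule.mem_bot] at hx
    rw [hx, map_zero] at hxy
    exact rcmf_unit_cancel t hxy
  obtain ⟨E, _, _, _, j, hj⟩ := rcmf_exists_inj R X
  have hex := rcmf_exact j
  have hsu := Submodule.mkQ_surjective (LinearMap.range j)
  set q := (LinearMap.range j).mkQ with hq
  let fE := LocalizedModule.mkLinearMap S E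
  let fZ := LocalizedModule.mkLinearMap S (E ⧸ LinearMap.range j)
  have : Module.Injective (Localization S) (LocalizedModule S E) := Module.injective_of_isLocalizedModule S fE
  let j' := (IsLocalizedModule.map S f fE j).extendScalarsOfIsLocalization S (Localization S)
  let q' := (IsLocalizedModule.map S fE fZ q).extendScalarsOfIsLocalization S (Localization S)
  have hj' : Function.Injective j' := IsLocalizedModule.map_injective S f fE j hj
  have hsu' : Function.Surjective q' := IsLocalizedModule.map_surjective S fE fZ q hsu
  have hex' : Function.Exact j' q' := IsLocalizedModule.map_exact S f fE fZ j q hex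
  rcases i with _ | i
  · rw [zero_add, rcmfV_one_iff hj hex hsu] at h
    rw [zero_add, rcmfV_one_iff hj' hex' hsu']
    intro n z hz
    obtain ⟨t, x, ⟨m, hx⟩, hxy⟩ := rcmf_loc_Γ (S := S) fZ n z ((rcmf_loc_kill n z).1 hz)
    obtain ⟨k, y, rfl, hy⟩ := h m x hx
    obtain ⟨y', hy', c, hc⟩ := rcmf_unit_smul t (fE y)
    refine ⟨k, y', ?_, ?_⟩
    · rw [← sub_eq_zero]
      apply rcmf_unit_cancel t
      rw [smul_sub, hxy, sub_eq_zero]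
      have e1 : t • q' y' = q' (t • y') := (map_smul (IsLocalizedModule.map S fE fZ q) (t : R) y').symm
      rw [e1, hy']
      exact IsLocalizedModule.map_apply S fE fZ q y
    · rw [rcmf_loc_kill]
      intro r hr
      rw [hc, smul_comm, ← map_smul, hy r hr, map_zero, smul_zero]
  · rw [rcmfV_shift hj hex hsu] at h
    rw [rcmfV_shift hj' hex' hsu']
    exact ih (i+1) (by omega) fZ h
end

end

section
open CategoryTheory Opposite Limits

section
variable {R : Type} [CommRing R] {a : Ideal R}

open TensorProduct in
lemma rcmf_exists_hom (N : Type) [AddCommGroup N] [Module R N] [Module.Finite R N] (q : PrimeSpectrum R)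
    (hq : Module.annihilator R N ≤ q.asIdeal) : ∃ h : N →ₗ[R] (R ⧸ q.asIdeal), h ≠ 0 := by
  classical
  have hs : q ∈ Module.support R N := by
    rw [Module.support_eq_zeroLocus]; exact hq
  rw [Module.mem_support_iff_nontrivial_residueField_tensorProduct] at hs
  set κ := q.asIdeal.ResidueField
  obtain ⟨v, hv⟩ := exists_ne (0 : κ ⊗[R] N)
  have : ∃ D : Module.Dual κ (κ ⊗[R] N), D v ≠ 0 := by
    by_contra hD
    push Not at hD
    exact hv ((Module.forall_dual_apply_eq_zero_iff κ v).1 hD)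
  obtain ⟨D, hD⟩ := this
  let φ : N →ₗ[R] κ := (D.restrictScalars R).comp (TensorProduct.mk R κ N 1)
  have hφ : φ ≠ 0 := by
    intro h0
    apply hD
    have : D = 0 := by
      apply TensorProduct.AlgebraTensorModule.curry_injective
      ext n
      exact congrArg (fun f => f n) h0
    rw [this]; rfl
  obtain ⟨s, hs⟩ := Module.Finite.fg_top (R := R) (M := N)
  obtain ⟨b, hb⟩ := IsLocalization.exist_integer_multiples_of_finset (nonZeroDivisors (R ⧸ q.asIdeal))
    (S := κ) (s.image φ)
  let ι : (R ⧸ q.asIdeal) →ₗ[R] κ := (IsScalarTower.toAlgHom R (R ⧸ q.asIdeal) κ).toLinearMap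
  have hι : Function.Injective ι := IsFractionRing.injective (R ⧸ q.asIdeal) κ
  obtain ⟨b0, hb0⟩ := Ideal.Quotient.mk_surjective (b : R ⧸ q.asIdeal)
  have hbs : ∀ x : κ, (b : R ⧸ q.asIdeal) • x = b0 • x := by
    intro x
    rw [← hb0, ← Ideal.Quotient.algebraMap_eq, algebraMap_smul]
  have hr : ∀ n, (b0 • φ) n ∈ LinearMap.range ι := by
    intro n
    have hn : n ∈ Submodule.span R (s : Set N) := hs ▸ Submodule.mem_top
    induction hn using Submodule.span_induction with
    | mem n hn =>
      obtain ⟨c, hc⟩ := hb (φ n) (Finset.mem_image_of_mem _ hn)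
      refine ⟨c, hc.trans ?_⟩
      exact hbs _
    | zero => simp
    | add x y _ _ h1 h2 => rw [map_add]; exact Submodule.add_mem _ h1 h2
    | smul c x _ h => rw [map_smul]; exact Submodule.smul_mem _ _ h
  let e := LinearEquiv.ofInjective ι hι
  refine ⟨e.symm.toLinearMap.comp ((b0 • φ).codRestrict _ hr), fun h0 => hφ ?_⟩
  ext n
  have h1 : e.symm ((b0 • φ).codRestrict _ hr n) = 0 := congrArg (fun f => f n) h0
  rw [LinearEquiv.map_eq_zero_iff] at h1
  have h2 : b0 • φ n = 0 := congrArg Subtype.val h1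
  rw [← hbs, Algebra.smul_def] at h2
  rcases mul_eq_zero.1 h2 with h3 | h3
  · exact absurd ((map_eq_zero_iff _ (IsFractionRing.injective (R ⧸ q.asIdeal) κ)).1 h3) (nonZeroDivisors.ne_zero b.2)
  · exact h3

lemma rcmf_devissage [IsNoetherianRing R] (J : Ideal R) (j : ℕ)
    (h : ∀ q : PrimeSpectrum R, J ≤ q.asIdeal → rcmfV a j (R ⧸ q.asIdeal))
    (L : Type) [AddCommGroup L] [Module R L] [Module.Finite R L] (hL : J ≤ Module.annihilator R L) :
    rcmfV a j L := by
  revert hL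
  refine IsNoetherianRing.induction_on_isQuotientEquivQuotientPrime R (M := L) inferInstance
    (motive := fun L _ _ _ => J ≤ Module.annihilator R L → rcmfV a j L) ?_ ?_ ?_
  · intro N _ _ _ _ _
    exact rcmfV_subsingleton j
  · intro N _ _ _ p e hJ
    refine rcmfV_equiv e.symm (h p ?_)
    rw [e.annihilator_eq, Ideal.annihilator_quotient] at hJ
    exact hJ
  · intro N1 _ _ _ N2 _ _ _ N3 _ _ _ f g hf hg hfg h1 h3 hJ
    exact rcmfV_mid hf hfg hg (h1 (hJ.trans (f.annihilator_le_of_injective hf)))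
      (h3 (hJ.trans (g.annihilator_le_of_surjective hg)))

lemma rcmf_gruson [IsNoetherianRing R] (N : Type) [AddCommGroup N] [Module R N] [Module.Finite R N] (k : ℕ)
    (hN : ∀ j, k ≤ j → rcmfV a j N) (j : ℕ) (hj : k ≤ j) 
    (L : Type) [AddCommGroup L] [Module R L] [Module.Finite R L] (hL : Module.annihilator R N ≤ Module.annihilator R L) :
    rcmfV a j L := by
  obtain ⟨r, hr⟩ := rcmf_bound a
  suffices H : ∀ d j, k ≤ j → r < j + d → ∀ 
      (L : Type) [AddCommGroup L] [Module R L] [Module.Finite R L], Module.annihilator R N ≤ Module.annihilator R L →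
      rcmfV a j L from H (r+1) j hj (by omega) L hL
  intro d
  induction d with
  | zero => intro j _ hj L _ _ _ _; exact hr L j hj
  | succ d ih =>
    intro j hj hd L _ _ _ hL
    have ih' := ih (j+1) (by omega) (by omega)
    have hquot : ∀ (A B : Type) [AddCommGroup A] [Module R A] [AddCommGroup B] [Module R B] [Module.Finite R A]
      (f : A →ₗ[R] B), Function.Surjective f → Module.annihilator R N ≤ Module.annihilator R A → rcmfV a j A → rcmfV a j B := by
      intro A B _ _ _ _ _ f hf hA hV
      exact rcmfV_right (f := (LinearMap.ker f).subtype) (g := f) Subtype.val_injective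
        (LinearMap.exact_iff.2 (by simp)) hf hV (ih' _ (hA.trans
          ((LinearMap.ker f).subtype.annihilator_le_of_injective Subtype.val_injective)))
    refine rcmf_devissage _ j ?_ L hL
    suffices H : ∀ q : Ideal R, q.IsPrime → Module.annihilator R N ≤ q → rcmfV a j (R ⧸ q) from
      fun q hq => H q.asIdeal q.2 hq
    intro q
    induction q using WellFoundedGT.induction with
    | ind q ihq =>
    intro hq hN'
    obtain ⟨f, hf⟩ := rcmf_exists_hom N ⟨q, hq⟩ hN'
    simp only at f hf
    have hB : rcmfV a j (LinearMap.range f) := hquot N _ f.rangeRestrict (LinearMap.surjective_rangeRestrict f) le_rfl (hN j hj)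
    refine rcmfV_mid (f := (LinearMap.range f).subtype) (g := (LinearMap.range f).mkQ) Subtype.val_injective
      (LinearMap.exact_iff.2 (by simp)) (Submodule.mkQ_surjective _) hB ?_
    obtain ⟨n, hn⟩ : ∃ n, f n ≠ 0 := by
      by_contra hc; push Not at hc; exact hf (LinearMap.ext hc)
    obtain ⟨y, hy⟩ := Ideal.Quotient.mk_surjective (f n)
    have hyq : y ∉ q := by
      intro h; apply hn; rw [← hy]; exact Ideal.Quotient.eq_zero_iff_mem.2 h
    have hlt : q < q ⊔ Ideal.span {y} := by
      refine lt_of_le_of_ne le_sup_left fun h => hyq ?_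
      rw [h]
      exact (le_sup_right : Ideal.span {y} ≤ q ⊔ Ideal.span {y}) (Ideal.mem_span_singleton_self y)
    refine rcmf_devissage (q ⊔ Ideal.span {y}) j (fun p hp => ihq p.asIdeal (lt_of_lt_of_le hlt hp) p.2
      (hN'.trans (le_sup_left.trans hp))) _ ?_
    refine sup_le ?_ ?_
    · refine le_trans ?_ ((LinearMap.range f).mkQ.annihilator_le_of_surjective (Submodule.mkQ_surjective _))
      rw [Ideal.annihilator_quotient]
    · rw [Ideal.span_singleton_le_iff_mem, Module.mem_annihilator]
      intro z
      obtain ⟨z, rfl⟩ := Submodule.mkQ_surjective _ z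
      obtain ⟨z, rfl⟩ := Ideal.Quotient.mk_surjective z
      rw [← map_smul, Submodule.mkQ_apply, Submodule.Quotient.mk_eq_zero]
      refine ⟨z • n, ?_⟩
      rw [map_smul, ← hy, Algebra.smul_def, Algebra.smul_def]
      simp only [Ideal.Quotient.algebraMap_eq]
      rw [mul_comm]
end

end

section
open CategoryTheory Opposite Limits

section
variable {R : Type} [CommRing R] {a : Ideal R}

structure RcmfK (R : Type) [CommRing R] where
  G : ℤ → Type
  grp : ∀ i, AddCommGroup (G i)
  mod : ∀ i, Module R (G i)
  proj : ∀ i, Module.Projective R (G i)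
  d : ∀ i, G i →ₗ[R] G (i-1)
  dd : ∀ i x, d (i-1) (d i x) = 0
  neg : ∀ i < 0, Subsingleton (G i)

attribute [instance] RcmfK.grp RcmfK.mod RcmfK.proj

/-- base -/
def rcmfKbase (R : Type) [CommRing R] : RcmfK R where
  G i := PLift (i = 0) → R
  grp _ := inferInstance
  mod _ := inferInstance
  proj i := by
    classical
    have : Finite (PLift (i = 0)) := inferInstance
    infer_instance
  d _ := 0
  dd _ _ := rfl
  neg i hi := by
    have : IsEmpty (PLift (i = 0)) := ⟨fun h => by have := h.down; omega⟩
    infer_instance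

/-- cone -/
def rcmfKcone (K : RcmfK R) (x : R) : RcmfK R where
  G i := K.G i × K.G (i-1)
  grp _ := inferInstance
  mod _ := inferInstance
  proj _ := inferInstance
  d i := ((K.d i).comp (LinearMap.fst R _ _) + x • LinearMap.snd R _ _).prod (- ((K.d (i-1)).comp (LinearMap.snd R _ _)))
  dd i y := by
    obtain ⟨y, z⟩ := y
    simp [K.dd]
  neg i hi := by
    have := K.neg i hi
    have := K.neg (i-1) (by omega)
    infer_instance

lemma rcmfKcone_d (K : RcmfK R) (x : R) (i : ℤ) (y : K.G i) (z : K.G (i-1)) :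
    (rcmfKcone K x).d i ((y, z) : K.G i × K.G (i-1)) = ((K.d i y + x • z, - K.d (i-1) z) : K.G (i-1) × K.G (i-1-1)) := rfl

lemma rcmfK_exists (J : Ideal R) (l : List R) (hl : ∀ s ∈ l, s ∈ J) : ∃ K : RcmfK R,
    (∀ s ∈ l, ∃ h : ∀ i, K.G (i-1) →ₗ[R] K.G i, ∀ i x, K.d i (h i x) + h (i-1) (K.d (i-1) x) = s • x) ∧
    ∃ (t : ℤ) (ω : K.G t) (τ : K.G t →ₗ[R] R), τ ω = 1 ∧ (∀ j > t, Subsingleton (K.G j)) ∧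
      K.d t ω ∈ J • (⊤ : Submodule R (K.G (t-1))) := by
  induction l with
  | nil =>
    refine ⟨rcmfKbase R, by simp, 0, fun _ => 1, LinearMap.proj ⟨rfl⟩, rfl, ?_, ?_⟩
    · intro j hj
      have : IsEmpty (PLift (j = 0)) := ⟨fun h => by have := h.down; omega⟩
      exact inferInstanceAs (Subsingleton (PLift (j = 0) → R))
    · exact Submodule.zero_mem _
  | cons x l ih =>
    obtain ⟨K, hK, t, ω, τ, h1, h2, h3⟩ := ih (fun s hs => hl s (List.mem_cons_of_mem _ hs))
    obtain ⟨t, rfl⟩ : ∃ t', t = t' - 1 := ⟨t+1, by omega⟩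
    refine ⟨rcmfKcone K x, ?_, t, (0, ω), τ.comp (LinearMap.snd R _ _), h1, ?_, ?_⟩
    · intro s hs
      rcases List.mem_cons.1 hs with rfl | hs
      · refine ⟨fun i => (LinearMap.inr R (K.G i) (K.G (i-1))).comp (LinearMap.fst R _ _), ?_⟩
        intro i y
        obtain ⟨y, z⟩ := y
        refine Prod.ext ?_ ?_
        · change (K.d i 0 + s • y) + 0 = s • y
          simp
        · change - K.d (i-1) y + (K.d (i-1) y + s • z) = s • z
          simp
      · obtain ⟨h, hh⟩ := hK s hs
        refine ⟨fun i => ((h i).comp (LinearMap.fst R _ _)).prod (-((h (i-1)).comp (LinearMap.snd R _ _))), ?_⟩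
        intro i y
        obtain ⟨y, z⟩ := y
        refine Prod.ext ?_ ?_
        · change (K.d i (h i y) + x • (- h (i-1) z)) + h (i-1) (K.d (i-1) y + x • z) = s • y
          rw [← hh, map_add, map_smul, smul_neg]; abel
        · change - (K.d (i-1) (- h (i-1) z)) + (- h (i-1-1) (- K.d (i-1-1) z)) = s • z
          rw [← hh, map_neg, map_neg, neg_neg, neg_neg]
    · intro j hj
      have := h2 j (by omega)
      have := h2 (j-1) (by omega)
      exact inferInstanceAs (Subsingleton (K.G j × K.G (j-1)))
    · have e : (rcmfKcone K x).d t ((0, ω) : K.G t × K.G (t-1)) =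
        x • LinearMap.inl R (K.G (t-1)) (K.G (t-1-1)) ω - LinearMap.inr R (K.G (t-1)) (K.G (t-1-1)) (K.d (t-1) ω) := by
        rw [rcmfKcone_d]; simp; rfl
      have m1 : x • LinearMap.inl R (K.G (t-1)) (K.G (t-1-1)) ω ∈ J • (⊤ : Submodule R (K.G (t-1) × K.G (t-1-1))) :=
        Submodule.smul_mem_smul (hl x List.mem_cons_self) trivial
      have m2 : LinearMap.inr R (K.G (t-1)) (K.G (t-1-1)) (K.d (t-1) ω) ∈ J • (⊤ : Submodule R (K.G (t-1) × K.G (t-1-1))) := by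
        have := Submodule.mem_map_of_mem (f := LinearMap.inr R (K.G (t-1)) (K.G (t-1-1))) h3
        rw [Submodule.map_smul''] at this
        exact Submodule.smul_mono le_rfl le_top this
      exact e ▸ Submodule.sub_mem _ m1 m2

lemma rcmfK_ext (K : RcmfK R) (l : List R) (n : ℕ) (hn : a ^ n ≤ Ideal.span {s | s ∈ l})
    (hK : ∀ s ∈ l, ∃ h : ∀ i, K.G (i-1) →ₗ[R] K.G i, ∀ i x, K.d i (h i x) + h (i-1) (K.d (i-1) x) = s • x)
    (E : Type) [AddCommGroup E] [Module R E] [Module.Injective R E] (hE : rcmfV a 0 E) (i : ℤ)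
    (φ : K.G (i-1) →ₗ[R] E) (hφ : ∀ x, φ (K.d i x) = 0) :
    ∃ ψ : K.G (i-1-1) →ₗ[R] E, ∀ x, φ x = ψ (K.d (i-1) x) := by
  have hker : LinearMap.ker (K.d (i-1)) ≤ LinearMap.ker φ := by
    intro x hx
    rw [LinearMap.mem_ker] at hx ⊢
    refine rcmfV_zero_iff.1 hE n _ fun r hr => ?_
    have : Ideal.span {s | s ∈ l} ≤ LinearMap.ker (LinearMap.toSpanSingleton R E (φ x)) := by
      rw [Ideal.span_le]
      intro s hs
      obtain ⟨h, hh⟩ := hK s hs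
      have := hh i x
      rw [hx, map_zero, add_zero] at this
      simp only [SetLike.mem_coe, LinearMap.mem_ker, LinearMap.toSpanSingleton_apply]
      rw [← map_smul, ← this, hφ]
    simpa using this (hn hr)
  obtain ⟨ψ, hψ⟩ := Module.Injective.out ((LinearMap.ker (K.d (i-1))).liftQ (K.d (i-1)) le_rfl)
    (LinearMap.ker_eq_bot.1 (Submodule.ker_liftQ_eq_bot _ _ _ le_rfl))
    ((LinearMap.ker (K.d (i-1))).liftQ φ hker)
  exact ⟨ψ, fun x => (hψ (Submodule.Quotient.mk x)).symm⟩

lemma rcmfK_main [IsNoetherianRing R] (K : RcmfK R) (l : List R) (n : ℕ) (hn : a ^ n ≤ Ideal.span {s | s ∈ l})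
    (hK : ∀ s ∈ l, ∃ h : ∀ i, K.G (i-1) →ₗ[R] K.G i, ∀ i x, K.d i (h i x) + h (i-1) (K.d (i-1) x) = s • x)
    (m : ℕ) : ∀ (i : ℤ), i ≤ m → ∀ (k : ℕ) (X Q : Type) [AddCommGroup X] [Module R X] [AddCommGroup Q] [Module R Q]
    (f : X →ₗ[R] Q), (∀ j, k ≤ j → rcmfV a j X) → (∀ j, j < k → rcmfV a j Q) →
    ∀ (φ : K.G (i-1) →ₗ[R] X), (∀ x, φ (K.d i x) = 0) →
    ∃ ψ : K.G (i-1-1) →ₗ[R] Q, ∀ x, f (φ x) = ψ (K.d (i-1) x) := by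
  induction m with
  | zero =>
    intro i hi k X Q _ _ _ _ f hX hQ φ hφ
    have := K.neg (i-1) (by simp at hi; omega)
    refine ⟨0, fun x => ?_⟩
    rw [Subsingleton.elim x 0]; simp
  | succ m ih =>
    intro i hi
    have main : ∀ (k : ℕ) (X Q : Type) [AddCommGroup X] [Module R X] [AddCommGroup Q] [Module R Q]
      (f : X →ₗ[R] Q), (∀ j, k + 1 ≤ j → rcmfV a j X) → (∀ j, j < k + 1 → rcmfV a j Q) →
      ∀ (φ : K.G (i-1) →ₗ[R] X), (∀ x, φ (K.d i x) = 0) →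
      ∃ ψ : K.G (i-1-1) →ₗ[R] Q, ∀ x, f (φ x) = ψ (K.d (i-1) x) := by
      intro k X Q _ _ _ _ f hX hQ φ hφ
      have hQ0 := hQ 0 (by omega)
      have hle : rcmfΓ a X ≤ LinearMap.ker f := fun x hx => by
        have := rcmfΓ_map f hx
        rw [rcmfV_zero_iff'.1 hQ0] at this
        exact this
      let fb := (rcmfΓ a X).liftQ f hle
      have hXb : ∀ j, k + 1 ≤ j → rcmfV a j (X ⧸ rcmfΓ a X) := fun j hj =>
        rcmfV_right (f := (rcmfΓ a X).subtype) (g := (rcmfΓ a X).mkQ) Subtype.val_injective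
          (LinearMap.exact_iff.2 (by simp)) (Submodule.mkQ_surjective _) (hX j hj) (rcmfV_torsion rcmfΓ_Γ j)
      obtain ⟨E, _, _, _, iX, hiX, hE⟩ := rcmf_exists_inj_free (a := a) (rcmfV_zero_quot (a := a) (X := X))
      obtain ⟨E', _, _, _, iQ, hiQ, hE'⟩ := rcmf_exists_inj_free hQ0
      obtain ⟨g, hg⟩ := Module.Injective.out iX hiX (iQ.comp fb)
      obtain ⟨ψ, hψ⟩ := rcmfK_ext K l n hn hK E (hE 0) i (iX.comp ((rcmfΓ a X).mkQ.comp φ))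
        (fun x => by simp [hφ])
      have hle2 : LinearMap.range iX ≤ (LinearMap.range iQ).comap g := by
        rintro _ ⟨x, rfl⟩
        exact ⟨fb x, (hg x).symm⟩
      obtain ⟨χ, hχ⟩ := ih (i-1) (by push_cast at hi ⊢; omega) k (E ⧸ LinearMap.range iX) (E' ⧸ LinearMap.range iQ)
        (Submodule.mapQ _ _ g hle2)
        (fun j hj => rcmfV_right hiX (rcmf_exact iX) (Submodule.mkQ_surjective _) (hE j) (hXb (j+1) (by omega)))
        (fun j hj => rcmfV_right hiQ (rcmf_exact iQ) (Submodule.mkQ_surjective _) (hE' j) (hQ (j+1) (by omega)))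
        ((LinearMap.range iX).mkQ.comp ψ)
        (fun x => by
          rw [LinearMap.comp_apply, ← hψ]
          simp)
      obtain ⟨χ', hχ'⟩ := Module.projective_lifting_property (LinearMap.range iQ).mkQ χ (Submodule.mkQ_surjective _)
      let θ0 : K.G (i-1-1) →ₗ[R] E' := g.comp ψ - χ'.comp (K.d (i-1-1))
      have hθ0 : ∀ x, θ0 x ∈ LinearMap.range iQ := by
        intro x
        have h1 := hχ x
        rw [← hχ'] at h1
        rw [← Submodule.Quotient.mk_eq_zero]
        change (LinearMap.range iQ).mkQ (g (ψ x) - χ' (K.d (i-1-1) x)) = 0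
        rw [map_sub, sub_eq_zero]
        exact h1
      let e := LinearEquiv.ofInjective iQ hiQ
      have he : ∀ y, iQ (e.symm y) = y := fun y => by
        rw [← LinearEquiv.ofInjective_apply (h := hiQ)]; exact congrArg Subtype.val (e.apply_symm_apply y)
      refine ⟨e.symm.toLinearMap.comp (θ0.codRestrict _ hθ0), fun x => hiQ ?_⟩
      rw [LinearMap.comp_apply, LinearEquiv.coe_coe, he]
      change iQ (f (φ x)) = g (ψ (K.d (i-1) x)) - χ' (K.d (i-1-1) (K.d (i-1) x))
      rw [K.dd, map_zero, sub_zero, ← hψ, LinearMap.comp_apply, hg]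
      rfl
    intro k X Q _ _ _ _ f hX hQ φ hφ
    cases k with
    | succ k => exact main k X Q f hX hQ φ hφ
    | zero =>
      obtain ⟨ψ, hψ⟩ := main 0 X X LinearMap.id (fun j _ => hX j (Nat.zero_le _)) (fun j _ => hX j (Nat.zero_le _)) φ hφ
      exact ⟨f.comp ψ, fun x => by rw [LinearMap.comp_apply, ← hψ]; rfl⟩

lemma rcmf_key_pow [IsNoetherianRing R] (k : ℕ) (X Q : Type) [AddCommGroup X] [Module R X] [AddCommGroup Q] [Module R Q]
    (f : X →ₗ[R] Q) (hX : ∀ j, k ≤ j → rcmfV a j X) (hQ : ∀ j, j < k → rcmfV a j Q) (n : ℕ) (x : X) :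
    f x ∈ a ^ n • (⊤ : Submodule R Q) := by
  obtain ⟨s, hs⟩ := (IsNoetherian.noetherian (a ^ n) : (a ^ n).FG)
  have hspan : Ideal.span {r | r ∈ s.toList} = a ^ n := by
    rw [← hs]; congr 1; ext; simp
  obtain ⟨K, hK, t, ω, τ, h1, h2, h3⟩ := rcmfK_exists (a ^ n) s.toList (fun r hr => by
    rw [← hspan]; exact Ideal.subset_span hr)
  obtain ⟨t, rfl⟩ : ∃ t', t = t' - 1 := ⟨t+1, by omega⟩
  obtain ⟨ψ, hψ⟩ := rcmfK_main K s.toList n hspan.ge hK t.toNat t (by omega) k X Q f hX hQ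
    ((LinearMap.toSpanSingleton R X x).comp τ) (fun y => by
      have := h2 t (by omega)
      rw [Subsingleton.elim y 0]; simp)
  have := hψ ω
  simp only [LinearMap.comp_apply, h1, LinearMap.toSpanSingleton_apply, one_smul] at this
  rw [this]
  have := Submodule.mem_map_of_mem (f := ψ) h3
  rw [Submodule.map_smul''] at this
  exact Submodule.smul_mono le_rfl le_top this

lemma rcmf_key [IsNoetherianRing R] [IsLocalRing R] (ha : a ≠ ⊤) (k : ℕ) (X Q : Type) [AddCommGroup X] [Module R X]
    [AddCommGroup Q] [Module R Q] [Module.Finite R Q]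
    (f : X →ₗ[R] Q) (hX : ∀ j, k ≤ j → rcmfV a j X) (hQ : ∀ j, j < k → rcmfV a j Q) : f = 0 := by
  ext x
  have := Ideal.iInf_pow_smul_eq_bot_of_isLocalRing (M := Q) a ha
  have h2 : f x ∈ (⨅ n : ℕ, a ^ n • (⊤ : Submodule R Q)) := by
    rw [Submodule.mem_iInf]
    exact fun n => rcmf_key_pow k X Q f hX hQ n x
  rw [this] at h2
  exact h2

end

end

section
open CategoryTheory Opposite Limits

section
variable {R : Type} [CommRing R] {a : Ideal R}

lemma rcmf_exists_largest [IsNoetherianRing R] (M : Type) [AddCommGroup M] [Module R M] [Module.Finite R M] (i : ℕ) :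
    ∃ N : Submodule R M, (∀ j, i < j → rcmfV a j N) ∧
      ∀ N' : Submodule R M, (∀ j, i < j → rcmfV a j N') → N' ≤ N := by
  obtain ⟨N, hN, hmax⟩ := set_has_maximal_iff_noetherian.2 (inferInstanceAs (IsNoetherian R M))
    {N : Submodule R M | ∀ j, i < j → rcmfV a j N} ⟨⊥, fun j _ => rcmfV_subsingleton j⟩
  refine ⟨N, hN, fun N' hN' => ?_⟩
  have hsup : ∀ j, i < j → rcmfV a j (N ⊔ N' : Submodule R M) := by
    intro j hj
    let g : (N × N') →ₗ[R] (N ⊔ N' : Submodule R M) :=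
      (Submodule.inclusion le_sup_left).coprod (Submodule.inclusion le_sup_right)
    have hg : Function.Surjective g := by
      rintro ⟨y, hy⟩
      obtain ⟨u, hu, v, hv, rfl⟩ := Submodule.mem_sup.1 hy
      exact ⟨(⟨u, hu⟩, ⟨v, hv⟩), rfl⟩
    refine rcmf_gruson (N × N') (i+1) (fun j hj => ?_) j hj _ (g.annihilator_le_of_surjective hg)
    exact rcmfV_mid (f := LinearMap.inl R N N') (g := LinearMap.snd R N N') LinearMap.inl_injective
      .inl_snd LinearMap.snd_surjective (hN j hj) (hN' j hj)
  by_contra hlt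
  exact hmax _ hsup (left_lt_sup.2 hlt)

lemma rcmfV_factor_congr {M : Type} [AddCommGroup M] [Module R M] (A B A' B' : Submodule R M) (hA : A = A')
    (hB : B = B') (j : ℕ) (h : rcmfV a j (A ⧸ B.comap A.subtype)) : rcmfV a j (A' ⧸ B'.comap A'.subtype) := by
  subst hA hB; exact h

lemma rcmf_relCM [IsNoetherianRing R] {X : Type} [AddCommGroup X] [Module R X] {i : ℕ} (h : Subsingleton X ∨ (IsRelCM a X ∧ cohDim a X = i))
    (j : ℕ) (hj : j ≠ i) : rcmfV a j X := by
  rcases h with h | ⟨⟨c, hc⟩, h2⟩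
  · exact rcmfV_subsingleton j
  · have : {i : ℕ | Nontrivial ((localCohomology a i).obj (ModuleCat.of R X))} = {c} := by
      ext k; exact hc k
    have h3 : cohDim a X = c := by
      unfold cohDim; rw [this]; exact csSup_singleton c
    by_contra hV
    exact hj (((hc j).1 (rcmf_not_V.1 hV)).trans (h3.symm.trans h2))

lemma rcmf_of_local [IsNoetherianRing R] [IsLocalRing R] (ha : a ≠ ⊤) {X : Type} [AddCommGroup X] [Module R X]
    [Module.Finite R X] {i : ℕ} (h : ∀ j, j ≠ i → rcmfV a j X) : Subsingleton X ∨ (IsRelCM a X ∧ cohDim a X = i) := by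
  by_cases hi : rcmfV a i X
  · left
    have := rcmf_key ha 0 X X LinearMap.id (fun j _ => by
      by_cases hj : j = i
      · exact hj ▸ hi
      · exact h j hj) (fun j hj => by omega)
    exact ⟨fun x y => by
      rw [← LinearMap.id_apply (R := R) x, ← LinearMap.id_apply (R := R) y, this]; rfl⟩
  · right
    have key : ∀ j, Nontrivial ((localCohomology a j).obj (ModuleCat.of R X)) ↔ j = i := by
      intro j
      rw [← rcmf_not_V]
      exact ⟨fun hj => by_contra fun hne => hj (h j hne), fun hj => hj ▸ hi⟩
    refine ⟨⟨i, key⟩, ?_⟩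
    have : {i : ℕ | Nontrivial ((localCohomology a i).obj (ModuleCat.of R X))} = {i} := by
      ext k; exact key k
    unfold cohDim; rw [this]; exact csSup_singleton i

section
variable {S : Submonoid R} {M M' : Type} [AddCommGroup M] [Module R M]
  [AddCommGroup M'] [Module R M'] [Module (Localization S) M'] [IsScalarTower R (Localization S) M']
  (f : M →ₗ[R] M') [IsLocalizedModule S f]

lemma rcmfV_loc_sub [IsNoetherianRing R] (N : Submodule R M) (j : ℕ) (h : rcmfV a j N) :
    rcmfV (a.map (algebraMap R (Localization S))) j (N.localized' (Localization S) S f) :=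
  rcmfV_loc (N.toLocalized' (Localization S) S f) j h

lemma rcmfV_loc_factor [IsNoetherianRing R] (A B : Submodule R M) (hBA : B ≤ A) (j : ℕ)
    (h : rcmfV a j (A ⧸ B.comap A.subtype)) :
    rcmfV (a.map (algebraMap R (Localization S))) j (A.localized' (Localization S) S f ⧸
      (B.localized' (Localization S) S f).comap (A.localized' (Localization S) S f).subtype) := by
  let u := A.toLocalized' (Localization S) S f
  have hu : ∀ x, (u x : M') = f x := fun x => rfl
  have e : (B.comap A.subtype).localized' (Localization S) S u =
      (B.localized' (Localization S) S f).comap (A.localized' (Localization S) S f).subtype := by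
    ext x
    rw [Submodule.mem_localized', Submodule.mem_comap, Submodule.mem_localized']
    constructor
    · rintro ⟨m, hm, s, hs⟩
      refine ⟨m, hm, s, ?_⟩
      rw [IsLocalizedModule.mk'_eq_iff] at hs ⊢
      rw [← hu, hs]; rfl
    · rintro ⟨m, hm, s, hs⟩
      refine ⟨⟨m, hBA hm⟩, hm, s, ?_⟩
      rw [IsLocalizedModule.mk'_eq_iff] at hs ⊢
      exact Subtype.ext hs
  rw [← e]
  exact rcmfV_loc (Submodule.toLocalizedQuotient' (Localization S) S u (B.comap A.subtype)) j h
end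

end

end

/-- Proposition 2.16: if `M` is an RCMF `R`-module w.r.t. `𝔞`, then `M_𝔭` is an RCMF
`R_𝔭`-module w.r.t. `𝔞R_𝔭` for every prime `𝔭 ∈ Supp(M) ∩ V(𝔞)`. -/
theorem stmt16 {R : Type} [CommRing R] [IsNoetherianRing R]
    (𝔞 : Ideal R) (h𝔞 : 𝔞 ≠ ⊤)
    (M : Type) [AddCommGroup M] [Module R M] [Module.Finite R M]
    (hM : IsRCMF 𝔞 M)
    (p : PrimeSpectrum R) (hsupp : p ∈ Module.support R M) (hV : 𝔞 ≤ p.asIdeal) :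
    IsRCMF (𝔞.map (algebraMap R (Localization.AtPrime p.asIdeal)))
      (LocalizedModule p.asIdeal.primeCompl M) := by
  set S := p.asIdeal.primeCompl with hS
  set b : Ideal (Localization.AtPrime p.asIdeal) := 𝔞.map (algebraMap R (Localization.AtPrime p.asIdeal)) with hb
  have hbtop : b ≠ ⊤ := by
    intro h
    have h1 : b ≤ IsLocalRing.maximalIdeal (Localization.AtPrime p.asIdeal) := by
      rw [← Localization.AtPrime.map_eq_maximalIdeal]
      exact Ideal.map_mono hV
    rw [h, top_le_iff] at h1
    exact (IsLocalRing.maximalIdeal.isMaximal _).ne_top h1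
  let f := LocalizedModule.mkLinearMap S M
  haveI : IsNoetherianRing (Localization.AtPrime p.asIdeal) := IsLocalization.isNoetherianRing S _ inferInstance
  haveI : Module.Finite (Localization.AtPrime p.asIdeal) (LocalizedModule S M) :=
    Module.Finite.of_isLocalizedModule S f
  choose F hF1 hF2 using fun i => rcmf_exists_largest (a := 𝔞) M i
  have hmono : ∀ i, F (i-1) ≤ F i := fun i => hF2 i _ fun j hj => hF1 (i-1) j (by omega)
  set c := cohDim 𝔞 M with hc
  have hVM : ∀ j, c < j → rcmfV 𝔞 j M := rcmf_cohDim_le.1 hc.ge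
  have hFc : F c = ⊤ := top_le_iff.1 <| hF2 c ⊤ fun j hj =>
    rcmfV_equiv (Submodule.topEquiv (R := R) (M := M)).symm (hVM j hj)
  have hFcd : IsCdFiltration 𝔞 c F := fun i _ =>
    ⟨rcmf_cohDim_le.2 (hF1 i), fun N hN => hF2 i N (rcmf_cohDim_le.1 hN)⟩
  have hfac : ∀ i, 1 ≤ i → i ≤ c → ∀ j, j ≠ i → rcmfV 𝔞 j (F i ⧸ (F (i-1)).comap (F i).subtype) :=
    fun i h1 h2 j hj => rcmf_relCM (hM F hFcd i h1 h2) j hj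
  let L : ℕ → Submodule (Localization.AtPrime p.asIdeal) (LocalizedModule S M) := fun i =>
    (F i).localized' (Localization S) S f
  have hL1 : ∀ i j, i < j → rcmfV b j (L i) := fun i j hj => rcmfV_loc_sub f (F i) j (hF1 i j hj)
  have hLfac : ∀ i, 1 ≤ i → i ≤ c → ∀ j, j ≠ i → rcmfV b j (L i ⧸ (L (i-1)).comap (L i).subtype) :=
    fun i h1 h2 j hj => rcmfV_loc_factor f _ _ (hmono i) j (hfac i h1 h2 j hj)
  have hLc : L c = ⊤ := by
    change (F c).localized' (Localization S) S f = ⊤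
    rw [hFc, Submodule.localized'_top]
  have hL2 : ∀ i ≤ c, ∀ N : Submodule (Localization.AtPrime p.asIdeal) (LocalizedModule S M),
      (∀ j, i < j → rcmfV b j N) → N ≤ L i := by
    intro i hi N hN
    have : ∀ m, m ≤ c - i → N ≤ L (c - m) := by
      intro m
      induction m with
      | zero => intro _; rw [Nat.sub_zero, hLc]; exact le_top
      | succ m ih =>
        intro hm
        have hle := ih (by omega)
        have h0 := rcmf_key hbtop (c - m) N (L (c-m) ⧸ (L (c-m-1)).comap (L (c-m)).subtype)
          (((L (c-m-1)).comap (L (c-m)).subtype).mkQ.comp (Submodule.inclusion hle))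
          (fun j hj => hN j (by omega))
          (fun j hj => hLfac (c-m) (by omega) (by omega) j (by omega))
        intro x hx
        have h1 := congrArg (fun g => g ⟨x, hx⟩) h0
        have h2 := (Submodule.Quotient.mk_eq_zero _).1 h1
        rw [show c - (m+1) = c - m - 1 by omega]
        exact h2
    have h := this (c - i) le_rfl
    rwa [show c - (c - i) = i by omega] at h
  have hc' : cohDim b (LocalizedModule S M) ≤ c :=
    rcmf_cohDim_le.2 fun j hj => rcmfV_loc f j (hVM j hj)
  intro G hG i hi1 hi2
  have hGL : ∀ i ≤ cohDim b (LocalizedModule S M), G i = L i := fun i hi =>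
    le_antisymm (hL2 i (hi.trans hc') _ (rcmf_cohDim_le.1 (hG i hi).1))
      ((hG i hi).2 _ (rcmf_cohDim_le.2 (hL1 i)))
  have hfin : Module.Finite (Localization.AtPrime p.asIdeal) (G i ⧸ (G (i-1)).comap (G i).subtype) := inferInstance
  exact rcmf_of_local (X := G i ⧸ (G (i-1)).comap (G i).subtype) hbtop fun j hj =>
    rcmfV_factor_congr _ _ _ _ (hGL i hi2).symm (hGL (i-1) ((Nat.sub_le i 1).trans hi2)).symm j
      (hLfac i hi1 (hi2.trans hc') j hj)
end

section
/- Let R be a Noetherian ring, 𝔞 ⊊ R a proper ideal, and M a finite RCMF R-module with respect to 𝔞. Then the 𝔞-adic completion M̂ is an RCMF R̂-module with respect to 𝔞R̂, where R̂ is the 𝔞-adic completion of R. -/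
open CategoryTheory

noncomputable section
namespace LC
open Opposite Limits

section OldNew
variable {R : Type} [CommRing R] {X Y : ModuleCat.{0} R}

abbrev OE (n : ℕ) (X Y : ModuleCat.{0} R) : ModuleCat.{0} R :=
  ((_root_.Ext R (ModuleCat.{0} R) n).obj (op X)).obj Y

abbrev YF (Y : ModuleCat.{0} R) : ModuleCat.{0} R ⥤ (ModuleCat.{0} R)ᵒᵖ :=
  ((linearYoneda R (ModuleCat.{0} R)).obj Y).rightOp

abbrev KK (P : ProjectiveResolution X) (Y : ModuleCat.{0} R) :
    ChainComplex (ModuleCat.{0} R)ᵒᵖ ℕ :=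
  ((YF Y).mapHomologicalComplex _).obj P.complex

def Rep (P : ProjectiveResolution X) (n : ℕ) (x : OE n X Y) (f : P.complex.X n ⟶ Y) : Prop :=
  ∃ c : (((KK P Y).opcycles n).unop : ModuleCat R),
    ((KK P Y).homologyι n).unop c = (P.isoLeftDerivedObj (YF Y) n).inv.unop x ∧
    ((KK P Y).pOpcycles n).unop c = f

lemma Rep.exists (P : ProjectiveResolution X) (n : ℕ) (x : OE n X Y) :
    ∃ f, Rep P n x f := by
  have h : Function.Surjective (((KK P Y).homologyι n).unop) := by
    rw [← ModuleCat.epi_iff_surjective]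
    infer_instance
  obtain ⟨c, hc⟩ := h ((P.isoLeftDerivedObj (YF Y) n).inv.unop x)
  exact ⟨_, c, hc, rfl⟩

lemma Rep.cocycle (P : ProjectiveResolution X) (n m : ℕ)  (x : OE n X Y) (f)
    (hf : Rep P n x f) : P.complex.d m n ≫ f = 0 := by
  obtain ⟨c, -, rfl⟩ := hf
  have := (KK P Y).d_pOpcycles m n
  have h2 := congrArg Quiver.Hom.unop this
  have h3 := ConcreteCategory.congr_hom h2 c
  exact h3

lemma Rep.exists' (P : ProjectiveResolution X) (n : ℕ) (f : P.complex.X n ⟶ Y)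
    (hf : P.complex.d (n+1) n ≫ f = 0) : ∃ x, Rep P n x f := by
  have hex : ((KK P Y).sc' (n+1) n ((ComplexShape.down ℕ).next n)).op.Exact ∨ True := Or.inr trivial
  have h1 : (ShortComplex.mk _ _ ((KK P Y).d_pOpcycles (n+1) n)).Exact := by
    apply ShortComplex.exact_of_g_is_cokernel
    exact (KK P Y).opcyclesIsCokernel (n+1) n (by simp)
  have h2 := h1.unop
  rw [ShortComplex.moduleCat_exact_iff] at h2
  obtain ⟨c, hc⟩ := h2 f hf
  refine ⟨(P.isoLeftDerivedObj (YF Y) n).hom.unop (((KK P Y).homologyι n).unop c), c, ?_, hc⟩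
  have := congrArg Quiver.Hom.unop (P.isoLeftDerivedObj (YF Y) n).inv_hom_id
  exact (ConcreteCategory.congr_hom this (((KK P Y).homologyι n).unop c)).symm

lemma Rep.eq_zero_iff (P : ProjectiveResolution X) (n : ℕ) (x : OE n X Y) (f)
    (hf : Rep P n x f) :
    x = 0 ↔ ∃ g : P.complex.X ((ComplexShape.down ℕ).next n) ⟶ Y,
      P.complex.d n _ ≫ g = f := by
  obtain ⟨c, hc, rfl⟩ := hf
  have hinj : Function.Injective (((KK P Y).pOpcycles n).unop) := by
    rw [← ModuleCat.mono_iff_injective]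
    infer_instance
  have hx : x = 0 ↔ ((KK P Y).homologyι n).unop c = 0 := by
    rw [hc]
    constructor
    · rintro rfl
      exact map_zero (P.isoLeftDerivedObj (YF Y) n).inv.unop.hom
    · intro h
      have := congrArg Quiver.Hom.unop (P.isoLeftDerivedObj (YF Y) n).hom_inv_id
      have h2 := (ConcreteCategory.congr_hom this x)
      refine h2.symm.trans ?_
      change (P.isoLeftDerivedObj (YF Y) n).hom.unop ((P.isoLeftDerivedObj (YF Y) n).inv.unop x) = 0
      rw [h]
      exact map_zero (P.isoLeftDerivedObj (YF Y) n).hom.unop.hom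
  rw [hx]
  have h1 : (ShortComplex.mk _ _ ((KK P Y).homologyι_comp_fromOpcycles n
      ((ComplexShape.down ℕ).next n))).Exact := by
    apply ShortComplex.exact_of_f_is_kernel
    exact (KK P Y).homologyIsKernel n _ rfl
  have h2 := h1.unop
  rw [ShortComplex.moduleCat_exact_iff] at h2
  constructor
  · intro h
    obtain ⟨g, hg⟩ := h2 c h
    refine ⟨g, ?_⟩
    have h3 := congrArg Quiver.Hom.unop ((KK P Y).p_fromOpcycles n ((ComplexShape.down ℕ).next n))
    have h4 := (ConcreteCategory.congr_hom h3 g).symm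
    refine Eq.trans h4 ?_
    change ((KK P Y).pOpcycles n).unop (((KK P Y).fromOpcycles n ((ComplexShape.down ℕ).next n)).unop g) = _
    exact congrArg _ hg
  · rintro ⟨g, hg⟩
    have h3 := congrArg Quiver.Hom.unop ((KK P Y).p_fromOpcycles n ((ComplexShape.down ℕ).next n))
    have h4 := (ConcreteCategory.congr_hom h3 g).symm
    have h5 : ((KK P Y).fromOpcycles n ((ComplexShape.down ℕ).next n)).unop g = c := by
      apply hinj
      rw [← hg]
      exact h4.symm
    rw [← h5]
    have h6 := congrArg Quiver.Hom.unop ((KK P Y).homologyι_comp_fromOpcycles n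
      ((ComplexShape.down ℕ).next n))
    exact (ConcreteCategory.congr_hom h6 g)

lemma Rep.map {X' : ModuleCat.{0} R} (P : ProjectiveResolution X) (P' : ProjectiveResolution X')
    (g : X' ⟶ X) (φ : ProjectiveResolution.Hom P' P g)
    (n : ℕ) (x : OE n X Y) (f) (hf : Rep P n x f) :
    Rep P' n (((_root_.Ext R (ModuleCat.{0} R) n).map g.op).app Y x) (φ.hom.f n ≫ f) := by
  obtain ⟨c, hc, rfl⟩ := hf
  let ψ : KK P' Y ⟶ KK P Y := ((YF Y).mapHomologicalComplex _).map φ.hom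
  refine ⟨(HomologicalComplex.opcyclesMap ψ n).unop c, ?_, ?_⟩
  · have h1 := congrArg Quiver.Hom.unop (HomologicalComplex.homologyι_naturality ψ n)
    have h2 := (ConcreteCategory.congr_hom h1 c)
    refine (Eq.symm h2).trans ?_
    change (HomologicalComplex.homologyMap ψ n).unop (((KK P Y).homologyι n).unop c) = _
    rw [hc]
    have h3 := congrArg Quiver.Hom.unop (ProjectiveResolution.isoLeftDerivedObj_inv_naturality g P' P φ.hom
      (by simpa using φ.hom_f_zero_comp_π_f_zero) (YF Y) n)
    exact (ConcreteCategory.congr_hom h3 x).symm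
  · have h1 := congrArg Quiver.Hom.unop (HomologicalComplex.p_opcyclesMap ψ n)
    have h2 := (ConcreteCategory.congr_hom h1 c)
    exact h2

lemma extMk_eq_zero (P : ProjectiveResolution X) {n : ℕ} (f : P.complex.X n ⟶ Y)
    (hf : P.complex.d (n+1) n ≫ f = 0) :
    P.extMk f (n+1) rfl hf = 0 ↔ ∃ g : P.complex.X ((ComplexShape.down ℕ).next n) ⟶ Y,
      P.complex.d n _ ≫ g = f := by
  cases n with
  | succ p =>
    rw [ProjectiveResolution.extMk_eq_zero_iff P f (p+1+1) rfl hf p rfl]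
    rw [ChainComplex.next_nat_succ]
  | zero =>
    have h0 : P.complex.d 0 ((ComplexShape.down ℕ).next 0) = 0 := by
      apply HomologicalComplex.shape; simp
    have h1 : (∃ g : P.complex.X ((ComplexShape.down ℕ).next 0) ⟶ Y,
      P.complex.d 0 _ ≫ g = f) ↔ f = 0 := by
      rw [h0]
      constructor
      · rintro ⟨g, hg⟩; rw [← hg]; simp
      · rintro rfl; exact ⟨0, by simp⟩
    rw [h1]
    constructor
    · intro h
      have h2 := congrArg P.extEquivCohomologyClass h
      rw [ProjectiveResolution.extEquivCohomologyClass_extMk,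
        ProjectiveResolution.extEquivCohomologyClass_zero,
        CochainComplex.HomComplex.CohomologyClass.mk_eq_zero_iff,
        CochainComplex.HomComplex.Cocycle.toSingleMk_mem_coboundaries_iff _ _ _ _ _ 1 (by simp)] at h2
      obtain ⟨g, hg⟩ := h2
      have hz : IsZero (P.cochainComplex.X 1) := by
        apply CochainComplex.isZero_of_isStrictlyLE _ 0 1 (by simp)
      have : g = 0 := hz.eq_of_src _ _
      rw [this, comp_zero] at hg
      have := (P.cochainComplexXIso (-(0:ℕ)) 0 rfl).isIso_hom
      rw [← cancel_epi (P.cochainComplexXIso (-(0:ℕ)) 0 rfl).hom, ← hg, comp_zero]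
    · intro h; subst h; simp

/-- transfer of dies after pulling back along `g`. -/
lemma old_dies_iff {X' : ModuleCat.{0} R} (n : ℕ) (P : ProjectiveResolution X) (g : X' ⟶ X)
    (x : OE n X Y) (f) (hf : Rep P n x f) :
    ((_root_.Ext R (ModuleCat.{0} R) n).map g.op).app Y x = 0 ↔
    (Abelian.Ext.mk₀ g).comp (P.extMk f (n+1) rfl (Rep.cocycle P n (n+1) x f hf)) (zero_add n) = 0 := by
  obtain ⟨P'⟩ : Nonempty (ProjectiveResolution X') := HasProjectiveResolution.out
  let φ : ProjectiveResolution.Hom P' P g :=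
    ⟨ProjectiveResolution.lift g P' P, by
      rw [ProjectiveResolution.lift_commutes_zero]; simp⟩
  rw [ProjectiveResolution.mk₀_comp_extMk f (n+1) rfl _ φ, extMk_eq_zero,
    (Rep.map P P' g φ n x f hf).eq_zero_iff]

end OldNew

variable {R : Type} [CommRing R]

abbrev qmap (I : Ideal R) {n m : ℕ} (h : n ≤ m) :
    ModuleCat.of R (R ⧸ I ^ m) ⟶ ModuleCat.of R (R ⧸ I ^ n) :=
  ModuleCat.ofHom (Submodule.mapQ _ _ LinearMap.id (Ideal.pow_le_pow_right h))

/-- vanishing of local cohomology in terms of `Abelian.Ext`. -/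
def Van (I : Ideal R) (i : ℕ) (M : ModuleCat.{0} R) : Prop :=
  ∀ (n : ℕ) (e : Abelian.Ext (ModuleCat.of R (R ⧸ I ^ n)) M i),
    ∃ (m : ℕ) (h : n ≤ m), (Abelian.Ext.mk₀ (qmap I h)).comp e (zero_add i) = 0

theorem van_iff (I : Ideal R) (i : ℕ) (M : ModuleCat.{0} R) :
    Subsingleton ((localCohomology I i).obj M) ↔ Van I i M := by
  let D := localCohomology.diagram (localCohomology.idealPowersDiagram I) i
  let F : (ℕᵒᵖ)ᵒᵖ ⥤ ModuleCat.{0} R := D ⋙ (evaluation _ _).obj M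
  have e : (localCohomology I i).obj M ≅ colimit F := colimitObjIsoColimitCompEvaluation D M
  have h1 : Subsingleton ((localCohomology I i).obj M) ↔ Subsingleton (colimit F : ModuleCat R) :=
    e.toLinearEquiv.toEquiv.subsingleton_congr
  rw [h1]
  constructor
  · intro hs n ε
    obtain ⟨P⟩ : Nonempty (ProjectiveResolution (ModuleCat.of R (R ⧸ I ^ n))) := HasProjectiveResolution.out
    obtain ⟨f, hf, rfl⟩ := P.extMk_surjective ε (i+1) rfl
    obtain ⟨x, hx⟩ := Rep.exists' P i f hf
    have h0 : (colimit.ι F (op (op n))).hom x = 0 := Subsingleton.elim _ _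
    obtain ⟨j', k, hk⟩ := Concrete.colimit_rep_eq_zero R F (op (op n)) x h0
    have hle : n ≤ j'.unop.unop := k.unop.unop.down.down
    refine ⟨_, hle, ?_⟩
    rw [← old_dies_iff i P (qmap I hle) x f hx]
    exact hk
  · intro hv
    refine ⟨fun a b => ?_⟩
    suffices h : ∀ a : (colimit F : ModuleCat R), a = 0 by rw [h a, h b]
    intro a
    obtain ⟨j, x, rfl⟩ := Concrete.colimit_exists_rep F a
    obtain ⟨P⟩ : Nonempty (ProjectiveResolution (ModuleCat.of R (R ⧸ I ^ j.unop.unop))) :=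
      HasProjectiveResolution.out
    obtain ⟨f, hf⟩ := Rep.exists P i (Y := M) x
    obtain ⟨m, hm, h⟩ := hv _ (P.extMk f (i+1) rfl (Rep.cocycle P i (i+1) x f hf))
    rw [← old_dies_iff i P (qmap I hm) x f hf] at h
    have hk : F.map (homOfLE hm).op.op x = 0 := h
    have := ConcreteCategory.congr_hom (colimit.w F (homOfLE hm).op.op) x
    refine this.symm.trans ?_
    change colimit.ι F _ (F.map (homOfLE hm).op.op x) = 0
    rw [hk]
    exact map_zero (colimit.ι F _).hom

end LC
end


noncomputable section
namespace LC
open Opposite Limits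

section Basics
variable {R : Type} [CommRing R]
variable {A B C D T X : Type} [AddCommGroup A] [Module R A] [AddCommGroup B] [Module R B]
  [AddCommGroup C] [Module R C] [AddCommGroup D] [Module R D] [AddCommGroup T] [Module R T]
  [AddCommGroup X] [Module R X]

/-- short exact sequences of modules -/
structure SES (f : A →ₗ[R] B) (g : B →ₗ[R] C) : Prop where
  inj : Function.Injective f
  ex : Function.Exact f g
  surj : Function.Surjective g

abbrev SES.sc {f : A →ₗ[R] B} {g : B →ₗ[R] C} (h : SES f g) : ShortComplex (ModuleCat.{0} R) :=
  ModuleCat.shortComplexOfCompEqZero f g (by ext x; exact h.ex.apply_apply_eq_zero x)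

lemma SES.se {f : A →ₗ[R] B} {g : B →ₗ[R] C} (h : SES f g) : h.sc.ShortExact :=
  ModuleCat.shortComplex_shortExact _ h.ex h.inj h.surj

lemma SES.quot (N : Submodule R A) : SES N.subtype N.mkQ :=
  ⟨N.subtype_injective, LinearMap.exact_subtype_mkQ N, N.mkQ_surjective⟩

lemma SES.ker {g : B →ₗ[R] C} (hg : Function.Surjective g) : SES (LinearMap.ker g).subtype g :=
  ⟨Submodule.subtype_injective _, LinearMap.exact_subtype_ker_map g, hg⟩

lemma SES.coker {f : A →ₗ[R] B} (hf : Function.Injective f) : SES f (LinearMap.range f).mkQ :=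
  ⟨hf, LinearMap.exact_map_mkQ_range f, Submodule.mkQ_surjective _⟩

lemma SES.iso (e : A ≃ₗ[R] B) : SES e.toLinearMap (0 : B →ₗ[R] PUnit.{1}) :=
  ⟨e.injective, fun y => ⟨fun _ => e.surjective y, fun _ => rfl⟩, fun x => ⟨0, rfl⟩⟩

lemma SES.prod : SES (LinearMap.inl R A B) (LinearMap.snd R A B) :=
  ⟨LinearMap.inl_injective, Function.Exact.inl_snd, LinearMap.snd_surjective⟩

variable (R) in
abbrev EX (k : ℕ) (A B : Type) [AddCommGroup A] [Module R A] [AddCommGroup B] [Module R B] :=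
  Abelian.Ext (ModuleCat.of R A) (ModuleCat.of R B) k

variable (R) in
/-- vanishing of Ext -/
def EV (k : ℕ) (A B : Type) [AddCommGroup A] [Module R A] [AddCommGroup B] [Module R B] : Prop :=
  ∀ e : EX R k A B, e = 0

section cov
variable {f : A →ₗ[R] B} {g : B →ₗ[R] C} (h : SES f g) {k : ℕ}
include h

lemma EV.mid (h1 : EV R k T A) (h2 : EV R k T C) : EV R k T B := by
  intro e
  obtain ⟨x, rfl⟩ := Abelian.Ext.covariant_sequence_exact₂ _ h.se e (h2 _)
  rw [h1 x, Abelian.Ext.zero_comp]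

lemma EV.right (h1 : EV R k T B) (h2 : EV R (k+1) T A) : EV R k T C := by
  intro e
  obtain ⟨x, rfl⟩ := Abelian.Ext.covariant_sequence_exact₃ _ h.se e rfl (h2 _)
  rw [h1 x, Abelian.Ext.zero_comp]

lemma EV.left (h1 : EV R (k+1) T B) (h2 : EV R k T C) : EV R (k+1) T A := by
  intro e
  obtain ⟨x, rfl⟩ := Abelian.Ext.covariant_sequence_exact₁ _ h.se e (h1 _) rfl
  rw [h2 x, Abelian.Ext.zero_comp]

lemma EV.left0 (h1 : EV R 0 T B) : EV R 0 T A := by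
  intro e
  have := h.se.mono_f
  exact Abelian.Ext.postcomp_mk₀_injective_of_mono _ h.sc.f ((h1 _).trans (h1 _).symm)

lemma EV.cmid (h1 : EV R k A X) (h2 : EV R k C X) : EV R k B X := by
  intro e
  obtain ⟨x, rfl⟩ := Abelian.Ext.contravariant_sequence_exact₂ h.se _ e (h1 _)
  rw [h2 x, Abelian.Ext.comp_zero]

lemma EV.cleft (h1 : EV R k B X) (h2 : EV R (k+1) C X) : EV R k A X := by
  intro e
  obtain ⟨x, rfl⟩ := Abelian.Ext.contravariant_sequence_exact₁ h.se _ e (add_comm 1 k) (h2 _)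
  rw [h1 x, Abelian.Ext.comp_zero]

lemma EV.cright (h1 : EV R (k+1) B X) (h2 : EV R k A X) : EV R (k+1) C X := by
  intro e
  obtain ⟨x, rfl⟩ := Abelian.Ext.contravariant_sequence_exact₃ h.se _ e (h1 _) (add_comm 1 k)
  rw [h2 x, Abelian.Ext.comp_zero]

lemma EV.cright0 (h1 : EV R 0 B X) : EV R 0 C X := by
  intro e
  have := h.se.epi_g
  exact Abelian.Ext.precomp_mk₀_injective_of_epi _ h.sc.g ((h1 _).trans (h1 _).symm)

end cov

lemma EV.zero_right {k : ℕ} [Subsingleton B] : EV R k A B := by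
  intro e
  have : (𝟙 (ModuleCat.of R B)) = 0 := by ext x; exact Subsingleton.elim _ _
  rw [← Abelian.Ext.comp_mk₀_id e, this, Abelian.Ext.mk₀_zero, Abelian.Ext.comp_zero]

lemma EV.zero_left {k : ℕ} [Subsingleton A] : EV R k A B := by
  intro e
  have : (𝟙 (ModuleCat.of R A)) = 0 := by ext x; exact Subsingleton.elim _ _
  rw [← Abelian.Ext.mk₀_id_comp e, this, Abelian.Ext.mk₀_zero, Abelian.Ext.zero_comp]

lemma EV.congr_right {k : ℕ} (e : A ≃ₗ[R] B) (h : EV R k T A) : EV R k T B :=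
  EV.mid (SES.iso e) h EV.zero_right

lemma EV.congr_left {k : ℕ} (e : A ≃ₗ[R] B) (h : EV R k A X) : EV R k B X :=
  EV.cmid (SES.iso e) h EV.zero_left

lemma ev_zero_iff : EV R 0 A B ↔ ∀ f : A →ₗ[R] B, f = 0 := by
  constructor
  · intro h f
    have := h (Abelian.Ext.mk₀ (ModuleCat.ofHom f))
    rw [Abelian.Ext.mk₀_eq_zero_iff] at this
    exact congrArg ModuleCat.Hom.hom this
  · intro h e
    obtain ⟨f, rfl⟩ := (Abelian.Ext.mk₀_bijective _ _).2 e
    rw [Abelian.Ext.mk₀_eq_zero_iff]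
    ext1
    exact h f.hom

lemma EV.of_injective {k : ℕ} [Module.Injective R B] : EV R (k+1) A B := by
  intro e
  have : Injective (ModuleCat.of R B) := Module.injective_object_of_injective_module R B
  exact Abelian.Ext.eq_zero_of_injective e

lemma EV.of_projective {k : ℕ} [Module.Projective R A] : EV R (k+1) A B := by
  intro e
  have : Projective (ModuleCat.of R A) := inferInstance
  exact Abelian.Ext.eq_zero_of_projective e

/-- scalar endomorphism -/
abbrev sc (A : Type) [AddCommGroup A] [Module R A] (x : R) : A →ₗ[R] A := LinearMap.lsmul R A x

lemma smul_right {k : ℕ} (e : EX R k A B) (x : R) :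
    x • e = e.comp (Abelian.Ext.mk₀ (ModuleCat.ofHom (sc B x))) (add_zero k) := by
  rw [Abelian.Ext.smul_eq_comp_mk₀]
  congr 1

lemma smul_left {k : ℕ} (e : EX R k A B) (x : R) :
    x • e = (Abelian.Ext.mk₀ (ModuleCat.ofHom (sc A x))).comp e (zero_add k) := by
  have : ModuleCat.ofHom (sc A x) = x • 𝟙 (ModuleCat.of R A) := rfl
  rw [this, Abelian.Ext.mk₀_smul, Abelian.Ext.smul_comp, Abelian.Ext.mk₀_id_comp]

/-- `x` kills `A` implies `x` kills Ext. -/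
lemma smul_zero_left {k : ℕ} (e : EX R k A B) (x : R) (hx : ∀ a : A, x • a = 0) : x • e = 0 := by
  rw [smul_left, show sc A x = 0 by ext a; exact hx a]
  simp

lemma smul_zero_right {k : ℕ} (e : EX R k A B) (x : R) (hx : ∀ a : B, x • a = 0) : x • e = 0 := by
  rw [smul_right, show sc B x = 0 by ext a; exact hx a]
  simp

lemma smul_inj_right {k : ℕ} (x : R) (hx : Function.Bijective (sc B x)) (e : EX R k A B)
    (h : x • e = 0) : e = 0 := by
  let ε := LinearEquiv.ofBijective _ hx
  have h2 : e.comp (Abelian.Ext.mk₀ (ModuleCat.ofHom (sc B x))) (add_zero k) = 0 := by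
    rw [← smul_right, h]
  have h3 := congrArg (fun t => Abelian.Ext.comp t
    (Abelian.Ext.mk₀ (ModuleCat.ofHom ε.symm.toLinearMap)) (add_zero k)) h2
  have h4 : ModuleCat.ofHom (sc B x) ≫ ModuleCat.ofHom ε.symm.toLinearMap = 𝟙 _ := by
    ext b
    exact ε.symm_apply_apply b
  simpa [h4] using h3

lemma smul_inj_left {k : ℕ} (x : R) (hx : Function.Bijective (sc A x)) (e : EX R k A B)
    (h : x • e = 0) : e = 0 := by
  let ε := LinearEquiv.ofBijective _ hx
  have h2 : (Abelian.Ext.mk₀ (ModuleCat.ofHom (sc A x))).comp e (zero_add k) = 0 := by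
    rw [← smul_left, h]
  have h3 := congrArg (fun t => (Abelian.Ext.mk₀ (ModuleCat.ofHom ε.symm.toLinearMap)).comp t
     (zero_add k)) h2
  have h4 : ModuleCat.ofHom ε.symm.toLinearMap ≫ ModuleCat.ofHom (sc A x) = 𝟙 _ := by
    ext b
    exact ε.apply_symm_apply b
  simp only [Abelian.Ext.comp_zero] at h3
  rwa [← Abelian.Ext.comp_assoc_of_second_deg_zero, Abelian.Ext.mk₀_comp_mk₀, h4,
    Abelian.Ext.mk₀_id_comp] at h3

lemma smul_pow_inj_right {k : ℕ} (x : R) (hx : Function.Bijective (sc B x)) (n : ℕ)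
    (e : EX R k A B) (h : x ^ n • e = 0) : e = 0 := by
  induction n with
  | zero => simpa using h
  | succ n ih =>
    apply ih
    apply smul_inj_right x hx
    rw [smul_smul, ← pow_succ', h]

lemma smul_pow_inj_left {k : ℕ} (x : R) (hx : Function.Bijective (sc A x)) (n : ℕ)
    (e : EX R k A B) (h : x ^ n • e = 0) : e = 0 := by
  induction n with
  | zero => simpa using h
  | succ n ih =>
    apply ih
    apply smul_inj_left x hx
    rw [smul_smul, ← pow_succ', h]

variable (I : Ideal R)

lemma quot_kill {n : ℕ} {y : R} (hy : y ∈ I ^ n) (a : R ⧸ I ^ n) : y • a = 0 := by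
  obtain ⟨a, rfl⟩ := Ideal.Quotient.mk_surjective a
  rw [Algebra.smul_def]
  change Ideal.Quotient.mk _ y * _ = 0
  rw [Ideal.Quotient.eq_zero_iff_mem.mpr hy, zero_mul]

/-- strongly acyclic modules -/
def SA (Y : Type) [AddCommGroup Y] [Module R Y] : Prop :=
  ∀ k n, EV R k (R ⧸ I ^ n) Y

variable {I}

lemma SA.of_bij {Y : Type} [AddCommGroup Y] [Module R Y] {x : R} (hxI : x ∈ I)
    (hx : Function.Bijective (sc Y x)) : SA I Y := by
  intro k n e
  apply smul_pow_inj_right x hx n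
  exact smul_zero_left _ _ (quot_kill I (Ideal.pow_mem_pow hxI n))

section
variable {f : A →ₗ[R] B} {g : B →ₗ[R] C} (h : SES f g)
include h
lemma SA.mid (h1 : SA I A) (h2 : SA I C) : SA I B := fun k n => EV.mid h (h1 k n) (h2 k n)
lemma SA.right (h1 : SA I A) (h2 : SA I B) : SA I C := fun k n => EV.right h (h2 k n) (h1 _ n)
lemma SA.left (h1 : SA I B) (h2 : SA I C) : SA I A := fun k n => by
  cases k with
  | zero => exact EV.left0 h (h1 _ n)
  | succ k => exact EV.left h (h1 _ n) (h2 _ n)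
end

variable (I) in
abbrev V (i : ℕ) (M : Type) [AddCommGroup M] [Module R M] : Prop := Van I i (ModuleCat.of R M)

lemma pull_pull {i : ℕ} {n m l : ℕ} (h1 : n ≤ m) (h2 : m ≤ l) (e : EX R i (R ⧸ I ^ n) A) :
    (Abelian.Ext.mk₀ (qmap I h2)).comp ((Abelian.Ext.mk₀ (qmap I h1)).comp e (zero_add i))
      (zero_add i) = (Abelian.Ext.mk₀ (qmap I (h1.trans h2))).comp e (zero_add i) := by
  rw [← Abelian.Ext.comp_assoc_of_second_deg_zero, Abelian.Ext.mk₀_comp_mk₀]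
  congr 2
  apply ModuleCat.hom_ext
  refine LinearMap.ext fun x => ?_
  obtain ⟨x, rfl⟩ := Submodule.Quotient.mk_surjective _ x
  rfl

lemma V.of_SA (h : SA I A) (i : ℕ) : V I i A := fun n e => ⟨n, le_rfl, by rw [h i n e]; simp⟩

section
variable {f : A →ₗ[R] B} {g : B →ₗ[R] C} (h : SES f g) {k : ℕ}
include h

lemma V.mid (h1 : V I k A) (h2 : V I k C) : V I k B := by
  intro n e
  obtain ⟨m, hm, he⟩ := h2 n (e.comp (Abelian.Ext.mk₀ h.sc.g) (add_zero k))
  rw [← Abelian.Ext.comp_assoc_of_third_deg_zero] at he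
  obtain ⟨x, hx⟩ := Abelian.Ext.covariant_sequence_exact₂ _ h.se _ he
  obtain ⟨l, hl, hx'⟩ := h1 m x
  refine ⟨l, hm.trans hl, ?_⟩
  rw [← pull_pull hm hl, ← hx, ← Abelian.Ext.comp_assoc_of_third_deg_zero, hx', Abelian.Ext.zero_comp]

lemma V.right (h1 : V I k B) (h2 : V I (k+1) A) : V I k C := by
  intro n e
  obtain ⟨m, hm, he⟩ := h2 n (e.comp h.se.extClass rfl)
  rw [← Abelian.Ext.comp_assoc _ _ _ (zero_add k) rfl (by omega)] at he
  obtain ⟨x, hx⟩ := Abelian.Ext.covariant_sequence_exact₃ _ h.se _ rfl he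
  obtain ⟨l, hl, hx'⟩ := h1 m x
  refine ⟨l, hm.trans hl, ?_⟩
  rw [← pull_pull hm hl, ← hx, ← Abelian.Ext.comp_assoc_of_third_deg_zero, hx', Abelian.Ext.zero_comp]

lemma V.left (h1 : V I (k+1) B) (h2 : V I k C) : V I (k+1) A := by
  intro n e
  obtain ⟨m, hm, he⟩ := h1 n (e.comp (Abelian.Ext.mk₀ h.sc.f) (add_zero _))
  rw [← Abelian.Ext.comp_assoc_of_third_deg_zero] at he
  obtain ⟨x, hx⟩ := Abelian.Ext.covariant_sequence_exact₁ _ h.se _ he rfl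
  obtain ⟨l, hl, hx'⟩ := h2 m x
  refine ⟨l, hm.trans hl, ?_⟩
  rw [← pull_pull hm hl, ← hx, ← Abelian.Ext.comp_assoc _ _ _ (zero_add k) rfl (by omega), hx',
    Abelian.Ext.zero_comp]

lemma V.left0 (h1 : V I 0 B) : V I 0 A := by
  intro n e
  obtain ⟨m, hm, he⟩ := h1 n (e.comp (Abelian.Ext.mk₀ h.sc.f) (add_zero _))
  refine ⟨m, hm, ?_⟩
  rw [← Abelian.Ext.comp_assoc_of_third_deg_zero] at he
  have := h.se.mono_f
  apply Abelian.Ext.postcomp_mk₀_injective_of_mono _ h.sc.f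
  refine Eq.trans he ?_
  simp

end

lemma V.zero {k : ℕ} [Subsingleton A] : V I k A := V.of_SA (fun _ _ => EV.zero_right) k

lemma V.congr {k : ℕ} (e : A ≃ₗ[R] B) : V I k A ↔ V I k B :=
  ⟨fun h => V.mid (SES.iso e) h V.zero, fun h => V.mid (SES.iso e.symm) h V.zero⟩

lemma V.of_injective {k : ℕ} [Module.Injective R B] : V I (k+1) B := by
  intro n e
  exact ⟨n, le_rfl, by rw [EV.of_injective e]; simp⟩

end Basics
end LC
end


noncomputable section
namespace LC
open Opposite Limits

section Tors
variable {R : Type} [CommRing R] (I : Ideal R)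
variable {A B C D T X : Type} [AddCommGroup A] [Module R A] [AddCommGroup B] [Module R B]
  [AddCommGroup C] [Module R C] [AddCommGroup D] [Module R D] [AddCommGroup T] [Module R T]
  [AddCommGroup X] [Module R X]

def Kill (n : ℕ) (a : A) : Prop := ∀ y ∈ I ^ n, y • a = 0

variable {I} in
lemma Kill.mono {n m : ℕ} (h : n ≤ m) {a : A} (ha : Kill I n a) : Kill I m a :=
  fun y hy => ha y (Ideal.pow_le_pow_right h hy)

variable (A) in
/-- torsion submodule -/
def Gam : Submodule R A where
  carrier := {a | ∃ n, Kill I n a}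
  add_mem' := by
    rintro a b ⟨n, hn⟩ ⟨m, hm⟩
    refine ⟨max n m, fun y hy => ?_⟩
    rw [smul_add, hn.mono (le_max_left n m) y hy, hm.mono (le_max_right n m) y hy, add_zero]
  zero_mem' := ⟨0, fun y _ => smul_zero y⟩
  smul_mem' := by
    rintro r a ⟨n, hn⟩
    exact ⟨n, fun y hy => by rw [smul_comm, hn y hy, smul_zero]⟩

lemma mem_gam {a : A} : a ∈ Gam I A ↔ ∃ n, Kill I n a := Iff.rfl

variable {I} in
def ofKill {n : ℕ} {a : A} (h : Kill I n a) : (R ⧸ I ^ n) →ₗ[R] A :=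
  Submodule.liftQ (I ^ n) (LinearMap.toSpanSingleton R A a) (fun y hy => h y hy)

variable {I} in
@[simp] lemma ofKill_mk {n : ℕ} {a : A} (h : Kill I n a) (r : R) :
    ofKill h (Submodule.Quotient.mk r) = r • a := rfl

lemma kill_one {n : ℕ} (f : (R ⧸ I ^ n) →ₗ[R] A) :
    Kill I n (f (Submodule.Quotient.mk 1)) := by
  intro y hy
  rw [← map_smul, quot_kill I hy, map_zero]

lemma quot_hom_ext {n : ℕ} {f g : (R ⧸ I ^ n) →ₗ[R] A}
    (h : f (Submodule.Quotient.mk 1) = g (Submodule.Quotient.mk 1)) : f = g := by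
  apply LinearMap.ext
  intro x
  obtain ⟨x, rfl⟩ := Submodule.Quotient.mk_surjective _ x
  have : (Submodule.Quotient.mk x : R ⧸ I ^ n) = x • Submodule.Quotient.mk 1 := by
    rw [← Submodule.Quotient.mk_smul, smul_eq_mul, mul_one]
  rw [this, map_smul, map_smul, h]

lemma van_zero_iff : V I 0 A ↔ ∀ a ∈ Gam I A, a = 0 := by
  constructor
  · rintro h a ⟨n, hn⟩
    obtain ⟨m, hm, he⟩ := h n (Abelian.Ext.mk₀ (ModuleCat.ofHom (ofKill hn)))
    rw [Abelian.Ext.mk₀_comp_mk₀, Abelian.Ext.mk₀_eq_zero_iff] at he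
    have := ConcreteCategory.congr_hom he (Submodule.Quotient.mk 1)
    have h2 : (1 : R) • a = 0 := this
    rwa [one_smul] at h2
  · intro h n e
    refine ⟨n, le_rfl, ?_⟩
    obtain ⟨f, rfl⟩ := (Abelian.Ext.mk₀_bijective _ _).2 e
    have : f = 0 := by
      apply ModuleCat.hom_ext
      apply quot_hom_ext
      rw [h _ ⟨n, kill_one I f.hom⟩]; rfl
    rw [this]; simp

section
variable {f : A →ₗ[R] B} {g : B →ₗ[R] C} (h : SES f g)
include h

lemma van_one_of (hs : ∀ c ∈ Gam I C, ∃ b ∈ Gam I B, g b = c)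
    (hB : ∀ n, EV R 1 (R ⧸ I ^ n) B) : V I 1 A := by
  intro n e
  obtain ⟨x, rfl⟩ := Abelian.Ext.covariant_sequence_exact₁ _ h.se e (hB n _) (zero_add 1)
  obtain ⟨φ, rfl⟩ := (Abelian.Ext.mk₀_bijective _ _).2 x
  obtain ⟨b, ⟨m, hm⟩, hb⟩ := hs _ ⟨n, kill_one I φ.hom⟩
  have hm' := hm.mono (le_max_right n m)
  refine ⟨max n m, le_max_left n m, ?_⟩
  have : qmap I (le_max_left n m) ≫ φ = ModuleCat.ofHom (ofKill hm') ≫ h.sc.g := by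
    apply ModuleCat.hom_ext
    apply quot_hom_ext
    refine Eq.trans hb.symm ?_
    change g b = g ((1 : R) • b)
    rw [one_smul]
  rw [← Abelian.Ext.comp_assoc _ _ _ (zero_add 0) (zero_add 1) (by omega),
    Abelian.Ext.mk₀_comp_mk₀, this, ← Abelian.Ext.mk₀_comp_mk₀,
    Abelian.Ext.comp_assoc _ _ _ (zero_add 0) (zero_add 1) (by omega),
    ShortComplex.ShortExact.comp_extClass, Abelian.Ext.comp_zero]

lemma surj_of_van_one (hv : V I 1 A) : ∀ c ∈ Gam I C, ∃ b ∈ Gam I B, g b = c := by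
  rintro c ⟨n, hn⟩
  obtain ⟨m, hm, he⟩ := hv n ((Abelian.Ext.mk₀ (ModuleCat.ofHom (ofKill hn))).comp h.se.extClass
    (zero_add 1))
  rw [← Abelian.Ext.comp_assoc _ _ _ (zero_add 0) (zero_add 1) (by omega),
    Abelian.Ext.mk₀_comp_mk₀] at he
  obtain ⟨x, hx⟩ := Abelian.Ext.covariant_sequence_exact₃ _ h.se _ _ he
  obtain ⟨ψ, rfl⟩ := (Abelian.Ext.mk₀_bijective _ _).2 x
  rw [Abelian.Ext.mk₀_comp_mk₀] at hx
  have h2 := (Abelian.Ext.mk₀_bijective _ _).1 hx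
  have h3 := ConcreteCategory.congr_hom h2 (Submodule.Quotient.mk 1)
  refine ⟨ψ.hom (Submodule.Quotient.mk 1), ⟨m, kill_one I ψ.hom⟩, h3.trans ?_⟩
  change (1 : R) • c = c
  rw [one_smul]

lemma van_shift [Module.Injective R B] (i : ℕ) : V I (i+2) A ↔ V I (i+1) C :=
  ⟨fun h1 => V.right h V.of_injective h1, fun h1 => V.left h V.of_injective h1⟩

end

variable (R) in
lemma exists_inj (M : Type) [AddCommGroup M] [Module R M] :
    ∃ (E : Type) (_ : AddCommGroup E) (_ : Module R E) (f : M →ₗ[R] E),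
      Module.Injective R E ∧ Function.Injective f := by
  obtain ⟨⟨J⟩⟩ := EnoughInjectives.presentation (ModuleCat.of R M)
  rename_i inj f mono
  refine ⟨J, inferInstance, inferInstance, f.hom, ?_, ?_⟩
  · exact Module.injective_module_of_injective_object R J
  · exact (ModuleCat.mono_iff_injective f).mp mono

end Tors

section F0
variable {R S : Type} [CommRing R] [CommRing S] [Algebra R S] (I : Ideal R)

lemma kill_map {Y : Type} [AddCommGroup Y] [Module S Y] [Module R Y] [IsScalarTower R S Y]
    (n : ℕ) (y : Y) : Kill (I.map (algebraMap R S)) n y ↔ Kill I n y := by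
  unfold Kill
  rw [← Ideal.map_pow]
  constructor
  · intro h r hr
    rw [← algebraMap_smul S r y]
    exact h _ (Ideal.mem_map_of_mem _ hr)
  · intro h r hr
    induction hr using Submodule.span_induction with
    | mem x hx =>
      obtain ⟨r, hr, rfl⟩ := hx
      rw [algebraMap_smul]
      exact h r hr
    | zero => simp
    | add x y _ _ h1 h2 => rw [add_smul, h1, h2, add_zero]
    | smul a x _ h1 => rw [smul_eq_mul, mul_smul, h1, smul_zero]

lemma gam_map {Y : Type} [AddCommGroup Y] [Module S Y] [Module R Y] [IsScalarTower R S Y]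
    (y : Y) : y ∈ Gam (I.map (algebraMap R S)) Y ↔ y ∈ Gam I Y := by
  simp only [mem_gam, kill_map]

lemma inj_restrict [Module.Flat R S] {E : Type} [AddCommGroup E] [Module S E] [Module R E]
    [IsScalarTower R S E] [Module.Injective S E] : Module.Injective R E where
  out := by
    intro X Y _ _ _ _ f hf g
    obtain ⟨h, hh⟩ := Module.Injective.out (R := S) (f.baseChange S)
      (Module.Flat.lTensor_preserves_injective_linearMap (M := S) f hf)
      (LinearMap.liftBaseChange S g)
    refine ⟨(h.restrictScalars R) ∘ₗ (TensorProduct.mk R S Y 1), fun x => ?_⟩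
    have := hh (1 ⊗ₜ x)
    simpa using this

theorem van_map [Module.Flat R S] (i : ℕ) : ∀ (Y : Type) [AddCommGroup Y] [Module S Y] [Module R Y]
    [IsScalarTower R S Y], V (I.map (algebraMap R S)) i Y ↔ V I i Y := by
  induction i with
  | zero =>
    intro Y _ _ _ _
    simp only [van_zero_iff, gam_map]
  | succ i ih =>
    intro Y _ _ _ _
    obtain ⟨E, _, _, f, hE, hf⟩ := exists_inj S Y
    let _ : Module R E := Module.compHom E (algebraMap R S)
    have _ : IsScalarTower R S E := ⟨fun r s e => by
      rw [Algebra.smul_def, mul_smul]; rfl⟩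
    have _ : Module.Injective R E := inj_restrict (S := S)
    have hS := SES.coker hf
    have hR : SES (f.restrictScalars R) ((LinearMap.range f).mkQ.restrictScalars R) :=
      ⟨hS.inj, hS.ex, hS.surj⟩
    cases i with
    | zero =>
      constructor
      · intro h
        refine van_one_of I hR (fun c hc => ?_) (fun n => EV.of_injective)
        rw [← gam_map (S := S)] at hc
        obtain ⟨b, hb, h2⟩ := surj_of_van_one _ hS h c hc
        exact ⟨b, (gam_map I b).mp hb, h2⟩
      · intro h
        refine van_one_of _ hS (fun c hc => ?_) (fun n => EV.of_injective)
        rw [gam_map (S := S)] at hc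
        obtain ⟨b, hb, h2⟩ := surj_of_van_one _ hR h c hc
        exact ⟨b, (gam_map I b).mpr hb, h2⟩
    | succ i =>
      rw [van_shift _ hS, van_shift _ hR]
      exact ih _
end F0
end LC
end


noncomputable section
namespace LC
open Opposite Limits

section Tors2
variable {R : Type} [CommRing R] [IsNoetherianRing R] (I : Ideal R)
variable {A B C D T X : Type} [AddCommGroup A] [Module R A] [AddCommGroup B] [Module R B]
  [AddCommGroup C] [Module R C] [AddCommGroup D] [Module R D] [AddCommGroup T] [Module R T]
  [AddCommGroup X] [Module R X]

lemma exists_kill_fg (J : Ideal R) (φ : J →ₗ[R] Gam I A) : ∃ n, ∀ x, Kill I n (φ x : A) := by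
  have hfg : (⊤ : Submodule R J).FG := Module.Finite.fg_top
  obtain ⟨s, hs⟩ := hfg
  choose n hn using fun x : J => (φ x).2
  refine ⟨s.sup n, fun x => ?_⟩
  have hx : x ∈ Submodule.span R (s : Set J) := hs ▸ Submodule.mem_top
  induction hx using Submodule.span_induction with
  | mem x hx => exact (hn x).mono (Finset.le_sup hx)
  | zero => intro y _; simp
  | add x y _ _ h1 h2 =>
    intro r hr
    rw [map_add, Submodule.coe_add, smul_add, h1 r hr, h2 r hr, add_zero]
  | smul a x _ h1 =>
    intro r hr
    rw [map_smul, Submodule.coe_smul, smul_comm, h1 r hr, smul_zero]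

instance gam_injective [Module.Injective R A] : Module.Injective R (Gam I A) := by
  apply Module.Baer.injective
  intro J φ
  obtain ⟨n, hn⟩ := exists_kill_fg I J φ
  obtain ⟨k, hk⟩ := Ideal.exists_pow_inf_eq_pow_smul I (J : Submodule R R)
  have hle : I ^ (k + n) ⊓ J ≤ I ^ n * J := by
    have := hk (k + n) (Nat.le_add_right _ _)
    rw [smul_eq_mul, Ideal.mul_top, Nat.add_sub_cancel_left] at this
    rw [this]
    exact Submodule.smul_mono le_rfl inf_le_right
  have hker : ∀ x : J, (x : R) ∈ I ^ n * J → φ x = 0 := by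
    rintro ⟨x, hx⟩ hx2
    have : ∀ z ∈ I ^ n * J, ∃ h : z ∈ J, φ ⟨z, h⟩ = 0 := by
      intro z hz
      refine Submodule.smul_induction_on (p := fun z => ∃ h : z ∈ J, φ ⟨z, h⟩ = 0) hz ?_ ?_
      · intro r hr y hy
        refine ⟨J.mul_mem_left r hy, ?_⟩
        have h2 : (⟨r • y, J.mul_mem_left r hy⟩ : J) = r • ⟨y, hy⟩ := rfl
        rw [h2, map_smul]
        apply Subtype.ext
        exact hn _ r hr
      · rintro y z ⟨hy, hy'⟩ ⟨hz, hz'⟩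
        refine ⟨J.add_mem hy hz, ?_⟩
        have h2 : (⟨y + z, J.add_mem hy hz⟩ : J) = ⟨y, hy⟩ + ⟨z, hz⟩ := rfl
        rw [h2, map_add, hy', hz', add_zero]
    exact (this x hx2).2
  let N : Submodule R J := Submodule.comap J.subtype (I ^ (k + n))
  let j : (J ⧸ N) →ₗ[R] (R ⧸ I ^ (k + n)) := Submodule.mapQ N (I ^ (k + n)) J.subtype le_rfl
  have hj : Function.Injective j := by
    rw [← LinearMap.ker_eq_bot]
    rw [eq_bot_iff]
    intro z hz
    obtain ⟨z, rfl⟩ := Submodule.Quotient.mk_surjective _ z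
    have hz2 : (Submodule.Quotient.mk (z : R) : R ⧸ I ^ (k + n)) = 0 := hz
    rw [Submodule.Quotient.mk_eq_zero] at hz2
    rw [Submodule.mem_bot, Submodule.Quotient.mk_eq_zero]
    exact hz2
  let φ' : (J ⧸ N) →ₗ[R] A := Submodule.liftQ N ((Gam I A).subtype ∘ₗ φ) (by
    intro x hx
    have := hker x (hle ⟨hx, x.2⟩)
    simp [this])
  obtain ⟨h, hh⟩ := Module.Injective.out j hj φ'
  let e : A := h (Submodule.Quotient.mk 1)
  have he : e ∈ Gam I A := ⟨_, kill_one I h⟩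
  refine ⟨LinearMap.toSpanSingleton R _ ⟨e, he⟩, fun x hx => ?_⟩
  apply Subtype.ext
  have := hh (Submodule.Quotient.mk ⟨x, hx⟩)
  change x • e = _
  have h3 : j (Submodule.Quotient.mk ⟨x, hx⟩) = x • Submodule.Quotient.mk 1 := by
    rw [← Submodule.Quotient.mk_smul, smul_eq_mul, mul_one]; rfl
  rw [h3, map_smul] at this
  exact this

/-- torsion modules -/
def IsTor (T : Type) [AddCommGroup T] [Module R T] : Prop := ∀ t : T, t ∈ Gam I T

variable {I}
omit [IsNoetherianRing R] in
lemma gam_map_mem (f : A →ₗ[R] B) {a : A} (ha : a ∈ Gam I A) : f a ∈ Gam I B := by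
  obtain ⟨n, hn⟩ := ha
  exact ⟨n, fun y hy => by rw [← map_smul, hn y hy, map_zero]⟩

omit [IsNoetherianRing R] in
lemma gam_of_inj (f : A →ₗ[R] B) (hf : Function.Injective f) {a : A} (ha : f a ∈ Gam I B) :
    a ∈ Gam I A := by
  obtain ⟨n, hn⟩ := ha
  exact ⟨n, fun y hy => hf (by rw [map_smul, hn y hy, map_zero])⟩

omit [IsNoetherianRing R] in
lemma IsTor.surj (h : IsTor I A) (f : A →ₗ[R] B) (hf : Function.Surjective f) : IsTor I B := by
  intro b
  obtain ⟨a, rfl⟩ := hf b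
  exact gam_map_mem f (h a)

omit [IsNoetherianRing R] in
lemma isTor_gam : IsTor I (Gam I A) := fun t => gam_of_inj (Gam I A).subtype
  (Submodule.subtype_injective _) t.2

theorem IsTor.van (k : ℕ) : ∀ (T : Type) [AddCommGroup T] [Module R T], IsTor I T →
    V I (k+1) T := by
  induction k with
  | zero =>
    intro T _ _ hT
    obtain ⟨E, _, _, f, hE, hf⟩ := exists_inj R T
    exact van_one_of I (SES.coker (f := f.codRestrict (Gam I E) (fun t => gam_map_mem f (hT t)))
      (fun x y h => hf (congrArg Subtype.val h)))
      (fun c _ => by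
        obtain ⟨b, rfl⟩ := Submodule.mkQ_surjective _ c
        exact ⟨b, isTor_gam b, rfl⟩) (fun n => EV.of_injective)
  | succ k ih =>
    intro T _ _ hT
    obtain ⟨E, _, _, f, hE, hf⟩ := exists_inj R T
    rw [van_shift I (SES.coker (f := f.codRestrict (Gam I E) (fun t => gam_map_mem f (hT t)))
      (fun x y h => hf (congrArg Subtype.val h)))]
    exact ih _ (isTor_gam.surj _ (Submodule.mkQ_surjective _))

/-- embeddings into injectives without torsion. -/
lemma exists_inj_notor (X : Type) [AddCommGroup X] [Module R X] (hX : V I 0 X) :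
    ∃ (E : Type) (_ : AddCommGroup E) (_ : Module R E) (f : X →ₗ[R] E),
      Module.Injective R E ∧ Function.Injective f ∧ V I 0 E := by
  obtain ⟨E, _, _, f, hE, hf⟩ := exists_inj R X
  obtain ⟨r, hr⟩ := Module.Injective.out (Gam I E).subtype (Submodule.subtype_injective _)
    (LinearMap.id : Gam I E →ₗ[R] Gam I E)
  rw [van_zero_iff] at hX
  refine ⟨E ⧸ Gam I E, inferInstance, inferInstance, (Gam I E).mkQ ∘ₗ f, ?_, ?_, ?_⟩
  · let s : (E ⧸ Gam I E) →ₗ[R] E := Submodule.liftQ _ (LinearMap.id - (Gam I E).subtype ∘ₗ r) (by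
      intro x hx
      have := hr ⟨x, hx⟩
      simp only [Submodule.subtype_apply, LinearMap.id_apply] at this
      simp [this])
    have hs : ∀ x, (Gam I E).mkQ (s x) = x := by
      intro x
      obtain ⟨x, rfl⟩ := Submodule.mkQ_surjective _ x
      change (Gam I E).mkQ (x - (r x : E)) = _
      rw [map_sub, sub_eq_self]
      simp
    constructor
    intro A B _ _ _ _ u hu g
    obtain ⟨h, hh⟩ := Module.Injective.out u hu (s ∘ₗ g)
    refine ⟨(Gam I E).mkQ ∘ₗ h, fun x => ?_⟩
    simp only [LinearMap.comp_apply, hh, hs]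
  · rw [injective_iff_map_eq_zero]
    intro x hx
    apply hX
    apply gam_of_inj f hf
    simpa using hx
  · rw [van_zero_iff]
    intro c hc
    obtain ⟨b, hb, rfl⟩ := surj_of_van_one I (SES.quot (Gam I E)) (IsTor.van 0 _ isTor_gam) c hc
    simpa using hb

omit [IsNoetherianRing R] in
lemma EV.zero_of_tor (hT : IsTor I T) (hX : V I 0 X) : EV R 0 T X := by
  rw [ev_zero_iff]
  intro f
  ext t
  rw [van_zero_iff] at hX
  exact hX _ (gam_map_mem f (hT t))

theorem IsTor.ev (hT : IsTor I T) (j : ℕ) : ∀ (X : Type) [AddCommGroup X] [Module R X],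
    (∀ i < j, V I i X) → ∀ k < j, EV R k T X := by
  induction j with
  | zero => intro X _ _ _ k hk; omega
  | succ j ih =>
    intro X _ _ hX k hk
    cases k with
    | zero => exact EV.zero_of_tor hT (hX 0 (by omega))
    | succ k =>
      obtain ⟨E, _, _, f, hE, hf, hE0⟩ := exists_inj_notor X (hX 0 (by omega))
      refine EV.left (SES.coker hf) EV.of_injective (ih _ (fun i hi => ?_) k (by omega))
      refine V.right (SES.coker hf) ?_ (hX (i+1) (by omega))
      cases i with
      | zero => exact hE0
      | succ i => exact V.of_injective

end Tors2

section Compl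
variable {R : Type} [CommRing R]

lemma ev_one_of {K F Y X : Type} [AddCommGroup K] [Module R K] [AddCommGroup F] [Module R F]
    [AddCommGroup Y] [Module R Y] [AddCommGroup X] [Module R X]
    {f : K →ₗ[R] F} {g : F →ₗ[R] Y} (h : SES f g) [Module.Projective R F]
    (H : ∀ φ : K →ₗ[R] X, ∃ ψ : F →ₗ[R] X, ψ ∘ₗ f = φ) : EV R 1 Y X := by
  intro e
  obtain ⟨x, rfl⟩ := Abelian.Ext.contravariant_sequence_exact₃ h.se _ e (EV.of_projective _)
    (add_zero 1)
  obtain ⟨φ, rfl⟩ := (Abelian.Ext.mk₀_bijective _ _).2 x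
  obtain ⟨ψ, hψ⟩ := H φ.hom
  have : φ = h.sc.f ≫ ModuleCat.ofHom ψ := by
    apply ModuleCat.hom_ext
    exact hψ.symm
  rw [this, ← Abelian.Ext.mk₀_comp_mk₀, ← Abelian.Ext.comp_assoc _ _ _ (add_zero 1) (add_zero 0) (by omega),
    ShortComplex.ShortExact.extClass_comp, Abelian.Ext.zero_comp]

lemma of_ev_one {K F Y X : Type} [AddCommGroup K] [Module R K] [AddCommGroup F] [Module R F]
    [AddCommGroup Y] [Module R Y] [AddCommGroup X] [Module R X]
    {f : K →ₗ[R] F} {g : F →ₗ[R] Y} (h : SES f g)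
    (H : EV R 1 Y X) (φ : K →ₗ[R] X) : ∃ ψ : F →ₗ[R] X, ψ ∘ₗ f = φ := by
  obtain ⟨x, hx⟩ := Abelian.Ext.contravariant_sequence_exact₁ h.se _
    (Abelian.Ext.mk₀ (ModuleCat.ofHom φ)) (add_zero 1) (H _)
  obtain ⟨ψ, rfl⟩ := (Abelian.Ext.mk₀_bijective _ _).2 x
  rw [Abelian.Ext.mk₀_comp_mk₀] at hx
  have h2 := (Abelian.Ext.mk₀_bijective _ _).1 hx
  exact ⟨ψ.hom, congrArg ModuleCat.Hom.hom h2⟩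

theorem ev_pi {X : ℕ → Type} [∀ n, AddCommGroup (X n)] [∀ n, Module R (X n)] (k : ℕ) :
    ∀ (Y : Type) [AddCommGroup Y] [Module R Y], (∀ n, EV R k Y (X n)) → EV R k Y (∀ n, X n) := by
  induction k with
  | zero =>
    intro Y _ _ h
    rw [ev_zero_iff]
    intro f
    ext y n
    exact LinearMap.congr_fun (ev_zero_iff.mp (h n) (LinearMap.proj n ∘ₗ f)) y
  | succ k ih =>
    intro Y _ _ h
    let g : (Y →₀ R) →ₗ[R] Y := Finsupp.linearCombination R id
    have hg : Function.Surjective g := Finsupp.linearCombination_id_surjective R Y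
    have hs := SES.ker hg
    cases k with
    | zero =>
      refine ev_one_of hs (fun φ => ?_)
      choose ψ hψ using fun n => of_ev_one hs (h n) (LinearMap.proj n ∘ₗ φ)
      refine ⟨LinearMap.pi ψ, ?_⟩
      ext x n
      exact LinearMap.congr_fun (hψ n) x
    | succ k =>
      exact EV.cright hs EV.of_projective (ih _ (fun n => EV.cleft hs EV.of_projective (h n)))

variable (I : Ideal R) (M : Type) [AddCommGroup M] [Module R M]

def diffMap : (∀ n : ℕ, M ⧸ (I ^ n • ⊤ : Submodule R M)) →ₗ[R]
    (∀ n : ℕ, M ⧸ (I ^ n • ⊤ : Submodule R M)) :=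
  LinearMap.pi fun n => LinearMap.proj n -
    (AdicCompletion.transitionMap I M (Nat.le_succ n)) ∘ₗ
      (LinearMap.proj (φ := fun n : ℕ => M ⧸ (I ^ n • ⊤ : Submodule R M)) (n+1))

lemma trans_surj (n : ℕ) :
    Function.Surjective (AdicCompletion.transitionMap I M (Nat.le_succ n)) := by
  intro x
  obtain ⟨m, rfl⟩ := Submodule.mkQ_surjective _ x
  exact ⟨Submodule.Quotient.mk m, rfl⟩

lemma compl_ses : SES (AdicCompletion.incl I M) (diffMap I M) where
  inj := fun x y h => Subtype.ext h
  ex := by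
    intro x
    constructor
    · intro h
      have h1 : ∀ n, AdicCompletion.transitionMap I M (Nat.le_succ n) (x (n+1)) = x n := by
        intro n
        have := congrFun h n
        exact (sub_eq_zero.mp this).symm
      refine ⟨⟨x, ?_⟩, rfl⟩
      intro m n hmn
      induction n, hmn using Nat.le_induction with
      | base => simp
      | succ n hmn ih =>
        rw [← ih, ← h1 n]
        simp
    · rintro ⟨y, rfl⟩
      ext n
      change y.val n - AdicCompletion.transitionMap I M (Nat.le_succ n) (y.val (n+1)) = 0
      rw [y.2 (Nat.le_succ n), sub_self]
  surj := by
    intro c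
    choose s hs using trans_surj I M
    let m : ∀ n, M ⧸ (I ^ n • ⊤ : Submodule R M) := fun n => Nat.rec 0 (fun n x => s n (x - c n)) n
    refine ⟨m, ?_⟩
    ext n
    change m n - AdicCompletion.transitionMap I M (Nat.le_succ n) (s n (m n - c n)) = c n
    rw [hs, sub_sub_cancel]

theorem ev_compl {Y : Type} [AddCommGroup Y] [Module R Y] {x : R} (hxI : x ∈ I)
    (hx : Function.Bijective (sc Y x)) (k : ℕ) : EV R k Y (AdicCompletion I M) := by
  have h : ∀ k, EV R k Y (∀ n : ℕ, M ⧸ (I ^ n • ⊤ : Submodule R M)) := by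
    intro k
    refine ev_pi k Y (fun n e => ?_)
    apply smul_pow_inj_left x hx n
    apply smul_zero_right
    intro a
    obtain ⟨a, rfl⟩ := Submodule.Quotient.mk_surjective _ a
    rw [← Submodule.Quotient.mk_smul, Submodule.Quotient.mk_eq_zero]
    exact Submodule.smul_mem_smul (Ideal.pow_mem_pow hxI n) trivial
  cases k with
  | zero => exact EV.left0 (compl_ses I M) (h 0)
  | succ k => exact EV.left (compl_ses I M) (h _) (h _)

end Compl
end LC
end


noncomputable section
namespace LC
open Opposite Limits

section Cech
variable {R : Type} [CommRing R]

variable (R) in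
/-- cochain complexes of modules -/
structure Cx where
  L : ℕ → ModuleCat.{0} R
  d : ∀ i, L i →ₗ[R] L (i+1)
  dd : ∀ i x, d (i+1) (d i x) = 0

def Cx.Bd (K : Cx R) : ∀ i, Submodule R (K.L i)
  | 0 => ⊥
  | i+1 => LinearMap.range (K.d i)

abbrev Loc (x : R) (N : Type) [AddCommGroup N] [Module R N] : Type :=
  LocalizedModule (Submonoid.powers x) N

abbrev toLoc (x : R) (N : Type) [AddCommGroup N] [Module R N] : N →ₗ[R] Loc x N :=
  LocalizedModule.mkLinearMap (Submonoid.powers x) N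

abbrev mapLoc (x : R) {N N' : Type} [AddCommGroup N] [Module R N] [AddCommGroup N'] [Module R N']
    (f : N →ₗ[R] N') : Loc x N →ₗ[R] Loc x N' :=
  IsLocalizedModule.map (Submonoid.powers x) (toLoc x N) (toLoc x N') f

lemma mapLoc_toLoc (x : R) {N N' : Type} [AddCommGroup N] [Module R N] [AddCommGroup N']
    [Module R N'] (f : N →ₗ[R] N') (u : N) : mapLoc x f (toLoc x N u) = toLoc x N' (f u) :=
  IsLocalizedModule.map_apply _ _ _ _ _

lemma loc_bij (x : R) (N : Type) [AddCommGroup N] [Module R N] (a : ℕ) :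
    Function.Bijective (sc (Loc x N) (x ^ a)) := by
  have := IsLocalizedModule.map_units (S := Submonoid.powers x) (toLoc x N) ⟨x ^ a, a, rfl⟩
  rw [Module.End.isUnit_iff] at this
  exact this

lemma loc_surj (x : R) (N : Type) [AddCommGroup N] [Module R N] (w : Loc x N) :
    ∃ (a : ℕ) (u : N), x ^ a • w = toLoc x N u := by
  obtain ⟨⟨u, s, a, rfl⟩, h⟩ := IsLocalizedModule.surj (Submonoid.powers x) (toLoc x N) w
  exact ⟨a, u, h⟩

lemma loc_eq (x : R) (N : Type) [AddCommGroup N] [Module R N] {u v : N}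
    (h : toLoc x N u = toLoc x N v) : ∃ b : ℕ, x ^ b • u = x ^ b • v := by
  obtain ⟨⟨s, b, rfl⟩, h⟩ := IsLocalizedModule.exists_of_eq (S := Submonoid.powers x) h
  exact ⟨b, h⟩

lemma loc_inj (x : R) (N : Type) [AddCommGroup N] [Module R N] (a : ℕ) {u v : Loc x N}
    (h : x ^ a • u = x ^ a • v) : u = v := (loc_bij x N a).1 h

lemma mapLoc_zero (x : R) {N N' N'' : Type} [AddCommGroup N] [Module R N] [AddCommGroup N']
    [Module R N'] [AddCommGroup N''] [Module R N''] (f : N →ₗ[R] N') (g : N' →ₗ[R] N'')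
    (h : ∀ u, g (f u) = 0) (w : Loc x N) : mapLoc x g (mapLoc x f w) = 0 := by
  obtain ⟨a, u, hu⟩ := loc_surj x N w
  apply loc_inj x _ a
  rw [← map_smul, ← map_smul, hu, mapLoc_toLoc, mapLoc_toLoc, h, map_zero, smul_zero]

def coneL (x : R) (L : ℕ → ModuleCat.{0} R) : ℕ → ModuleCat.{0} R
  | 0 => L 0
  | i+1 => ModuleCat.of R (L (i+1) × Loc x (L i))

def coneD (x : R) (K : Cx R) : ∀ i, coneL x K.L i →ₗ[R] coneL x K.L (i+1)
  | 0 => LinearMap.prod (K.d 0) (toLoc x (K.L 0))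
  | i+1 => LinearMap.prod (K.d (i+1) ∘ₗ LinearMap.fst R (K.L (i+1)) (Loc x (K.L i)))
      (toLoc x (K.L (i+1)) ∘ₗ LinearMap.fst R (K.L (i+1)) (Loc x (K.L i)) -
        mapLoc x (K.d i) ∘ₗ LinearMap.snd R (K.L (i+1)) (Loc x (K.L i)))

lemma coneD_succ (x : R) (K : Cx R) (i : ℕ) (z : K.L (i+1)) (w : Loc x (K.L i)) :
    coneD x K (i+1) (z, w) = (K.d (i+1) z, toLoc x (K.L (i+1)) z - mapLoc x (K.d i) w) := rfl

lemma coneD_zero (x : R) (K : Cx R) (z : K.L 0) :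
    coneD x K 0 z = (K.d 0 z, toLoc x (K.L 0) z) := rfl

def cone (x : R) (K : Cx R) : Cx R where
  L := coneL x K.L
  d := coneD x K
  dd := by
    intro i z
    cases i with
    | zero =>
      let z0 : K.L 0 := z
      change coneD x K 1 (K.d 0 z0, toLoc x (K.L 0) z0) = 0
      rw [coneD_succ, K.dd, mapLoc_toLoc, sub_self]
      rfl
    | succ i =>
      obtain ⟨z, w⟩ := z
      rw [coneD_succ, coneD_succ, K.dd, map_sub, mapLoc_toLoc,
        mapLoc_zero _ _ _ (K.dd i), sub_zero, sub_self]
      rfl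

def Tors (K : Cx R) (y : R) : Prop :=
  ∀ i (z : K.L i), K.d i z = 0 → ∃ a : ℕ, y ^ a • z ∈ K.Bd i

/-- `d(v,0)` is a boundary. -/
lemma bd_left (x : R) (K : Cx R) (i : ℕ) (v : K.L i) :
    ((K.d i v, toLoc x (K.L i) v) : K.L (i+1) × Loc x (K.L i)) ∈ (cone x K).Bd (i+1) := by
  cases i with
  | zero => exact ⟨v, rfl⟩
  | succ i =>
    refine ⟨(v, 0), ?_⟩
    change coneD x K (i+1) (v, 0) = _
    rw [coneD_succ, map_zero, sub_zero]

lemma tors_cone_self (x : R) (K : Cx R) : Tors (cone x K) x := by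
  intro i z hz
  cases i with
  | zero =>
    have h : toLoc x (K.L 0) z = toLoc x (K.L 0) 0 := by
      rw [map_zero]; exact congrArg Prod.snd hz
    obtain ⟨b, hb⟩ := loc_eq x _ h
    refine ⟨b, ?_⟩
    rw [smul_zero] at hb
    exact hb
  | succ i =>
    obtain ⟨z, w⟩ := z
    change coneD x K (i+1) (z, w) = 0 at hz
    rw [coneD_succ] at hz
    have h2 : toLoc x (K.L (i+1)) z = mapLoc x (K.d i) w := sub_eq_zero.mp (congrArg Prod.snd hz)
    obtain ⟨a, u, hu⟩ := loc_surj x _ w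
    have h3 : toLoc x (K.L (i+1)) (x ^ a • z) = toLoc x (K.L (i+1)) (K.d i u) := by
      rw [map_smul, h2, ← map_smul, hu, mapLoc_toLoc]
    obtain ⟨b, hb⟩ := loc_eq x _ h3
    refine ⟨b + a, ?_⟩
    have : x ^ (b + a) • ((z, w) : K.L (i+1) × Loc x (K.L i)) =
        (K.d i (x ^ b • u), toLoc x (K.L i) (x ^ b • u)) := by
      rw [map_smul, map_smul, ← hb, ← hu, smul_smul, smul_smul, ← pow_add]; rfl
    exact Set.mem_of_eq_of_mem (s := ((cone x K).Bd (i+1) : Set ((cone x K).L (i+1)))) this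
      (bd_left x K i _)

lemma tors_cone (x y : R) (K : Cx R) (hK : Tors K y) : Tors (cone x K) y := by
  intro i z hz
  cases i with
  | zero =>
    have h : K.d 0 z = 0 := congrArg Prod.fst hz
    exact hK 0 z h
  | succ i =>
    obtain ⟨z, w⟩ := z
    change coneD x K (i+1) (z, w) = 0 at hz
    rw [coneD_succ] at hz
    have h1 : K.d (i+1) z = 0 := congrArg Prod.fst hz
    have h2 : toLoc x (K.L (i+1)) z = mapLoc x (K.d i) w := sub_eq_zero.mp (congrArg Prod.snd hz)
    obtain ⟨n, v, hv⟩ := hK (i+1) z h1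
    let w' : Loc x (K.L i) := y ^ n • w - toLoc x (K.L i) v
    have hw' : mapLoc x (K.d i) w' = 0 := by
      rw [map_sub, map_smul, ← h2, mapLoc_toLoc, hv, map_smul, sub_self]
    obtain ⟨a, u, hu⟩ := loc_surj x _ w'
    have h3 : toLoc x (K.L (i+1)) (K.d i u) = toLoc x (K.L (i+1)) 0 := by
      rw [← mapLoc_toLoc, ← hu, map_smul, hw', smul_zero, map_zero]
    obtain ⟨b, hb⟩ := loc_eq x _ h3
    rw [smul_zero, ← map_smul] at hb
    obtain ⟨m, hm⟩ := hK i _ hb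
    have hbd : ((0, y ^ m • w') : K.L (i+1) × Loc x (K.L i)) ∈ (cone x K).Bd (i+1) := by
      have hxw : x ^ (b + a) • (y ^ m • w') = toLoc x (K.L i) (y ^ m • x ^ b • u) := by
        rw [map_smul, map_smul, ← hu, smul_smul, smul_smul, smul_smul, pow_add]
        congr 1; ring
      cases i with
      | zero =>
        have h0 : y ^ m • x ^ b • u = 0 := hm
        rw [h0, map_zero] at hxw
        have : y ^ m • w' = 0 := loc_inj x _ (b + a) (by rw [hxw, smul_zero])
        rw [this]
        exact Submodule.zero_mem _
      | succ j =>
        obtain ⟨v', hv'⟩ := hm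
        obtain ⟨v'', hv''⟩ := (loc_bij x (K.L j) (b + a)).2 (toLoc x (K.L j) v')
        have hv3 : x ^ (b + a) • v'' = toLoc x (K.L j) v' := hv''
        refine ⟨(0, - v''), ?_⟩
        change coneD x K (j+1) (0, -v'') = _
        rw [coneD_succ, map_zero, map_zero, zero_sub, map_neg, neg_neg]
        congr 1
        apply loc_inj x _ (b + a)
        rw [hxw, ← hv', ← map_smul, hv3, mapLoc_toLoc]
    refine ⟨m + n, ?_⟩
    have : y ^ (m + n) • ((z, w) : K.L (i+1) × Loc x (K.L i)) =
        y ^ m • (K.d i v, toLoc x (K.L i) v) + (0, y ^ m • w') := by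
      ext
      · simp [hv, pow_add, smul_smul]
      · simp [w', pow_add, smul_smul, smul_sub]
    exact Set.mem_of_eq_of_mem (s := ((cone x K).Bd (i+1) : Set ((cone x K).L (i+1)))) this
      (Submodule.add_mem _ (Submodule.smul_mem _ _ (bd_left x K i v)) hbd)

def Cx.single (N : Type) [AddCommGroup N] [Module R N] : Cx R where
  L := fun i => match i with
    | 0 => ModuleCat.of R N
    | _+1 => ModuleCat.of R PUnit
  d := fun _ => 0
  dd := fun _ _ => rfl

variable (I : Ideal R) (Q : ∀ (N : Type) [AddCommGroup N] [Module R N], Prop)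

structure IsCech (N : Type) [AddCommGroup N] [Module R N] (s : List R) (K : Cx R) : Prop where
  zero : Nonempty (N ≃ₗ[R] K.L 0)
  q : ∀ i, Q (K.L (i+1))
  bdd : ∀ i, s.length < i → Subsingleton (K.L i)
  tors : ∀ x ∈ s, Tors K x

lemma exists_cech_aux (hQ : ∀ (A B : Type) [AddCommGroup A] [Module R A] [AddCommGroup B] [Module R B],
      Q A → Q B → Q (A × B))
    (hQ2 : ∀ (A : Type) [AddCommGroup A] [Module R A] (x : R), x ∈ I →
      Function.Bijective (sc A x) → Q A)
    (N : Type) [AddCommGroup N] [Module R N] (s : List R) (hs : ∀ x ∈ s, x ∈ I) :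
    ∃ K, IsCech Q N s K := by
  induction s with
  | nil =>
    refine ⟨Cx.single N, ⟨LinearEquiv.refl R N⟩, fun i => ?_, fun i hi => ?_, by simp⟩
    · refine hQ2 _ 0 I.zero_mem ?_
      have : Subsingleton ((Cx.single (R := R) N).L (i+1)) :=
        inferInstanceAs (Subsingleton PUnit)
      exact ⟨fun a b _ => Subsingleton.elim _ _, fun a => ⟨0, Subsingleton.elim _ _⟩⟩
    · obtain _ | i := i
      · simp at hi
      · exact inferInstanceAs (Subsingleton PUnit)
  | cons x s ih =>
    obtain ⟨K, hK⟩ := ih (fun y hy => hs y (List.mem_cons_of_mem _ hy))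
    refine ⟨cone x K, hK.zero, fun i => ?_, fun i hi => ?_, fun y hy => ?_⟩
    · refine hQ _ _ (hK.q i) (hQ2 _ x (hs x List.mem_cons_self) ?_)
      simpa using loc_bij x (K.L i) 1
    · obtain _ | i := i
      · simp at hi
      · simp only [List.length_cons] at hi
        have h1 := hK.bdd (i+1) (by omega)
        have h2 := hK.bdd i (by omega)
        have h3 : Subsingleton (Loc x (K.L i)) := by
          refine ⟨fun a b => ?_⟩
          obtain ⟨a1, u, hu⟩ := loc_surj x _ a
          obtain ⟨b1, v, hv⟩ := loc_surj x _ b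
          have e1 : a = 0 := loc_inj x _ a1 (by
            rw [hu, Subsingleton.elim u 0, map_zero, smul_zero])
          have e2 : b = 0 := loc_inj x _ b1 (by
            rw [hv, Subsingleton.elim v 0, map_zero, smul_zero])
          rw [e1, e2]
        exact inferInstanceAs (Subsingleton (K.L (i+1) × Loc x (K.L i)))
    · rcases List.mem_cons.mp hy with rfl | hy
      · exact tors_cone_self y K
      · exact tors_cone x y K (hK.tors y hy)

/-- the Cech-like resolution -/
theorem exists_cech [IsNoetherianRing R] : ∃ m : ℕ, 
    ∀ (Q : ∀ (N : Type) [AddCommGroup N] [Module R N], Prop)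
    (_ : ∀ (A B : Type) [AddCommGroup A] [Module R A] [AddCommGroup B] [Module R B],
      Q A → Q B → Q (A × B))
    (_ : ∀ (A : Type) [AddCommGroup A] [Module R A] (x : R), x ∈ I →
      Function.Bijective (sc A x) → Q A)
    (N : Type) [AddCommGroup N] [Module R N],
    ∃ K : Cx R, Nonempty (N ≃ₗ[R] K.L 0) ∧ (∀ i, Q (K.L (i+1))) ∧
      (∀ i, m < i → Subsingleton (K.L i)) ∧
      (∀ i (z : K.L i), K.d i z = 0 → ∃ n : ℕ, ∀ y ∈ I ^ n, y • z ∈ K.Bd i) := by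
  obtain ⟨s, hs⟩ := (isNoetherianRing_iff_ideal_fg R).mp inferInstance I
  refine ⟨s.toList.length, fun Q hQ hQ2 N _ _ => ?_⟩
  have hsI : ∀ x ∈ s.toList, x ∈ I := by
    intro x hx
    rw [← hs]
    exact Submodule.subset_span (by simpa using hx)
  obtain ⟨K, hK⟩ := exists_cech_aux I Q hQ hQ2 N s.toList hsI
  refine ⟨K, hK.zero, hK.q, hK.bdd, fun i z hz => ?_⟩
  let J : Ideal R := Submodule.comap (LinearMap.toSpanSingleton R (K.L i) z) (K.Bd i)
  have hle : I ≤ J.radical := by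
    rw [← hs, Ideal.span_le]
    intro x hx
    obtain ⟨a, ha⟩ := hK.tors x (by simpa using hx) i z hz
    exact ⟨a, ha⟩
  obtain ⟨n, hn⟩ := Ideal.exists_pow_le_of_le_radical_of_fg hle
    ((isNoetherianRing_iff_ideal_fg R).mp inferInstance I)
  exact ⟨n, fun y hy => hn hy⟩

end Cech
end LC
end


noncomputable section
namespace LC
open Opposite Limits

section F2
variable {R : Type} [CommRing R]

lemma Cx.bd_le (K : Cx R) (i : ℕ) : K.Bd i ≤ LinearMap.ker (K.d i) := by
  cases i with
  | zero => exact bot_le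
  | succ i =>
    rintro _ ⟨x, rfl⟩
    exact K.dd i x

abbrev Cx.Z (K : Cx R) (i : ℕ) : Submodule R (K.L i) := LinearMap.ker (K.d i)

abbrev Cx.HB (K : Cx R) (i : ℕ) : Submodule R (K.Z i) := (K.Bd i).comap (K.Z i).subtype

abbrev Cx.H (K : Cx R) (i : ℕ) : Type := K.Z i ⧸ K.HB i

lemma Cx.ses1 (K : Cx R) (i : ℕ) : SES (K.Z i).subtype
    (LinearMap.rangeRestrict (K.d i) : K.L i →ₗ[R] K.Bd (i+1)) where
  inj := Submodule.subtype_injective _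
  ex := by
    intro x
    constructor
    · intro h
      exact ⟨⟨x, congrArg Subtype.val h⟩, rfl⟩
    · rintro ⟨x, rfl⟩
      exact Subtype.ext x.2
  surj := LinearMap.surjective_rangeRestrict _

lemma Cx.ses2 (K : Cx R) (i : ℕ) : SES (Submodule.inclusion (K.bd_le i)) (K.HB i).mkQ where
  inj := Submodule.inclusion_injective _
  ex := by
    intro x
    rw [Submodule.mkQ_apply, Submodule.Quotient.mk_eq_zero]
    constructor
    · intro h
      exact ⟨⟨x, h⟩, rfl⟩
    · rintro ⟨y, rfl⟩
      exact y.2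
  surj := Submodule.mkQ_surjective _

variable (I : Ideal R)

structure Cx.Good (K : Cx R) (m : ℕ) : Prop where
  sa : ∀ i, SA I (K.L (i+1))
  bdd : ∀ i, m < i → Subsingleton (K.L i)
  tors : ∀ i (z : K.L i), K.d i z = 0 → ∃ n : ℕ, ∀ y ∈ I ^ n, y • z ∈ K.Bd i

variable {I} {K : Cx R} {m : ℕ} (hK : K.Good I m)
include hK

lemma Cx.Good.torH (i : ℕ) : IsTor I (K.H i) := by
  intro t
  obtain ⟨⟨z, hz⟩, rfl⟩ := Submodule.mkQ_surjective _ t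
  obtain ⟨n, hn⟩ := hK.tors i z hz
  refine ⟨n, fun y hy => ?_⟩
  rw [← map_smul, Submodule.mkQ_apply, Submodule.Quotient.mk_eq_zero]
  exact hn y hy

lemma Cx.Good.torZ : IsTor I (K.Z 0) := by
  intro z
  obtain ⟨n, hn⟩ := hK.tors 0 z.1 z.2
  refine ⟨n, fun y hy => ?_⟩
  have h : y • z.1 = 0 := hn y hy
  exact Subtype.ext h

lemma Cx.Good.subB (i : ℕ) (hi : m < i) : Subsingleton (K.Bd i) := by
  have := hK.bdd i hi
  infer_instance

variable [IsNoetherianRing R]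

lemma Cx.Good.vanB (k : ℕ) : ∀ j, m < k + 1 + j → V I (k+1) (K.Bd (j+1)) := by
  induction k with
  | zero =>
    intro j hj
    have := hK.subB (j+1) (by omega)
    exact V.zero
  | succ k ih =>
    intro j hj
    refine V.left (K.ses2 (j+1)) ?_ (IsTor.van k _ (hK.torH (j+1)))
    exact V.left (K.ses1 (j+1)) (V.of_SA (hK.sa j) _) (ih (j+1) (by omega))

lemma Cx.Good.vanL (k : ℕ) (hk : m < k) : V I k (K.L 0) := by
  obtain _ | k := k
  · omega
  exact V.mid (K.ses1 0) (IsTor.van k _ hK.torZ) (hK.vanB k 0 (by omega))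

/-- upward propagation of vanishing -/
lemma Cx.Good.vanB_up {j : ℕ} (hN : ∀ k, j ≤ k → V I k (K.L 0)) (t : ℕ) :
    ∀ k, j ≤ k + 1 + t → V I (k+1) (K.Bd (t+1)) := by
  induction t with
  | zero =>
    intro k hk
    exact V.right (K.ses1 0) (hN _ hk) (IsTor.van _ _ hK.torZ)
  | succ t ih =>
    intro k hk
    refine V.right (K.ses1 (t+1)) (V.of_SA (hK.sa t) _) ?_
    exact V.mid (K.ses2 (t+1)) (ih (k+1) (by omega)) (IsTor.van _ _ (hK.torH _))

lemma Cx.Good.subH {j : ℕ} (hN : ∀ k, j ≤ k → V I k (K.L 0)) (t : ℕ) (ht : j ≤ t + 1) :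
    Subsingleton (K.H (t+1)) := by
  have h1 := hK.vanB_up hN t 0 (by omega)
  have h2 : V I 0 (K.Z (t+1)) := V.left0 (K.ses1 (t+1)) (V.of_SA (hK.sa t) _)
  rw [van_zero_iff] at h2
  suffices h : ∀ a : K.H (t+1), a = 0 from ⟨fun a b => by rw [h a, h b]⟩
  intro a
  obtain ⟨b, hb, rfl⟩ := surj_of_van_one I (K.ses2 (t+1)) h1 a (hK.torH _ a)
  rw [h2 b hb, map_zero]

lemma Cx.Good.ev {j : ℕ} (hj : 1 ≤ j) (hN : ∀ k, j ≤ k → V I k (K.L 0))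
    {X : Type} [AddCommGroup X] [Module R X] (hX : ∀ i < j, V I i X)
    (hL : ∀ i k, EV R k (K.L (i+1)) X) : EV R 0 (K.L 0) X := by
  have key : ∀ n k, m < k + 1 + n → EV R k (K.Bd (k+1)) X := by
    intro n
    induction n with
    | zero =>
      intro k hk
      have := hK.subB (k+1) (by omega)
      exact EV.zero_left
    | succ n ih =>
      intro k hk
      refine EV.cleft (K.ses2 (k+1)) ?_ ?_
      · exact EV.cleft (K.ses1 (k+1)) (hL k k) (ih (k+1) (by omega))
      · by_cases h : k + 1 < j
        · exact IsTor.ev (hK.torH (k+1)) j X hX (k+1) h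
        · have := hK.subH hN k (by omega)
          exact EV.zero_left
  exact EV.cmid (K.ses1 0) (EV.zero_of_tor hK.torZ (hX 0 (by omega))) (key m 0 (by omega))

end F2

section
variable {R : Type} [CommRing R] [IsNoetherianRing R] (I : Ideal R)

/-- Boundedness of local cohomology -/
theorem exists_bound : ∃ m : ℕ, ∀ (N : Type) [AddCommGroup N] [Module R N], ∀ k, m < k →
    V I k N := by
  obtain ⟨m, hm⟩ := exists_cech I
  refine ⟨m, fun N _ _ k hk => ?_⟩
  obtain ⟨K, ⟨e⟩, h1, h2, h3⟩ := hm (fun A _ _ => SA I A)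
    (fun A B _ _ _ _ ha hb => SA.mid SES.prod ha hb)
    (fun A _ _ x hx hb => SA.of_bij hx hb) N
  have hK : K.Good I m := ⟨h1, h2, h3⟩
  exact (V.congr e).mpr (hK.vanL k hk)

theorem hom_compl_zero {N M : Type} [AddCommGroup N] [Module R N] [AddCommGroup M] [Module R M]
    {j : ℕ} (hj : 1 ≤ j) (hN : ∀ k, j ≤ k → V I k N)
    (hX : ∀ i < j, V I i (AdicCompletion I M)) (f : N →ₗ[R] AdicCompletion I M) : f = 0 := by
  obtain ⟨m, hm⟩ := exists_cech I
  obtain ⟨K, ⟨e⟩, h1, h2, h3⟩ := hm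
    (fun A _ _ => SA I A ∧ ∀ k, EV R k A (AdicCompletion I M))
    (fun A B _ _ _ _ ha hb => ⟨SA.mid SES.prod ha.1 hb.1,
      fun k => EV.cmid SES.prod (ha.2 k) (hb.2 k)⟩)
    (fun A _ _ x hx hb => ⟨SA.of_bij hx hb, ev_compl I M hx hb⟩) N
  have hK : K.Good I m := ⟨fun i => (h1 i).1, h2, h3⟩
  have := hK.ev hj (fun k hk => (V.congr e).mp (hN k hk)) hX (fun i k => (h1 i).2 k)
  exact ev_zero_iff.mp (EV.congr_left e.symm this) f
end
end LC
end


noncomputable section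
namespace LC
open Opposite Limits

section
variable {R : Type} [CommRing R]
variable {A B C T : Type} [AddCommGroup A] [Module R A] [AddCommGroup B] [Module R B]
  [AddCommGroup C] [Module R C] [AddCommGroup T] [Module R T]

lemma EV.inj_of_right {f : A →ₗ[R] B} {g : B →ₗ[R] C} (h : SES f g) (hC : ∀ k, EV R k T C)
    {k : ℕ} (e : EX R k T A)
    (he : e.comp (Abelian.Ext.mk₀ (ModuleCat.ofHom f)) (add_zero k) = 0) : e = 0 := by
  cases k with
  | zero =>
    have := h.se.mono_f
    refine Abelian.Ext.postcomp_mk₀_injective_of_mono _ h.sc.f (he.trans ?_)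
    simp
  | succ k =>
    obtain ⟨x, rfl⟩ := Abelian.Ext.covariant_sequence_exact₁ _ h.se e he rfl
    rw [hC k x, Abelian.Ext.zero_comp]

lemma EV.inj_of_left {f : A →ₗ[R] B} {g : B →ₗ[R] C} (h : SES f g) (hA : ∀ k, EV R k T A)
    {k : ℕ} (e : EX R k T B)
    (he : e.comp (Abelian.Ext.mk₀ (ModuleCat.ofHom g)) (add_zero k) = 0) : e = 0 := by
  obtain ⟨x, rfl⟩ := Abelian.Ext.covariant_sequence_exact₂ _ h.se e he
  rw [hA k x, Abelian.Ext.zero_comp]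

lemma SA.of_ker_coker {I : Ideal R} {x : R} (hxI : x ∈ I)
    (h1 : SA I (LinearMap.ker (sc C x))) (h2 : SA I (C ⧸ LinearMap.range (sc C x))) :
    SA I C := by
  intro k n
  have key : ∀ e : EX R k (R ⧸ I ^ n) C, x • e = 0 → e = 0 := by
    intro e he
    rw [smul_right] at he
    refine EV.inj_of_left (SES.ker (LinearMap.surjective_rangeRestrict (sc C x)))
      (T := R ⧸ I ^ n) (fun k => ?_) e ?_
    · rw [LinearMap.ker_rangeRestrict]
      exact h1 k n
    · refine EV.inj_of_right (SES.quot (LinearMap.range (sc C x))) (fun k => h2 k n) _ ?_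
      rw [Abelian.Ext.comp_assoc_of_second_deg_zero, Abelian.Ext.mk₀_comp_mk₀]
      exact he
  have key2 : ∀ m, ∀ e : EX R k (R ⧸ I ^ n) C, x ^ m • e = 0 → e = 0 := by
    intro m
    induction m with
    | zero => intro e he; simpa using he
    | succ m ih =>
      intro e he
      apply ih
      apply key
      rw [smul_smul, ← pow_succ', he]
  intro e
  exact key2 n e (smul_zero_left _ _ (quot_kill I (Ideal.pow_mem_pow hxI n)))

lemma SA.congr {I : Ideal R} (e : A ≃ₗ[R] B) (h : SA I A) : SA I B :=
  fun k n => (h k n).congr_right e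

end

section
variable {R : Type} [CommRing R] [IsNoetherianRing R] (I : Ideal R)
variable {A B C : Type} [AddCommGroup A] [Module R A] [AddCommGroup B] [Module R B]
  [AddCommGroup C] [Module R C]

/-- cokernel of the completion map -/
abbrev Q (A : Type) [AddCommGroup A] [Module R A] : Type :=
  AdicCompletion I A ⧸ LinearMap.range (AdicCompletion.of I A)

abbrev cmap (f : A →ₗ[R] B) : AdicCompletion I A →ₗ[R] AdicCompletion I B :=
  (AdicCompletion.map I f).restrictScalars R

def qm (f : A →ₗ[R] B) : Q I A →ₗ[R] Q I B :=
  Submodule.mapQ _ _ (cmap I f) (by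
    rintro _ ⟨a, rfl⟩
    exact ⟨f a, (AdicCompletion.map_of I f a).symm⟩)

lemma exists_ker_id (A : Type) [AddCommGroup A] [Module R A] [Module.Finite R A] :
    ∃ x ∈ I, ∀ a : A, AdicCompletion.of I A a = 0 → x • a = a := by
  let K : Submodule R A := LinearMap.ker (AdicCompletion.of I A)
  have hK : K ≤ I • K := by
    intro a ha
    have : a ∈ (⨅ i : ℕ, I ^ i • ⊤ : Submodule R A) := by
      rw [Submodule.mem_iInf]
      intro i
      have h1 : (AdicCompletion.of I A a).1 i = 0 := by rw [LinearMap.mem_ker.mp ha]; rfl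
      rw [AdicCompletion.of_apply] at h1
      exact (Submodule.Quotient.mk_eq_zero _).mp h1
    obtain ⟨r, hr⟩ := (I.mem_iInf_smul_pow_eq_bot_iff a).mp this
    rw [← hr]
    exact Submodule.smul_mem_smul r.2 ha
  obtain ⟨r, hr1, hr2⟩ := Submodule.exists_sub_one_mem_and_smul_eq_zero_of_fg_of_le_smul I K
    (IsNoetherian.noetherian K) hK
  refine ⟨1 - r, ?_, fun a ha => ?_⟩
  · rw [← neg_sub]; exact I.neg_mem hr1
  · rw [sub_smul, one_smul, hr2 a ha, sub_zero]

omit [IsNoetherianRing R] in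
lemma SA.of_id {Y : Type} [AddCommGroup Y] [Module R Y] {x : R} (hxI : x ∈ I)
    (hx : ∀ y : Y, x • y = y) : SA I Y := by
  refine SA.of_bij hxI ?_
  have : sc Y x = LinearMap.id := by ext y; exact hx y
  rw [this]
  exact Function.bijective_id

lemma SES.cmap [Module.Finite R A] [Module.Finite R B] [Module.Finite R C]
    {f : A →ₗ[R] B} {g : B →ₗ[R] C} (h : SES f g) : SES (cmap I f) (cmap I g) :=
  ⟨AdicCompletion.map_injective I h.inj, AdicCompletion.map_exact h.inj h.ex h.surj,
    AdicCompletion.map_surjective I h.surj⟩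

section
variable [Module.Finite R A] [Module.Finite R B] [Module.Finite R C]
    {f : A →ₗ[R] B} {g : B →ₗ[R] C} (h : SES f g)
include h

lemma qm_ker : SA I (LinearMap.ker (qm I f)) := by
  obtain ⟨x, hxI, hx⟩ := exists_ker_id I C
  refine SA.of_id I hxI ?_
  rintro ⟨u, hu⟩
  apply Subtype.ext
  change x • u = u
  obtain ⟨α, rfl⟩ := Submodule.mkQ_surjective _ u
  have h1 : cmap I f α ∈ LinearMap.range (AdicCompletion.of I B) :=
    (Submodule.Quotient.mk_eq_zero _).mp hu
  obtain ⟨b, hb⟩ := h1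
  have h2 : AdicCompletion.of I C (g b) = 0 := by
    rw [← AdicCompletion.map_of, hb]
    exact (h.cmap I).ex.apply_apply_eq_zero α
  have h3 : g (b - x • b) = 0 := by rw [map_sub, map_smul, hx _ h2, sub_self]
  obtain ⟨a, ha⟩ := (h.ex _).mp h3
  have h4 : AdicCompletion.of I A a = α - x • α := by
    apply (h.cmap I).inj
    rw [map_sub, map_smul, ← hb, ← map_smul, ← map_sub, ← ha]
    exact AdicCompletion.map_of I f a
  rw [← map_smul, eq_comm, ← sub_eq_zero, ← map_sub, ← h4]
  exact (Submodule.Quotient.mk_eq_zero _).mpr ⟨a, rfl⟩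

lemma qm_surj : Function.Surjective (qm I g) := by
  intro u
  obtain ⟨γ, rfl⟩ := Submodule.mkQ_surjective _ u
  obtain ⟨β, rfl⟩ := (h.cmap I).surj γ
  exact ⟨Submodule.mkQ _ β, rfl⟩

lemma qm_ex : Function.Exact (qm I f) (qm I g) := by
  intro u
  constructor
  · intro hu
    obtain ⟨β, rfl⟩ := Submodule.mkQ_surjective _ u
    have h1 : cmap I g β ∈ LinearMap.range (AdicCompletion.of I C) :=
      (Submodule.Quotient.mk_eq_zero _).mp hu
    obtain ⟨c, hc⟩ := h1
    obtain ⟨b, rfl⟩ := h.surj c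
    have h2 : cmap I g (β - AdicCompletion.of I B b) = 0 := by
      rw [map_sub, ← hc, sub_eq_zero]
      exact (AdicCompletion.map_of I g b).symm
    obtain ⟨α, hα⟩ := ((h.cmap I).ex _).mp h2
    refine ⟨Submodule.mkQ _ α, ?_⟩
    change Submodule.mkQ _ (cmap I f α) = _
    rw [hα, map_sub, sub_eq_self]
    exact (Submodule.Quotient.mk_eq_zero _).mpr ⟨b, rfl⟩
  · rintro ⟨v, rfl⟩
    obtain ⟨α, rfl⟩ := Submodule.mkQ_surjective _ v
    change Submodule.mkQ _ (cmap I g (cmap I f α)) = _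
    rw [(h.cmap I).ex.apply_apply_eq_zero α, map_zero]

lemma SES.qmr : SES (LinearMap.range (qm I f)).subtype (qm I g) :=
  ⟨Submodule.subtype_injective _, fun y => by
    rw [qm_ex I h y]
    simp, qm_surj I h⟩

lemma Q_mid (hA : SA I (Q I A)) (hC : SA I (Q I C)) : SA I (Q I B) := by
  refine SA.mid (h.qmr I) ?_ hC
  refine SA.right (SES.ker (LinearMap.surjective_rangeRestrict (qm I f))) ?_ hA
  rw [LinearMap.ker_rangeRestrict]
  exact qm_ker I h

end

def Qcongr (e : A ≃ₗ[R] B) : Q I A ≃ₗ[R] Q I B :=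
  Submodule.Quotient.equiv _ _ ((AdicCompletion.congr I e).restrictScalars R) (by
    ext u
    constructor
    · rintro ⟨_, ⟨a, rfl⟩, rfl⟩
      exact ⟨e a, rfl⟩
    · rintro ⟨b, rfl⟩
      refine ⟨_, ⟨e.symm b, rfl⟩, ?_⟩
      change AdicCompletion.map I e.toLinearMap (AdicCompletion.of I A (e.symm b)) = _
      rw [AdicCompletion.map_of]
      simp)

lemma Q_congr (e : A ≃ₗ[R] B) (h : SA I (Q I A)) : SA I (Q I B) :=
  fun k n => EV.congr_right (Qcongr I e) (h k n)

lemma Q_zero [Subsingleton A] : SA I (Q I A) := by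
  refine SA.of_id I I.zero_mem (fun y => ?_)
  obtain ⟨u, rfl⟩ := Submodule.mkQ_surjective _ y
  have : u = 0 := by
    ext n
    obtain ⟨a, ha⟩ := Submodule.mkQ_surjective _ (u.val n)
    rw [← ha, Subsingleton.elim a 0]
    simp
  rw [this]; simp

/-- modules killed by `I` are complete -/
lemma Q_kill (hk : ∀ x ∈ I, ∀ a : A, x • a = 0) : SA I (Q I A) := by
  refine SA.of_id I I.zero_mem (fun y => ?_)
  obtain ⟨u, rfl⟩ := Submodule.mkQ_surjective _ y
  have hz : ∀ n, (I ^ (n+1) • ⊤ : Submodule R A) = ⊥ := by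
    intro n
    rw [eq_bot_iff, Submodule.smul_le]
    intro r hr a _
    exact hk r (Ideal.pow_le_self (Nat.succ_ne_zero n) hr) a
  obtain ⟨a, ha⟩ := Submodule.mkQ_surjective _ (u.val 1)
  have : u = AdicCompletion.of I A a := by
    ext n
    rcases n with _ | n
    · have : (I ^ 0 • ⊤ : Submodule R A) = ⊤ := by simp
      have : Subsingleton (A ⧸ (I ^ 0 • ⊤ : Submodule R A)) := by
        rw [this]; infer_instance
      exact Subsingleton.elim _ _
    · obtain ⟨b, hb⟩ := Submodule.mkQ_surjective _ (u.val (n+1))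
      have h1 := u.2 (show 1 ≤ n+1 by omega)
      rw [← hb, ← ha] at h1
      have h2 : b - a ∈ (I ^ 1 • ⊤ : Submodule R A) :=
        (Submodule.Quotient.eq _).mp h1
      rw [hz 0, Submodule.mem_bot, sub_eq_zero] at h2
      change u.val (n+1) = _
      rw [← hb, h2]
      rfl
  rw [this]
  have h0 : Submodule.mkQ (LinearMap.range (AdicCompletion.of I A)) (AdicCompletion.of I A a) = 0 :=
    (Submodule.Quotient.mk_eq_zero _).mpr ⟨a, rfl⟩
  rw [h0, smul_zero]

end

/-- devissage with an annihilator -/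
lemma devissage {R : Type} [CommRing R] [IsNoetherianRing R]
    (P : (N : Type) → [AddCommGroup N] → [Module R N] → Prop) (J : Ideal R)
    (h0 : ∀ (N : Type) [AddCommGroup N] [Module R N], Subsingleton N → P N)
    (hc : ∀ (N N' : Type) [AddCommGroup N] [Module R N] [AddCommGroup N'] [Module R N'],
      (N ≃ₗ[R] N') → P N' → P N)
    (hq : ∀ p : Ideal R, p.IsPrime → J ≤ p → P (R ⧸ p))
    (he : ∀ (A B C : Type) [AddCommGroup A] [Module R A] [AddCommGroup B] [Module R B]
      [AddCommGroup C] [Module R C] [Module.Finite R A] [Module.Finite R B] [Module.Finite R C]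
      (f : A →ₗ[R] B) (g : B →ₗ[R] C), SES f g → P A → P C → P B)
    (N : Type) [AddCommGroup N] [Module R N] [hN : Module.Finite R N]
    (hJ : ∀ r ∈ J, ∀ n : N, r • n = 0) : P N := by
  refine IsNoetherianRing.induction_on_isQuotientEquivQuotientPrime R hN
    (motive := fun N _ _ _ => (∀ r ∈ J, ∀ n : N, r • n = 0) → P N) ?_ ?_ ?_ hJ
  · intro N _ _ _ _ _
    exact h0 N inferInstance
  · intro N _ _ _ p e h
    refine hc _ _ e (hq p.1 p.2 ?_)
    intro r hr
    have := h r hr (e.symm 1)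
    rw [← map_smul, LinearEquiv.map_eq_zero_iff, Algebra.smul_def, mul_one] at this
    exact Ideal.Quotient.eq_zero_iff_mem.mp this
  · intro A _ _ _ B _ _ _ C _ _ _ f g hf hg hfg hA hC hB
    refine he A B C f g ⟨hf, hfg, hg⟩ (hA ?_) (hC ?_)
    · intro r hr a
      apply hf
      rw [map_smul, hB r hr, map_zero]
    · intro r hr c
      obtain ⟨b, rfl⟩ := hg c
      rw [← map_smul, hB r hr, map_zero]

section
variable {R : Type} [CommRing R] [IsNoetherianRing R] (I : Ideal R)

def QSA (N : Type) [AddCommGroup N] [Module R N] : Prop := SA I (Q I N)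

lemma QSA_dev (J : Ideal R) (hq : ∀ p : Ideal R, p.IsPrime → J ≤ p → QSA I (R ⧸ p))
    (N : Type) [AddCommGroup N] [Module R N] [hN : Module.Finite R N]
    (hJ : ∀ r ∈ J, ∀ n : N, r • n = 0) : QSA I N := by
  refine devissage (QSA I) J ?_ ?_ (fun p hp h => ?_) ?_ N hJ
  rotate_left 2
  · have := hq p hp h
    exact this
  rotate_left 1
  · intro N _ _ _; exact Q_zero I
  · intro N N1 _ _ _ _ e h
    exact Q_congr (A := N1) (B := N) I e.symm h
  · intro A B C _ _ _ _ _ _ _ _ _ f g h h1 h2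
    exact Q_mid I h h1 h2

lemma Q_prime (p : Ideal R) (hp : p.IsPrime) : QSA I (R ⧸ p) := by
  induction p using WellFoundedGT.induction with
  | ind p ih =>
  by_cases hI : I ≤ p
  · refine Q_kill I (fun x hx a => ?_)
    obtain ⟨a, rfl⟩ := Ideal.Quotient.mk_surjective a
    rw [Algebra.smul_def]
    change Ideal.Quotient.mk _ x * _ = 0
    rw [Ideal.Quotient.eq_zero_iff_mem.mpr (hI hx), zero_mul]
  · obtain ⟨x, hxI, hxp⟩ := Set.not_subset.mp hI
    have hinj : Function.Injective (sc (R ⧸ p) x) := by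
      rw [injective_iff_map_eq_zero]
      intro a ha
      have : Ideal.Quotient.mk p x * a = 0 := by
        rw [← ha]; exact (Algebra.smul_def x a).symm
      rcases mul_eq_zero.mp this with h | h
      · exact absurd (Ideal.Quotient.eq_zero_iff_mem.mp h) hxp
      · exact h
    have hs := SES.coker hinj
    have hQ : QSA I ((R ⧸ p) ⧸ LinearMap.range (sc (R ⧸ p) x)) := by
      refine QSA_dev I (p ⊔ Ideal.span {x}) ?_ _ ?_
      · intro q hq hle
        refine ih q (lt_of_le_of_ne (le_sup_left.trans hle) ?_) hq
        rintro rfl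
        exact hxp (hle (Ideal.mem_sup_right (Ideal.mem_span_singleton_self x)))
      · intro r hr n
        obtain ⟨a, rfl⟩ := Submodule.mkQ_surjective _ n
        obtain ⟨b, hb, c, hc, rfl⟩ := Submodule.mem_sup.mp hr
        obtain ⟨d, rfl⟩ := Ideal.mem_span_singleton.mp hc
        have : b • a = 0 := by
          rw [Algebra.smul_def]
          change Ideal.Quotient.mk _ b * _ = 0
          rw [Ideal.Quotient.eq_zero_iff_mem.mpr hb, zero_mul]
        rw [← map_smul, add_smul, this, zero_add, mul_smul]
        exact (Submodule.Quotient.mk_eq_zero _).mpr ⟨d • a, rfl⟩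
    have hqm : qm I (sc (R ⧸ p) x) = sc (Q I (R ⧸ p)) x := by
      refine LinearMap.ext fun u => ?_
      obtain ⟨u, rfl⟩ := Submodule.mkQ_surjective _ u
      change Submodule.mkQ _ (AdicCompletion.map I (sc (R ⧸ p) x) u) = x • Submodule.mkQ (LinearMap.range (AdicCompletion.of I (R ⧸ p))) u
      rw [← map_smul]
      congr 1
    have h1 := qm_ker I hs
    rw [hqm] at h1
    refine SA.of_ker_coker hxI h1 ?_
    have h2 := hs.qmr I
    rw [hqm] at h2
    have e : LinearMap.range (sc (Q I (R ⧸ p)) x) = LinearMap.ker (qm I (LinearMap.range (sc (R ⧸ p) x)).mkQ) := by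
      ext y
      rw [LinearMap.mem_ker, h2.ex y]
      simp
    rw [e]
    exact SA.congr (LinearMap.quotKerEquivOfSurjective _ h2.surj).symm hQ

theorem Q_SA (A : Type) [AddCommGroup A] [Module R A] [Module.Finite R A] : SA I (Q I A) := by
  refine QSA_dev I ⊥ (fun q hq hle => Q_prime I q hq) A ?_
  · rintro r hr n
    rw [(Submodule.mem_bot R).mp hr, zero_smul]

/-- local cohomology and completion -/
theorem van_compl (i : ℕ) (A : Type) [AddCommGroup A] [Module R A] [Module.Finite R A] :
    V I i A ↔ V I i (AdicCompletion I A) := by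
  let φ := AdicCompletion.of I A
  have s1 := SES.ker (LinearMap.surjective_rangeRestrict φ)
  have s2 := SES.quot (LinearMap.range φ)
  have hK : SA I (LinearMap.ker φ.rangeRestrict) := by
    rw [LinearMap.ker_rangeRestrict]
    obtain ⟨x, hxI, hx⟩ := exists_ker_id I A
    exact SA.of_id I hxI (fun y => Subtype.ext (hx y.1 y.2))
  have hQ : SA I (AdicCompletion I A ⧸ LinearMap.range φ) := Q_SA I A
  constructor
  · intro h
    exact V.mid s2 (V.right s1 h (V.of_SA hK _)) (V.of_SA hQ _)
  · intro h
    refine V.mid s1 (V.of_SA hK _) ?_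
    cases i with
    | zero => exact V.left0 s2 h
    | succ i => exact V.left s2 h (V.of_SA hQ _)

end
end LC
end


noncomputable section
namespace LC
open Opposite Limits

section
variable {R : Type} [CommRing R] [IsNoetherianRing R] (I : Ideal R)

lemma quot_prime_kill {p : Ideal R} {r : R} (hr : r ∈ p) (a : R ⧸ p) : r • a = 0 := by
  obtain ⟨a, rfl⟩ := Ideal.Quotient.mk_surjective a
  rw [Algebra.smul_def]
  change Ideal.Quotient.mk _ r * _ = 0
  rw [Ideal.Quotient.eq_zero_iff_mem.mpr hr, zero_mul]

lemma exists_map_ne (M : Type) [AddCommGroup M] [Module R M] [Module.Finite R M] (p : Ideal R)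
    (hp : p.IsPrime) (h : Module.annihilator R M ≤ p) : ∃ f : M →ₗ[R] R ⧸ p, f ≠ 0 := by
  by_contra! hf
  have h1 : Subsingleton (M →ₗ[R] R ⧸ p) := ⟨fun a b => (hf a).trans (hf b).symm⟩
  obtain ⟨r, hr, hreg⟩ := IsSMulRegular.subsingleton_linearMap_iff.mp h1
  have h2 : (1 : R ⧸ p) = 0 := by
    apply hreg
    simp only
    rw [quot_prime_kill (h hr), quot_prime_kill (h hr)]
  exact one_ne_zero h2

lemma V_dev (k : ℕ) (J : Ideal R) (hq : ∀ p : Ideal R, p.IsPrime → J ≤ p → V I k (R ⧸ p))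
    (N : Type) [AddCommGroup N] [Module R N] [hN : Module.Finite R N]
    (hJ : ∀ r ∈ J, ∀ n : N, r • n = 0) : V I k N := by
  refine devissage (fun N _ _ => V I k N) J ?_ ?_ (fun p hp h => ?_) ?_ N hJ
  rotate_left 2
  · exact hq p hp h
  rotate_left 1
  · intro N _ _ _
    exact V.zero
  · intro N N1 _ _ _ _ e h
    exact (V.congr e).mpr h
  · intro A B C _ _ _ _ _ _ _ _ _ f g h h1 h2
    exact V.mid h h1 h2

lemma V_prime (M : Type) [AddCommGroup M] [Module R M] [Module.Finite R M] (k : ℕ)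
    (hM : V I k M)
    (hk : ∀ (N : Type) [AddCommGroup N] [Module R N] [Module.Finite R N],
      (∀ r ∈ Module.annihilator R M, ∀ n : N, r • n = 0) → V I (k+1) N)
    (p : Ideal R) (hp : p.IsPrime) (hle : Module.annihilator R M ≤ p) : V I k (R ⧸ p) := by
  induction p using WellFoundedGT.induction with
  | ind p ih =>
  obtain ⟨f, hf⟩ := exists_map_ne M p hp hle
  have s1 := SES.ker (LinearMap.surjective_rangeRestrict f)
  have s2 := SES.quot (LinearMap.range f)
  obtain ⟨m, hm⟩ : ∃ m, f m ≠ 0 := by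
    by_contra! h
    exact hf (LinearMap.ext h)
  obtain ⟨x, hx⟩ := Ideal.Quotient.mk_surjective (f m)
  have hxp : x ∉ p := by
    intro h
    apply hm
    rw [← hx]
    exact Ideal.Quotient.eq_zero_iff_mem.mpr h
  refine V.mid s2 (V.right s1 hM (hk _ ?_)) ?_
  · intro r hr n
    apply Subtype.ext
    exact Module.mem_annihilator.mp hr n.1
  · refine V_dev I k (p ⊔ Ideal.span {x}) ?_ _ ?_
    · intro q hq hle2
      refine ih q (lt_of_le_of_ne (le_sup_left.trans hle2) ?_) hq (hle.trans (le_sup_left.trans hle2))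
      rintro rfl
      exact hxp (hle2 (Ideal.mem_sup_right (Ideal.mem_span_singleton_self x)))
    · intro r hr n
      obtain ⟨a, rfl⟩ := Submodule.mkQ_surjective _ n
      obtain ⟨b, hb, c, hc, rfl⟩ := Submodule.mem_sup.mp hr
      obtain ⟨d, rfl⟩ := Ideal.mem_span_singleton.mp hc
      rw [← map_smul, add_smul, quot_prime_kill hb, zero_add, mul_smul]
      refine (Submodule.Quotient.mk_eq_zero _).mpr ?_
      obtain ⟨a', ha'⟩ := Ideal.Quotient.mk_surjective (d • a)
      refine ⟨a' • m, ?_⟩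
      rw [map_smul, ← hx, ← ha', Algebra.smul_def, Algebra.smul_def]
      exact mul_comm _ _

theorem V_supp (M : Type) [AddCommGroup M] [Module R M] [Module.Finite R M] (i : ℕ)
    (hM : ∀ k, i < k → V I k M) (N : Type) [AddCommGroup N] [Module R N] [Module.Finite R N]
    (hN : ∀ r ∈ Module.annihilator R M, ∀ n : N, r • n = 0) : ∀ k, i < k → V I k N := by
  obtain ⟨m, hm⟩ := exists_bound I
  have key : ∀ n k, m < k + n → i < k → ∀ (N : Type) [AddCommGroup N] [Module R N]
      [Module.Finite R N], (∀ r ∈ Module.annihilator R M, ∀ n : N, r • n = 0) → V I k N := by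
    intro n
    induction n with
    | zero => intro k hk _ N _ _ _ _; exact hm N k hk
    | succ n ih =>
      intro k hk hik N _ _ _ hN
      refine V_dev I k (Module.annihilator R M) (fun p hp hle => ?_) N hN
      exact V_prime I M k (hM k hik) (ih (k+1) (by omega) (by omega)) p hp hle
  intro k hk
  exact key (m+1) k (by omega) hk N hN

end
end LC
end



noncomputable section
namespace LC
open Opposite Limits

section
variable {S : Type} [CommRing S] (J : Ideal S)

/-- cohomological dimension at most `i` -/
def Vd (i : ℕ) (N : Type) [AddCommGroup N] [Module S N] : Prop := ∀ k, i < k → V J k N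

lemma nontriv_iff (i : ℕ) (N : Type) [AddCommGroup N] [Module S N] :
    Nontrivial ((localCohomology J i).obj (ModuleCat.of S N)) ↔ ¬ V J i N := by
  rw [← not_subsingleton_iff_nontrivial, van_iff]

lemma cohDim_le_iff (hb : ∃ m : ℕ, ∀ (N : Type) [AddCommGroup N] [Module S N], ∀ k, m < k →
    V J k N) (i : ℕ) (N : Type) [AddCommGroup N] [Module S N] :
    cohDim J N ≤ i ↔ Vd J i N := by
  obtain ⟨m, hm⟩ := hb
  have hbd : BddAbove {i : ℕ | Nontrivial ((localCohomology J i).obj (ModuleCat.of S N))} := by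
    refine ⟨m, fun k hk => ?_⟩
    by_contra h
    exact (nontriv_iff J k N).mp hk (hm N k (by omega))
  constructor
  · intro h k hk
    by_contra hV
    have := le_csSup hbd ((nontriv_iff J k N).mpr hV)
    unfold cohDim at h
    omega
  · intro h
    unfold cohDim
    rcases Set.eq_empty_or_nonempty
      {i : ℕ | Nontrivial ((localCohomology J i).obj (ModuleCat.of S N))} with he | he
    · rw [he]; simp
    · refine csSup_le he (fun k hk => ?_)
      by_contra hki
      exact (nontriv_iff J k N).mp hk (h k (by omega))

end

lemma cohDim_congr {R S : Type} [CommRing R] [CommRing S] (I : Ideal R) (J : Ideal S)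
    (A B : Type) [AddCommGroup A] [Module R A] [AddCommGroup B] [Module S B]
    (h : ∀ k, V I k A ↔ V J k B) : cohDim I A = cohDim J B := by
  unfold cohDim
  congr 1
  ext k
  simp only [Set.mem_setOf_eq, nontriv_iff, h]

lemma isRelCM_congr {R S : Type} [CommRing R] [CommRing S] (I : Ideal R) (J : Ideal S)
    (A B : Type) [AddCommGroup A] [Module R A] [AddCommGroup B] [Module S B]
    (h : ∀ k, V I k A ↔ V J k B) (hA : IsRelCM I A) : IsRelCM J B := by
  obtain ⟨c, hc⟩ := hA
  refine ⟨c, fun i => ?_⟩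
  rw [nontriv_iff, ← h, ← nontriv_iff, hc]

section
variable {R : Type} [CommRing R] [IsNoetherianRing R] (I : Ideal R)

/-- boundedness over a flat extension -/
lemma bound_map {S : Type} [CommRing S] [Algebra R S] [Module.Flat R S] :
    ∃ m : ℕ, ∀ (N : Type) [AddCommGroup N] [Module S N], ∀ k, m < k →
      V (I.map (algebraMap R S)) k N := by
  obtain ⟨m, hm⟩ := exists_bound I
  refine ⟨m, fun N _ _ k hk => ?_⟩
  letI : Module R N := Module.compHom N (algebraMap R S)
  haveI : IsScalarTower R S N := ⟨fun r s n => by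
    rw [Algebra.smul_def, mul_smul]; rfl⟩
  exact (van_map I k N).mpr (hm N k hk)

variable (M : Type) [AddCommGroup M] [Module R M] [Module.Finite R M]

lemma exists_largest (i : ℕ) : ∃ P : Submodule R M, Vd I i P ∧
    ∀ N : Submodule R M, Vd I i N → N ≤ P := by
  obtain ⟨P, hP, hmax⟩ := WellFounded.has_min (wellFounded_gt (α := Submodule R M))
    {N | Vd I i N} ⟨⊥, fun k _ => V.zero⟩
  refine ⟨P, hP, fun N hN => ?_⟩
  have h1 : Vd I i ↥(P ⊔ N) := by
    refine V_supp I (P × N) i (fun k hk => V.mid SES.prod (hP k hk) (hN k hk)) _ ?_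
    rintro r hr ⟨n, hn⟩
    apply Subtype.ext
    obtain ⟨a, ha, b, hb, rfl⟩ := Submodule.mem_sup.mp hn
    have := Module.mem_annihilator.mp hr (⟨⟨a, ha⟩, ⟨b, hb⟩⟩ : P × N)
    have ha0 : r • a = 0 := congrArg (fun x : P × N => (x.1 : M)) this
    have hb0 : r • b = 0 := congrArg (fun x : P × N => (x.2 : M)) this
    change r • (a + b) = 0
    rw [smul_add, ha0, hb0, add_zero]
  have h2 := hmax _ h1
  by_contra h
  exact h2 (lt_of_le_of_ne le_sup_left (fun he => h (he ▸ le_sup_right)))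

variable {M}

/-- completed submodule -/
def hat (P : Submodule R M) : Submodule (AdicCompletion I R) (AdicCompletion I M) :=
  LinearMap.range (AdicCompletion.map I P.subtype)

def hatEquiv (P : Submodule R M) : AdicCompletion I P ≃ₗ[AdicCompletion I R] hat I P :=
  LinearEquiv.ofInjective _ (AdicCompletion.map_injective I P.subtype_injective)

lemma exists_psi (P P' : Submodule R M) (hle : P' ≤ P) :
    ∃ ψ : hat I P →ₗ[AdicCompletion I R]
      AdicCompletion I (P ⧸ Submodule.comap P.subtype P'),
      Function.Surjective ψ ∧ LinearMap.ker ψ = Submodule.comap (hat I P).subtype (hat I P') := by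
  let q := (Submodule.comap P.subtype P').mkQ
  have hs : SES (Submodule.inclusion hle) q := by
    refine ⟨Submodule.inclusion_injective hle, fun y => ?_, Submodule.mkQ_surjective _⟩
    rw [← LinearMap.mem_ker, Submodule.ker_mkQ]
    constructor
    · intro h; exact ⟨⟨y.1, h⟩, rfl⟩
    · rintro ⟨z, rfl⟩; exact z.2
  have hc := hs.cmap I
  refine ⟨(AdicCompletion.map I q).comp (hatEquiv I P).symm.toLinearMap, ?_, ?_⟩
  · exact hc.surj.comp (hatEquiv I P).symm.surjective
  · have hcomp : ∀ z, AdicCompletion.map I P.subtype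
        (AdicCompletion.map I (Submodule.inclusion hle) z) = AdicCompletion.map I P'.subtype z := by
      intro z
      rw [AdicCompletion.map_comp_apply]
      rfl
    ext y
    obtain ⟨u, rfl⟩ := (hatEquiv I P).surjective y
    have hval : ((hatEquiv I P u : hat I P) : AdicCompletion I M) =
      AdicCompletion.map I P.subtype u := rfl
    rw [LinearMap.mem_ker, Submodule.mem_comap]
    change AdicCompletion.map I q ((hatEquiv I P).symm (hatEquiv I P u)) = 0 ↔
      ((hatEquiv I P u : hat I P) : AdicCompletion I M) ∈ _
    rw [LinearEquiv.symm_apply_apply, hval]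
    refine (hc.ex u).trans ?_
    constructor
    · rintro ⟨z, rfl⟩
      exact ⟨z, (hcomp z).symm⟩
    · rintro ⟨z, hz⟩
      refine ⟨z, ?_⟩
      apply AdicCompletion.map_injective I P.subtype_injective
      exact (hcomp z).trans hz

lemma exists_equiv (P P' : Submodule R M) (hle : P' ≤ P)
    (G G' : Submodule (AdicCompletion I R) (AdicCompletion I M)) (hG : G = hat I P)
    (hG' : G' = hat I P') :
    Nonempty ((G ⧸ Submodule.comap G.subtype G') ≃ₗ[AdicCompletion I R]
      AdicCompletion I (P ⧸ Submodule.comap P.subtype P')) := by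
  subst hG hG'
  obtain ⟨ψ, h1, h2⟩ := exists_psi I P P' hle
  exact ⟨(Submodule.quotEquivOfEq _ _ h2.symm).trans (LinearMap.quotKerEquivOfSurjective ψ h1)⟩

lemma van_hat (k : ℕ) (A : Type) [AddCommGroup A] [Module R A] [Module.Finite R A] :
    V (I.map (algebraMap R (AdicCompletion I R))) k (AdicCompletion I A) ↔ V I k A := by
  haveI := AdicCompletion.flat_of_isNoetherian I (R := R)
  rw [van_map I k (AdicCompletion I A), ← van_compl]

theorem main (hM : IsRCMF I M) :
    IsRCMF (I.map (algebraMap R (AdicCompletion I R))) (AdicCompletion I M) := by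
  haveI := AdicCompletion.flat_of_isNoetherian I (R := R)
  have hbS := bound_map I (S := AdicCompletion I R)
  have hbR := exists_bound I
  have hcd : cohDim (I.map (algebraMap R (AdicCompletion I R))) (AdicCompletion I M)
      = cohDim I M := cohDim_congr _ _ _ _ (fun k => van_hat I k M)
  choose F hF1 hF2 using fun i => exists_largest I M i
  have hFcd : IsCdFiltration I (cohDim I M) F := fun i _ =>
    ⟨(cohDim_le_iff I hbR i _).mpr (hF1 i), fun N hN => hF2 i N ((cohDim_le_iff I hbR i _).mp hN)⟩
  have hmono : ∀ i, F (i-1) ≤ F i := fun i => hF2 i _ (fun k hk => hF1 (i-1) k (by omega))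
  have hFc : F (cohDim I M) = ⊤ := by
    rw [eq_top_iff]
    refine hF2 _ _ (fun k hk => ?_)
    exact (V.congr Submodule.topEquiv).mpr ((cohDim_le_iff I hbR _ M).mp le_rfl k hk)
  have hfac := hM F hFcd
  have hlow : ∀ i, 1 ≤ i → i ≤ cohDim I M → ∀ j < i, V I j (filtFactor F i) := by
    intro i h1 h2 j hj
    rcases hfac i h1 h2 with h | ⟨⟨c, hc⟩, h'⟩
    · exact V.zero
    · have hci : c = i := by
        rw [← h']
        unfold cohDim
        have : {k : ℕ | Nontrivial ((localCohomology I k).obj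
          (ModuleCat.of R (filtFactor F i)))} = {c} := by
          ext k; exact hc k
        rw [this]; simp
      by_contra hV
      have := (hc j).mp ((nontriv_iff I j _).mpr hV)
      omega
  intro G hG i h1 h2
  rw [hcd] at hG h2
  -- identification of the filtration
  have hle : ∀ i ≤ cohDim I M, hat I (F i) ≤ G i := by
    intro i hi
    refine (hG i hi).2 _ ((cohDim_le_iff _ hbS i _).mpr (fun k hk => ?_))
    exact (V.congr (hatEquiv I (F i))).mp ((van_hat I k (F i)).mpr (hF1 i k hk))
  have hge : ∀ i ≤ cohDim I M, G i ≤ hat I (F i) := by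
    intro i hi
    have hN : Vd (I.map (algebraMap R (AdicCompletion I R))) i (G i) :=
      (cohDim_le_iff _ hbS i _).mp (hG i hi).1
    have key : ∀ n k, i ≤ k → k + n = cohDim I M → G i ≤ hat I (F k) := by
      intro n
      induction n with
      | zero =>
        intro k hk hkn
        have : k = cohDim I M := by omega
        rw [this, hFc]
        intro x _
        obtain ⟨y, hy⟩ := AdicCompletion.map_surjective I
          (f := (⊤ : Submodule R M).subtype) (fun m => ⟨⟨m, trivial⟩, rfl⟩) x
        exact ⟨y, hy⟩
      | succ n ih =>
        intro k hk hkn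
        have h3 := ih (k+1) (by omega) (by omega)
        obtain ⟨ψ, hψ1, hψ2⟩ := exists_psi I (F (k+1)) (F (k+1-1)) (hmono (k+1))
        let φ : G i →ₗ[AdicCompletion I R] _ := ψ.comp (Submodule.inclusion h3)
        have h0 : φ.restrictScalars R = 0 := by
          refine hom_compl_zero I (j := k+1) (by omega) (fun l hl => ?_) (fun l hl => ?_) _
          · exact (van_map I l (G i)).mp (hN l (by omega))
          · haveI : Module.Finite R (filtFactor F (k+1)) :=
              inferInstanceAs (Module.Finite R (_ ⧸ Submodule.comap (F (k+1)).subtype (F (k+1-1))))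
            exact (van_compl I l _).mp (hlow (k+1) (by omega) (by omega) l hl)
        intro x hx
        have h4 : φ ⟨x, hx⟩ = 0 := LinearMap.congr_fun h0 ⟨x, hx⟩
        have h5 : (⟨x, h3 hx⟩ : hat I (F (k+1))) ∈ LinearMap.ker ψ := h4
        rw [hψ2] at h5
        exact h5
    exact key (cohDim I M - i) i le_rfl (by omega)
  have heq : ∀ i ≤ cohDim I M, G i = hat I (F i) := fun i hi => le_antisymm (hge i hi) (hle i hi)
  obtain ⟨e⟩ := exists_equiv I (F i) (F (i-1)) (hmono i) (G i) (G (i-1)) (heq i h2)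
    (heq (i-1) (by omega))
  have hV : ∀ k, V I k (filtFactor F i) ↔
      V (I.map (algebraMap R (AdicCompletion I R))) k (filtFactor G i) := by
    intro k
    have hf : Module.Finite R (F i ⧸ Submodule.comap (F i).subtype (F (i-1))) := inferInstance
    exact (van_hat I k (F i ⧸ Submodule.comap (F i).subtype (F (i-1)))).symm.trans (V.congr e).symm
  rcases hfac i h1 h2 with h | ⟨h, h'⟩
  · left
    have hs : Subsingleton (F i ⧸ Submodule.comap (F i).subtype (F (i-1))) := h
    have : Subsingleton (AdicCompletion I (F i ⧸ Submodule.comap (F i).subtype (F (i-1)))) := by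
      refine ⟨fun a b => ?_⟩
      ext n
      obtain ⟨x, hx⟩ := Submodule.mkQ_surjective _ (a.val n)
      obtain ⟨y, hy⟩ := Submodule.mkQ_surjective _ (b.val n)
      rw [← hx, ← hy, Subsingleton.elim x y]
    exact e.toEquiv.subsingleton
  · right
    exact ⟨isRelCM_congr _ _ _ _ hV h, (cohDim_congr _ _ _ _ hV).symm.trans h'⟩

end
end LC
end

/-- Proposition 2.17: if `M` is a finite RCMF `R`-module w.r.t. `𝔞`, then the `𝔞`-adic
completion `M̂` is an RCMF `R̂`-module w.r.t. `𝔞R̂`. -/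
theorem stmt17 {R : Type} [CommRing R] [IsNoetherianRing R]
    (𝔞 : Ideal R) (h𝔞 : 𝔞 ≠ ⊤)
    (M : Type) [AddCommGroup M] [Module R M] [Module.Finite R M]
    (hM : IsRCMF 𝔞 M) :
    IsRCMF (𝔞.map (algebraMap R (AdicCompletion 𝔞 R))) (AdicCompletion 𝔞 M) := by
  exact LC.main 𝔞 hM
end
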